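/- Let q > 1 be an integer and assume that every Dirichlet L-function L(s,χ) attached to a Dirichlet character χ mod q satisfies the Riemann Hypothesis. Let k > 2 be a fixed real number. Then there is a constant C depending only on k such that ∑_{χ ∈ X_q^−} |θ(1,χ)|^{2k} ≤ C · φ(q) · q^{3k/2} · (log q)^{(k−1)²}, where X_q^− is the set of odd primitive Dirichlet characters modulo q. -/

import Mathlib

open Complex Real Finset

def dirichletRH {q : ℕ} [NeZero q] (χ : DirichletCharacter ℂ q) : Prop :=
  ∀ s : ℂ, 0 < s.re → s.re < 1 → DirichletCharacter.LFunction χ s = 0 → s.re = 1 / 2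

/-- The theta function `θ(x,χ) = ∑_{n=1}^∞ χ(n) n^κ e^{-π n² x / q}` where `κ = (1-χ(-1))/2`. -/
noncomputable def dirichletTheta {q : ℕ} (χ : DirichletCharacter ℂ q) (x : ℝ) : ℂ :=
  ∑' n : ℕ, χ n * (n : ℂ) ^ (if χ (-1) = 1 then 0 else 1) *
    Complex.exp (-(Real.pi) * n ^ 2 * x / q)

/-! ### A1: polynomial bound for L-functions -/

lemma charSum_range_bound {q : ℕ} [NeZero q] {χ : DirichletCharacter ℂ q} (hχ : χ ≠ 1) (n : ℕ) :
    ‖∑ k ∈ Finset.range n, χ (k : ZMod q)‖ ≤ q := by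
  have hq : 0 < q := Nat.pos_of_ne_zero (NeZero.ne q)
  have h0 : ∑ k ∈ Finset.range q, χ (k : ZMod q) = 0 := by
    rw [← MulChar.sum_eq_zero_of_ne_one hχ]
    refine Finset.sum_bij (fun k _ => (k : ZMod q)) (by simp) ?_ ?_ (by simp)
    · intro a ha b hb hab
      rw [Finset.mem_range] at ha hb
      have := congrArg ZMod.val hab
      rwa [ZMod.val_natCast_of_lt ha, ZMod.val_natCast_of_lt hb] at this
    · intro b _
      exact ⟨b.val, by simpa using ZMod.val_lt b, by simp⟩
  have hper : ∀ n, ∑ k ∈ Finset.range (n + q), χ (k : ZMod q)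
      = ∑ k ∈ Finset.range n, χ (k : ZMod q) := by
    intro n
    induction n with
    | zero => simp [h0]
    | succ n ih =>
      rw [show n + 1 + q = (n + q) + 1 by ring, Finset.sum_range_succ, ih, Finset.sum_range_succ]
      simp
  induction n using Nat.strong_induction_on with
  | _ n ih =>
    by_cases h : n < q
    · calc _ ≤ ∑ k ∈ Finset.range n, ‖χ (k : ZMod q)‖ := norm_sum_le _ _
        _ ≤ ∑ k ∈ Finset.range n, 1 := Finset.sum_le_sum fun k _ => χ.norm_le_one _
        _ ≤ q := by simp; exact_mod_cast h.le
    · have h' : n = (n - q) + q := by omega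
      rw [h', hper]
      exact ih _ (by omega)

lemma charSum_Icc_bound {q : ℕ} [NeZero q] {χ : DirichletCharacter ℂ q} (hχ : χ ≠ 1) (n : ℕ) :
    ‖∑ k ∈ Finset.Icc 1 n, χ (k : ZMod q)‖ ≤ q := by
  have h1 : q ≠ 1 := by
    rintro rfl
    exact hχ (DirichletCharacter.level_one χ)
  have h := charSum_range_bound hχ (n + 1)
  rw [Finset.range_eq_Ico, Finset.sum_eq_sum_Ico_succ_bot (by omega)] at h
  have h0 : χ ((0 : ℕ) : ZMod q) = 0 := by
    have : Nontrivial (ZMod q) := by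
      have := ZMod.nontrivial_iff.2 h1
      exact this
    simpa using χ.map_nonunit (by simp)
  rw [h0, zero_add] at h
  exact h

noncomputable def charStep {q : ℕ} (χ : DirichletCharacter ℂ q) : ℝ → ℂ :=
  Set.indicator (Set.Ioi (1 : ℝ)) fun t => ∑ k ∈ Finset.Icc 1 ⌊t⌋₊, χ (k : ZMod q)

open MeasureTheory Filter Asymptotics Topology in
lemma LFunction_eq_mellin {q : ℕ} [NeZero q] {χ : DirichletCharacter ℂ q} (hχ : χ ≠ 1)
    {s : ℂ} (hs : 0 < s.re) :
    DirichletCharacter.LFunction χ s = s * mellin (charStep χ) (-s) := by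
  have hb : ∀ t, ‖charStep χ t‖ ≤ q := fun t => by
    unfold charStep
    by_cases h : t ∈ Set.Ioi (1 : ℝ)
    · rw [Set.indicator_of_mem h]; exact charSum_Icc_bound hχ _
    · rw [Set.indicator_of_notMem h]; simp
  have hmeas : Measurable (charStep χ) := by
    unfold charStep
    refine Measurable.indicator ?_ measurableSet_Ioi
    exact (measurable_from_nat (f := fun n => ∑ k ∈ Finset.Icc 1 n, χ (k : ZMod q))).comp
      Nat.measurable_floor
  have hloc : LocallyIntegrableOn (charStep χ) (Set.Ioi 0) := by
    apply LocallyIntegrable.locallyIntegrableOn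
    refine (locallyIntegrable_const (q : ℝ)).mono hmeas.aestronglyMeasurable ?_
    filter_upwards with t
    simpa using hb t
  have hdiff : ∀ z : ℂ, 0 < z.re → DifferentiableAt ℂ (mellin (charStep χ)) (-z) := by
    intro z hz
    refine mellin_differentiableAt_of_isBigO_rpow (a := 0) (b := -z.re - 1) hloc ?_ (by simpa using hz) ?_
      (by simp)
    · refine IsBigO.of_bound q ?_
      filter_upwards with t
      simpa using hb t
    · refine IsBigO.of_bound 1 ?_
      have : Set.Iio (1 : ℝ) ∈ 𝓝[>] (0:ℝ) := mem_nhdsWithin_of_mem_nhds (Iio_mem_nhds one_pos)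
      filter_upwards [this] with t ht
      rw [charStep, Set.indicator_of_notMem (by simpa using le_of_lt ht)]
      simp
  have hopen : IsOpen {z : ℂ | 0 < z.re} := isOpen_lt continuous_const continuous_re
  have hconn : IsPreconnected {z : ℂ | 0 < z.re} := (convex_halfSpace_re_gt 0).isPreconnected
  have ha1 : AnalyticOnNhd ℂ (DirichletCharacter.LFunction χ) {z : ℂ | 0 < z.re} :=
    ((DirichletCharacter.differentiable_LFunction hχ).differentiableOn).analyticOnNhd hopen
  have ha2 : AnalyticOnNhd ℂ (fun s => s * mellin (charStep χ) (-s)) {z : ℂ | 0 < z.re} := by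
    refine DifferentiableOn.analyticOnNhd (fun z hz => ?_) hopen
    refine (differentiableAt_id.mul ?_).differentiableWithinAt
    exact (hdiff z hz).comp z (differentiableAt_id.neg)
  refine ha1.eqOn_of_preconnected_of_eventuallyEq ha2 hconn (z₀ := 2) (by simp) ?_ hs
  have : {z : ℂ | 1 < z.re} ∈ 𝓝 (2 : ℂ) :=
    (isOpen_lt continuous_const continuous_re).mem_nhds (by simp)
  filter_upwards [this] with z hz
  have hz' : 1 < z.re := hz
  rw [DirichletCharacter.LFunction_eq_LSeries χ hz']
  rw [LSeries_eq_mul_integral (fun n => χ (n : ZMod q)) le_rfl (by linarith)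
    (DirichletCharacter.LSeriesSummable_of_one_lt_re χ hz') ?_]
  · rw [mellin]
    congr 1
    unfold charStep
    have : ∀ t : ℝ, (t:ℂ) ^ (-z - 1) • Set.indicator (Set.Ioi (1:ℝ))
        (fun t => ∑ k ∈ Finset.Icc 1 ⌊t⌋₊, χ (k : ZMod q)) t = Set.indicator (Set.Ioi (1:ℝ))
        (fun t => (∑ k ∈ Finset.Icc 1 ⌊t⌋₊, χ (k : ZMod q)) * (t:ℂ) ^ (-(z + 1))) t := by
      intro t
      by_cases ht : t ∈ Set.Ioi (1:ℝ)
      · rw [Set.indicator_of_mem ht, Set.indicator_of_mem ht, smul_eq_mul, mul_comm]; ring_nf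
      · rw [Set.indicator_of_notMem ht, Set.indicator_of_notMem ht, smul_zero]
    simp_rw [this]
    rw [setIntegral_indicator measurableSet_Ioi]
    congr 2
    ext t; simp only [Set.mem_inter_iff, Set.mem_Ioi]; grind
  · refine IsBigO.of_bound q ?_
    filter_upwards with n
    simpa using charSum_Icc_bound hχ n

open MeasureTheory in
lemma LFunction_bound {q : ℕ} [NeZero q] {χ : DirichletCharacter ℂ q} (hχ : χ ≠ 1)
    {s : ℂ} (hs : 0 < s.re) :
    ‖DirichletCharacter.LFunction χ s‖ ≤ q * ‖s‖ / s.re := by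
  rw [LFunction_eq_mellin hχ hs, norm_mul]
  have : ‖mellin (charStep χ) (-s)‖ ≤ q / s.re := by
    rw [mellin]
    have e : ∀ t : ℝ, (t:ℂ) ^ (-s - 1) • charStep χ t = Set.indicator (Set.Ioi (1:ℝ))
        (fun t => (t:ℂ) ^ (-s - 1) * ∑ k ∈ Finset.Icc 1 ⌊t⌋₊, χ (k : ZMod q)) t := by
      intro t
      unfold charStep
      by_cases ht : t ∈ Set.Ioi (1:ℝ)
      · rw [Set.indicator_of_mem ht, Set.indicator_of_mem ht, smul_eq_mul]
      · rw [Set.indicator_of_notMem ht, Set.indicator_of_notMem ht, smul_zero]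
    simp_rw [e]
    rw [setIntegral_indicator measurableSet_Ioi]
    have : Set.Ioi (0:ℝ) ∩ Set.Ioi 1 = Set.Ioi 1 := by
      ext t; simp only [Set.mem_inter_iff, Set.mem_Ioi]; grind
    rw [this]
    have hintg : IntegrableOn (fun t : ℝ => (q:ℝ) * t ^ (-s.re - 1)) (Set.Ioi 1) :=
      (integrableOn_Ioi_rpow_of_lt (by linarith) one_pos).const_mul _
    refine (norm_integral_le_of_norm_le hintg ?_).trans ?_
    · refine (ae_restrict_iff' measurableSet_Ioi).2 (Filter.Eventually.of_forall fun t ht => ?_)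
      have ht0 : 0 < t := lt_trans one_pos ht
      rw [norm_mul, norm_cpow_eq_rpow_re_of_pos ht0, mul_comm]
      simp only [sub_re, neg_re, one_re]
      gcongr
      exact charSum_Icc_bound hχ _
    · rw [integral_const_mul, integral_Ioi_rpow_of_lt (by linarith) one_pos]
      simp; field_simp; simp
  calc _ ≤ ‖s‖ * (q / s.re) := by gcongr
    _ = _ := by ring

/-! ### A2: logarithm of L -/

lemma differentiableAt_of_exp_eq {ℓ g : ℂ → ℂ} {s : ℂ} (hc : ContinuousAt ℓ s)
    (hg : DifferentiableAt ℂ g s) (h : ∀ᶠ z in nhds s, Complex.exp (ℓ z) = g z) :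
    DifferentiableAt ℂ ℓ s := by
  have h0 : Complex.exp (ℓ s) = g s := h.self_of_nhds
  have hne : g s ≠ 0 := h0 ▸ Complex.exp_ne_zero _
  have h1 : ∀ᶠ z in nhds s, ‖ℓ z - ℓ s‖ < 1 := by
    have := Metric.continuousAt_iff'.1 hc 1 one_pos
    simpa [dist_eq_norm] using this
  have h2 : ℓ =ᶠ[nhds s] fun z => ℓ s + Complex.log (g z / g s) := by
    filter_upwards [h, h1] with z hz hz1
    rw [← hz, ← h0, ← Complex.exp_sub, Complex.log_exp]
    · ring
    · have := (abs_le.1 (Complex.abs_im_le_norm (ℓ z - ℓ s))).1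
      linarith [Real.pi_gt_three]
    · have := (abs_le.1 (Complex.abs_im_le_norm (ℓ z - ℓ s))).2
      linarith [Real.pi_gt_three]
  refine DifferentiableAt.congr_of_eventuallyEq ?_ h2
  refine (DifferentiableAt.clog (hg.div_const _) ?_).const_add _
  rw [div_self hne]
  exact Complex.one_mem_slitPlane

noncomputable def logCoef {q : ℕ} (χ : DirichletCharacter ℂ q) (n : ℕ) : ℂ :=
  χ (n : ZMod q) * (ArithmeticFunction.vonMangoldt n / Real.log n : ℝ)

lemma vonMangoldt_div_log_le_one (n : ℕ) :
    |ArithmeticFunction.vonMangoldt n / Real.log n| ≤ 1 := by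
  rw [abs_of_nonneg (div_nonneg ArithmeticFunction.vonMangoldt_nonneg (Real.log_natCast_nonneg n))]
  exact div_le_one_of_le₀ ArithmeticFunction.vonMangoldt_le_log (Real.log_natCast_nonneg n)

lemma norm_logCoef_le {q : ℕ} (χ : DirichletCharacter ℂ q) (n : ℕ) : ‖logCoef χ n‖ ≤ 1 := by
  rw [logCoef, norm_mul, Complex.norm_real]
  exact mul_le_one₀ (χ.norm_le_one _) (norm_nonneg _) (vonMangoldt_div_log_le_one n)

lemma abscissa_logCoef {q : ℕ} (χ : DirichletCharacter ℂ q) :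
    LSeries.abscissaOfAbsConv (logCoef χ) ≤ 1 :=
  LSeries.abscissaOfAbsConv_le_of_le_const ⟨1, fun n _ => norm_logCoef_le χ n⟩

lemma abscissa_logCoef_lt {q : ℕ} (χ : DirichletCharacter ℂ q) {s : ℂ} (hs : 1 < s.re) :
    LSeries.abscissaOfAbsConv (logCoef χ) < s.re :=
  (abscissa_logCoef χ).trans_lt (by exact_mod_cast hs)

lemma LSeries_logCoef_hasDerivAt {q : ℕ} [NeZero q] (χ : DirichletCharacter ℂ q) {s : ℂ}
    (hs : 1 < s.re) : HasDerivAt (LSeries (logCoef χ))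
      (deriv (DirichletCharacter.LFunction χ) s / DirichletCharacter.LFunction χ s) s := by
  have h1 := LSeries_hasDerivAt (abscissa_logCoef_lt χ hs)
  convert h1 using 1
  have h2 := DirichletCharacter.LSeries_twist_vonMangoldt_eq χ hs
  have h3 : LSeries (LSeries.logMul (logCoef χ)) s =
      LSeries ((fun n : ℕ => χ (n : ZMod q)) * fun n : ℕ => (ArithmeticFunction.vonMangoldt n : ℂ)) s := by
    refine LSeries_congr (fun {n} hn => ?_) s
    simp only [LSeries.logMul, logCoef, Pi.mul_apply]
    rw [Complex.ofReal_div, ← Complex.natCast_log]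
    by_cases h1 : n = 1
    · simp [h1]
    · have : (Real.log n : ℂ) ≠ 0 := by
        have : 0 < Real.log n := Real.log_pos (by
          have : 2 ≤ n := by omega
          exact_mod_cast this)
        exact_mod_cast this.ne'
      field_simp
  rw [h3, h2, DirichletCharacter.LFunction_eq_LSeries χ hs,
    DirichletCharacter.deriv_LFunction_eq_deriv_LSeries χ hs]
  ring

/-- data of the holomorphic logarithm of L on Re > 1/2 -/
structure IsLogL {q : ℕ} [NeZero q] (χ : DirichletCharacter ℂ q) (ℓ : ℂ → ℂ) : Prop where
  diff : DifferentiableOn ℂ ℓ {s : ℂ | 1 / 2 < s.re}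
  exp_eq : ∀ s : ℂ, 1 / 2 < s.re → Complex.exp (ℓ s) = DirichletCharacter.LFunction χ s
  eq_series : ∀ s : ℂ, 1 < s.re → ℓ s = LSeries (logCoef χ) s

lemma isOpen_half (c : ℝ) : IsOpen {s : ℂ | c < s.re} := isOpen_lt continuous_const continuous_re

open Filter Topology in
lemma exists_logL {q : ℕ} [NeZero q] {χ : DirichletCharacter ℂ q} (hχ : χ ≠ 1)
    (hne : ∀ s : ℂ, 1 / 2 < s.re → DirichletCharacter.LFunction χ s ≠ 0) :
    ∃ ℓ : ℂ → ℂ, IsLogL χ ℓ := by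
  set U : Set ℂ := {s : ℂ | 1 / 2 < s.re}
  have hU : IsOpen U := isOpen_half _
  have hsc : IsSimplyConnected U := by
    have : ContractibleSpace U := (convex_halfSpace_re_gt (1/2)).contractibleSpace ⟨1, by norm_num⟩
    exact (inferInstance : SimplyConnectedSpace U)
  have hL := DirichletCharacter.differentiable_LFunction hχ
  obtain ⟨ℓ, hc, he⟩ := exists_continuousOn_eqOn_exp_comp hsc hU (g := DirichletCharacter.LFunction χ)
    hL.continuous.continuousOn (by rintro ⟨s, hs, h0⟩; exact hne s hs h0)
  have hd : ∀ s ∈ U, DifferentiableAt ℂ ℓ s := fun s hs =>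
    differentiableAt_of_exp_eq (hc.continuousAt (hU.mem_nhds hs)) (hL s)
      (by filter_upwards [hU.mem_nhds hs] with z hz using he hz)
  have hderiv : ∀ s ∈ U, deriv ℓ s
      = deriv (DirichletCharacter.LFunction χ) s / DirichletCharacter.LFunction χ s := by
    intro s hs
    have h1 : HasDerivAt (fun z => Complex.exp (ℓ z)) (Complex.exp (ℓ s) * deriv ℓ s) s :=
      (hd s hs).hasDerivAt.cexp
    have h2 : (fun z => Complex.exp (ℓ z)) =ᶠ[𝓝 s] DirichletCharacter.LFunction χ := by
      filter_upwards [hU.mem_nhds hs] with z hz using he hz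
    have h3 := (h1.congr_of_eventuallyEq h2.symm).deriv
    have h4 : Complex.exp (ℓ s) = DirichletCharacter.LFunction χ s := he hs
    rw [h3, h4, mul_div_cancel_left₀ _ (hne s hs)]
  obtain ⟨a, ha⟩ := (isOpen_half 1).exists_is_const_of_deriv_eq_zero
    (convex_halfSpace_re_gt 1).isPreconnected (f := fun s => ℓ s - LSeries (logCoef χ) s)
    (fun s hs => ((hd s (lt_trans (by norm_num) (show (1:ℝ) < s.re from hs))).sub
        (LSeries_logCoef_hasDerivAt χ hs).differentiableAt).differentiableWithinAt)
    (fun s hs => by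
      have hs' : s ∈ U := lt_trans (by norm_num) (show (1:ℝ) < s.re from hs)
      have h := (hd s hs').hasDerivAt.sub (LSeries_logCoef_hasDerivAt χ hs)
      have := h.deriv
      rw [hderiv s hs', sub_self] at this
      exact this)
  have hexp : Complex.exp a = 1 := by
    have h1 : Tendsto (fun x : ℝ => Complex.exp (LSeries (logCoef χ) x)) atTop (𝓝 1) := by
      have := LSeries.tendsto_atTop ((abscissa_logCoef χ).trans_lt (by exact_mod_cast EReal.coe_lt_top 1))
      have h := (Complex.continuous_exp.tendsto _).comp this
      simpa [logCoef, Function.comp_def] using h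
    have h2 : Tendsto (fun x : ℝ => LSeries (fun n : ℕ => χ (n : ZMod q)) x) atTop (𝓝 1) := by
      have := LSeries.tendsto_atTop (f := fun n : ℕ => χ (n : ZMod q)) (by
        rw [DirichletCharacter.absicssaOfAbsConv_eq_one (NeZero.ne q)]
        exact_mod_cast EReal.coe_lt_top 1)
      simpa using this
    have h3 : Tendsto (fun x : ℝ => Complex.exp a * Complex.exp (LSeries (logCoef χ) x)) atTop (𝓝 1) := by
      refine h2.congr' ?_
      filter_upwards [eventually_gt_atTop 1] with x hx
      have hx' : 1 < (x : ℂ).re := by simpa using hx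
      rw [← Complex.exp_add, ← DirichletCharacter.LFunction_eq_LSeries χ hx', ← he (by
        show 1 / 2 < (x:ℂ).re
        linarith), Function.comp_apply]
      congr 1
      have := ha (x : ℂ) hx'
      linear_combination this
    have h4 := tendsto_nhds_unique h3 (h1.const_mul (Complex.exp a))
    simpa using h4.symm
  refine ⟨fun s => ℓ s - a, ?_, ?_, ?_⟩
  · exact fun s hs => ((hd s hs).sub_const a).differentiableWithinAt
  · intro s hs
    rw [Complex.exp_sub, hexp, div_one]
    exact he hs
  · intro s hs
    have := ha s hs
    linear_combination this

lemma LFunction_ne_zero_of_RH {q : ℕ} [NeZero q] {χ : DirichletCharacter ℂ q} (hχ : χ ≠ 1)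
    (h : dirichletRH χ) (s : ℂ) (hs : 1 / 2 < s.re) : DirichletCharacter.LFunction χ s ≠ 0 := by
  intro h0
  rcases lt_or_ge s.re 1 with h1 | h1
  · have := h s (by linarith) h1 h0
    linarith
  · exact DirichletCharacter.LFunction_ne_zero_of_one_le_re χ (Or.inl hχ) h1 h0

/-! ### A3: growth of log L -/

noncomputable def MM (q : ℕ) (t : ℝ) : ℝ := Real.log q + Real.log (2 + |t|)

lemma two_le_q {q : ℕ} [NeZero q] {χ : DirichletCharacter ℂ q} (hχ : χ ≠ 1) : 2 ≤ q := by
  have h1 : q ≠ 1 := by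
    rintro rfl
    exact hχ (DirichletCharacter.level_one χ)
  have := NeZero.ne q
  omega

lemma MM_ge {q : ℕ} (hq : 2 ≤ q) (t : ℝ) : Real.log 4 ≤ MM q t := by
  unfold MM
  have h2 : Real.log 2 ≤ Real.log q := Real.log_le_log (by norm_num) (by exact_mod_cast hq)
  have h3 : Real.log 2 ≤ Real.log (2 + |t|) :=
    Real.log_le_log (by norm_num) (by linarith [abs_nonneg t])
  have : Real.log 4 = 2 * Real.log 2 := by
    rw [show (4:ℝ) = 2 ^ 2 by norm_num, Real.log_pow]; norm_num
  linarith

lemma log4_gt : (1:ℝ) < Real.log 4 := by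
  have : Real.log 4 = 2 * Real.log 2 := by
    rw [show (4:ℝ) = 2 ^ 2 by norm_num, Real.log_pow]; norm_num
  rw [this]; linarith [Real.log_two_gt_d9]

lemma MM_gt_one {q : ℕ} (hq : 2 ≤ q) (t : ℝ) : 1 < MM q t := log4_gt.trans_le (MM_ge hq t)

lemma norm_LSeries_logCoef_le {q : ℕ} (χ : DirichletCharacter ℂ q) {s : ℂ} (hs : 2 ≤ s.re) :
    ‖LSeries (logCoef χ) s‖ ≤ 2 := by
  unfold LSeries
  have h2 := hasSum_zeta_two
  have hb : ∀ n, ‖LSeries.term (logCoef χ) s n‖ ≤ 1 / (n : ℝ) ^ 2 := by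
    intro n
    rcases eq_or_ne n 0 with rfl | hn
    · simp
    · rw [LSeries.norm_term_eq, if_neg hn]
      have hn1 : (1:ℝ) ≤ n := by exact_mod_cast Nat.one_le_iff_ne_zero.2 hn
      have : (n:ℝ) ^ 2 ≤ (n:ℝ) ^ s.re := by
        rw [← Real.rpow_natCast]
        exact Real.rpow_le_rpow_of_exponent_le hn1 (by simpa using hs)
      gcongr
      exact norm_logCoef_le χ n
  refine (tsum_of_norm_bounded h2 hb).trans ?_
  nlinarith [Real.pi_lt_d2, Real.pi_pos]

lemma IsLogL.re_eq {q : ℕ} [NeZero q] {χ : DirichletCharacter ℂ q} {ℓ : ℂ → ℂ} (h : IsLogL χ ℓ)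
    {s : ℂ} (hs : 1 / 2 < s.re) : (ℓ s).re = Real.log ‖DirichletCharacter.LFunction χ s‖ := by
  rw [← h.exp_eq s hs, Complex.norm_exp, Real.log_exp]

lemma IsLogL.norm_le {q : ℕ} [NeZero q] {χ : DirichletCharacter ℂ q} (hχ : χ ≠ 1) {ℓ : ℂ → ℂ}
    (h : IsLogL χ ℓ) {ε : ℝ} (hε : 0 < ε) (hε1 : ε ≤ 1) {s : ℂ} (hs : 1 / 2 + ε ≤ s.re) :
    ‖ℓ s‖ ≤ 30 / ε * MM q s.im := by
  have hq := two_le_q hχ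
  have hM := MM_gt_one hq s.im
  have hM4 := MM_ge hq s.im
  rcases le_or_gt 2 s.re with h2 | h2
  · rw [h.eq_series s (by linarith)]
    refine (norm_LSeries_logCoef_le χ h2).trans ?_
    have : 30 ≤ 30 / ε := by rw [le_div_iff₀ hε]; linarith
    nlinarith
  set t := s.im
  set c : ℂ := ⟨2, t⟩
  set R : ℝ := 3 / 2 - ε / 2
  have hball : ∀ z ∈ Metric.ball (0 : ℂ) R, 1 / 2 < (c + z).re ∧ ‖c + z‖ ≤ 4 + |t| := by
    intro z hz
    rw [mem_ball_zero_iff] at hz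
    have h1 := (abs_le.1 (Complex.abs_re_le_norm z)).1
    constructor
    · simp only [add_re, c]; simp only [R] at hz; linarith
    · calc ‖c + z‖ ≤ ‖c‖ + ‖z‖ := norm_add_le _ _
        _ ≤ (|2| + |t|) + 3 / 2 := by
          gcongr
          · exact Complex.norm_le_abs_re_add_abs_im c
          · simp only [R] at hz; linarith
        _ ≤ _ := by norm_num; linarith
  have hd : DifferentiableOn ℂ (fun z => ℓ (c + z)) (Metric.ball 0 R) :=
    h.diff.comp (by fun_prop) fun z hz => (hball z hz).1
  have hmaps : Set.MapsTo (fun z => ℓ (c + z)) (Metric.ball 0 R) {z | z.re ≤ 3 * MM q t} := by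
    intro z hz
    obtain ⟨h1, h2⟩ := hball z hz
    show (ℓ (c + z)).re ≤ _
    rw [h.re_eq h1]
    have hL := LFunction_bound hχ (s := c + z) (by linarith)
    have hqp : (0:ℝ) < q := by positivity
    have h3 : ‖DirichletCharacter.LFunction χ (c + z)‖ ≤ q * (4 * (2 + |t|)) := by
      refine hL.trans ?_
      rw [div_le_iff₀ (by linarith), mul_assoc]
      gcongr
      have := abs_nonneg t
      nlinarith
    have hne : 0 < ‖DirichletCharacter.LFunction χ (c + z)‖ := by
      rw [← h.exp_eq _ h1]; simp
    refine (Real.log_le_log hne h3).trans ?_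
    have h2t : 0 < 2 + |t| := by positivity
    rw [Real.log_mul hqp.ne' (by positivity), Real.log_mul (by norm_num) h2t.ne']
    have : MM q t = Real.log q + Real.log (2 + |t|) := rfl
    linarith
  have hsz : ‖s - c‖ ≤ 3 / 2 - ε := by
    have : s - c = ((s.re - 2 : ℝ) : ℂ) := by
      apply Complex.ext <;> simp [c, t]
    rw [this, Complex.norm_real, Real.norm_eq_abs, abs_of_neg (by linarith)]
    linarith
  have hmem : s - c ∈ Metric.ball (0:ℂ) R := by
    rw [mem_ball_zero_iff]; simp only [R]; linarith
  have := Complex.borelCaratheodory (f := fun z => ℓ (c + z)) (by linarith : 0 < 3 * MM q t) hd hmaps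
    (by simp only [R]; linarith) hmem
  simp only [add_zero, add_sub_cancel] at this
  have hc2 : ‖ℓ c‖ ≤ 2 := by
    rw [h.eq_series c (by simp [c])]
    exact norm_LSeries_logCoef_le χ (by simp [c])
  refine this.trans ?_
  have hn := norm_nonneg (s - c)
  have hden : ε / 2 ≤ R - ‖s - c‖ := by simp only [R]; linarith
  have e1 : 2 * (3 * MM q t) * ‖s - c‖ / (R - ‖s - c‖) ≤ 2 * (3 * MM q t) * (3/2) / (ε / 2) := by
    gcongr
    linarith
  have e2 : ‖ℓ c‖ * (R + ‖s - c‖) / (R - ‖s - c‖) ≤ 2 * 3 / (ε / 2) := by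
    gcongr <;> (simp only [R]; linarith)
  have e3 : 2 * (3 * MM q t) * (3/2) / (ε / 2) = 18 * MM q t / ε := by field_simp; ring
  have e4 : (2:ℝ) * 3 / (ε / 2) = 12 / ε := by field_simp; ring
  have e5 : 12 / ε ≤ 12 * MM q t / ε := by gcongr; linarith
  calc _ ≤ 18 * MM q t / ε + 12 * MM q t / ε := by linarith
    _ = _ := by ring

/-! ### A5: reflection inequality -/

lemma MM_add_le {q : ℕ} (t y : ℝ) : MM q (t + y) ≤ MM q t + |y| := by
  unfold MM
  have h1 : 2 + |t + y| ≤ (2 + |t|) * (1 + |y|) := by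
    have := abs_add_le t y
    nlinarith [abs_nonneg t, abs_nonneg y]
  have h2 : Real.log (2 + |t + y|) ≤ Real.log (2 + |t|) + Real.log (1 + |y|) := by
    rw [← Real.log_mul (by positivity) (by positivity)]
    exact Real.log_le_log (by positivity) h1
  have h3 : Real.log (1 + |y|) ≤ |y| := by
    have := Real.log_le_sub_one_of_pos (show 0 < 1 + |y| by positivity)
    linarith
  linarith

lemma LFunction_bound_MM {q : ℕ} [NeZero q] {χ : DirichletCharacter ℂ q} (hχ : χ ≠ 1)
    {s : ℂ} (hs : 1 / 10 ≤ s.re) :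
    ‖DirichletCharacter.LFunction χ s‖ ≤ Real.exp (4 * MM q s.im) := by
  have hq := two_le_q hχ
  have hqp : (0:ℝ) < q := by positivity
  have h4 := MM_ge hq s.im
  refine (LFunction_bound hχ (by linarith)).trans ?_
  have h1 : ‖s‖ ≤ |s.re| + |s.im| := Complex.norm_le_abs_re_add_abs_im s
  rw [abs_of_pos (by linarith : 0 < s.re)] at h1
  have h2 : (q:ℝ) * ‖s‖ / s.re ≤ q * (64 * (2 + |s.im|)) := by
    rw [div_le_iff₀ (by linarith), mul_assoc]
    gcongr
    have := abs_nonneg s.im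
    nlinarith
  refine h2.trans ?_
  have h3 : (q:ℝ) * (64 * (2 + |s.im|)) = Real.exp (Real.log 64 + MM q s.im) := by
    unfold MM
    rw [Real.exp_add, Real.exp_add, Real.exp_log (by norm_num), Real.exp_log hqp,
      Real.exp_log (by positivity)]
    ring
  rw [h3]
  gcongr
  have : Real.log 64 = 3 * Real.log 4 := by
    rw [show (64:ℝ) = 4 ^ 3 by norm_num, Real.log_pow]; norm_num
  linarith

open Filter Asymptotics in
lemma LFunction_reflect {q : ℕ} [NeZero q] {χ : DirichletCharacter ℂ q} (hχ : χ ≠ 1) {ℓ : ℂ → ℂ}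
    (h : IsLogL χ ℓ) {c x : ℝ} (hc : 1 / 2 < c) (hx : 0 ≤ x) (hx1 : x ≤ 2 / 5) (t : ℝ) :
    ‖DirichletCharacter.LFunction χ ⟨c - x, t⟩‖ ≤
      Real.exp (5000 * x * MM q t) * ‖DirichletCharacter.LFunction χ ⟨c + x, t⟩‖ := by
  have hq := two_le_q hχ
  have hM := MM_gt_one hq t
  have hL := DirichletCharacter.differentiable_LFunction hχ
  set s₀ : ℂ := ⟨c, t⟩ with hs₀
  set B : ℝ := 5000 * MM q t with hB
  set Ls : ℂ → ℂ := fun z => (starRingEnd ℂ) (DirichletCharacter.LFunction χ (s₀ - (starRingEnd ℂ) z))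
    with hLs
  set g : ℂ → ℂ := fun z => Ls z * Complex.exp (-ℓ (s₀ + z)) * Complex.exp (z ^ 2 - B * z) with hg
  have hLsd : Differentiable ℂ Ls := by
    have h1 : Differentiable ℂ (fun w => DirichletCharacter.LFunction χ (s₀ - w)) := by
      exact hL.comp (by fun_prop)
    intro z
    have := (h1 ((starRingEnd ℂ) z)).hasDerivAt.star_conj
    simp only [Complex.conj_conj] at this
    exact this.differentiableAt
  have hgd : DifferentiableOn ℂ g {z | (1 / 2 - c : ℝ) < z.re} := by
    have h2 : DifferentiableOn ℂ (fun z => ℓ (s₀ + z)) {z | (1 / 2 - c : ℝ) < z.re} := by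
      refine h.diff.comp (by fun_prop) fun z hz => ?_
      have : (1 / 2 - c : ℝ) < z.re := hz
      show 1 / 2 < (s₀ + z).re
      simp only [add_re, hs₀]; linarith
    refine (hLsd.differentiableOn.mul h2.neg.cexp).mul ?_
    fun_prop
  -- norm computations
  have hnorm : ∀ z : ℂ, ‖g z‖ = ‖DirichletCharacter.LFunction χ ⟨c - z.re, t + z.im⟩‖ *
      Real.exp (-(ℓ ⟨c + z.re, t + z.im⟩).re) * Real.exp (z.re ^ 2 - z.im ^ 2 - B * z.re) := by
    intro z
    simp only [hg, hLs, norm_mul, Complex.norm_exp, RCLike.norm_conj]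
    have e1 : s₀ - (starRingEnd ℂ) z = ⟨c - z.re, t + z.im⟩ := by
      apply Complex.ext <;> simp [hs₀]
    have e2 : s₀ + z = ⟨c + z.re, t + z.im⟩ := by
      apply Complex.ext <;> simp [hs₀]
    rw [e1, e2]
    congr 2
    simp [pow_two]
  have hgen : ∀ (ε : ℝ), 0 < ε → ε ≤ 1 → ∀ z : ℂ, 0 ≤ z.re → z.re ≤ 2 / 5 → 1 / 2 + ε ≤ c + z.re →
      ‖g z‖ ≤ Real.exp ((4 + 30 / ε) * (MM q t + |z.im|) + (z.re ^ 2 - z.im ^ 2 - B * z.re)) := by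
    intro ε hε hε1 z hz0 hz1 hzc
    rw [hnorm, Real.exp_add, add_mul, Real.exp_add]
    gcongr
    · refine (LFunction_bound_MM hχ (by show 1 / 10 ≤ c - z.re; linarith)).trans ?_
      gcongr
      exact MM_add_le _ _
    · have := h.norm_le hχ hε hε1 (s := ⟨c + z.re, t + z.im⟩) hzc
      have h3 := (abs_le.1 (Complex.abs_re_le_norm (ℓ ⟨c + z.re, t + z.im⟩))).1
      have h4 : 30 / ε * MM q (t + z.im) ≤ 30 / ε * (MM q t + |z.im|) := by
        gcongr
        exact MM_add_le _ _
      simp only at this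
      linarith
  have hPL : ‖g (x : ℂ)‖ ≤ 1 := by
    refine PhragmenLindelof.vertical_strip (a := 0) (b := 2 / 5) (f := g) ?_ ?_ ?_ ?_ (by simpa using hx)
      (by simpa using hx1)
    · refine (hgd.mono ?_).diffContOnCl
      refine (closure_mono (Set.preimage_mono Set.Ioo_subset_Icc_self)).trans ?_
      rw [(isClosed_Icc.preimage continuous_re).closure_eq]
      intro z hz
      have : 0 ≤ z.re := hz.1
      show (1 / 2 - c : ℝ) < z.re
      linarith
    · refine ⟨1, ?_, ?_⟩
      · rw [lt_div_iff₀ (by norm_num)]; linarith [Real.pi_gt_three]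
      set ε := min (c - 1 / 2) 1
      have hε : 0 < ε := lt_min (by linarith) one_pos
      refine ⟨(4 + 30 / ε) * (MM q t + 1) + 1, ?_⟩
      refine IsBigO.of_bound 1 ?_
      refine Filter.Eventually.filter_mono inf_le_right ?_
      rw [Filter.eventually_principal]
      intro z hz
      have hz0 : 0 < z.re := hz.1
      have hz1 : z.re < 2 / 5 := hz.2
      rw [one_mul, Real.norm_eq_abs, Real.abs_exp]
      refine (hgen ε hε (min_le_right _ _) z hz0.le hz1.le
        (by have := min_le_left (c - 1/2) 1; linarith)).trans ?_
      gcongr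
      have h5 : |z.im| + 1 ≤ Real.exp (1 * |z.im|) := by rw [one_mul]; exact Real.add_one_le_exp _
      set E := Real.exp (1 * |z.im|)
      have h6 : MM q t + |z.im| ≤ (MM q t + 1) * E := by nlinarith [abs_nonneg z.im]
      have h7 : 0 ≤ 4 + 30 / ε := by positivity
      have h8 : 0 ≤ B * z.re := by positivity
      have h9 : 1 ≤ E := by linarith [abs_nonneg z.im]
      have := mul_le_mul_of_nonneg_left h6 h7
      nlinarith [sq_nonneg z.im]
    · intro z hz
      rw [hnorm, hz, sub_zero, add_zero, ← h.exp_eq _ (by show 1 / 2 < c; exact hc), Complex.norm_exp,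
        ← Real.exp_add, ← Real.exp_add]
      refine Real.exp_le_one_iff.2 ?_
      nlinarith [sq_nonneg z.im]
    · intro z hz
      refine (hgen (2/5) (by norm_num) (by norm_num) z (by rw [hz]; norm_num) hz.le
        (by rw [hz]; linarith)).trans (Real.exp_le_one_iff.2 ?_)
      rw [hz]
      have : z.im ^ 2 = |z.im| ^ 2 := (sq_abs _).symm
      rw [this, hB]
      nlinarith [sq_nonneg (|z.im| - 79/2)]
  rw [hnorm] at hPL
  simp only [ofReal_re, ofReal_im, add_zero] at hPL
  have hne : 1 / 2 < (⟨c + x, t⟩ : ℂ).re := by show 1 / 2 < c + x; linarith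
  rw [← h.exp_eq _ hne, Complex.norm_exp, ← Real.exp_add]
  rw [mul_assoc, ← Real.exp_add] at hPL
  have h10 := (le_div_iff₀ (Real.exp_pos _)).2 hPL
  rw [one_div, ← Real.exp_neg] at h10
  refine h10.trans ?_
  gcongr
  rw [hB]
  nlinarith [sq_nonneg x]

/-! ### A6: Schwarz-Pick in a half-plane; lower bound for the derivative -/

lemma halfplane_schwarz_pick {G : ℂ → ℂ} {b : ℝ}
    (hG : DifferentiableOn ℂ G {s : ℂ | b < s.re})
    (hpos : ∀ s : ℂ, b < s.re → 0 < (G s).re) {s s₀ : ℂ} (hs : b < s.re) (hs₀ : b < s₀.re) :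
    ‖G s - G s₀‖ ≤ (G s₀).re * (‖s - s₀‖ * ‖s + (starRingEnd ℂ) s₀ - 2 * b‖) /
      ((s.re - b) * (s₀.re - b)) := by
  set F := (G s₀).re with hF
  have hFpos : 0 < F := hpos _ hs₀
  set x₀ := s₀.re - b with hx₀
  have hx₀p : 0 < x₀ := by simp only [hx₀]; linarith
  set x := s.re - b with hx
  have hxp : 0 < x := by simp only [hx]; linarith
  -- the disc parametrisation
  set Z : ℂ → ℂ := fun w => (s₀ + ((starRingEnd ℂ) s₀ - 2 * b) * w) / (1 - w) with hZ
  have hw1 : ∀ w ∈ Metric.ball (0:ℂ) 1, (1 - w) ≠ 0 := by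
    intro w hw h0
    have : w = 1 := by linear_combination -h0
    rw [this] at hw; simp at hw
  have hZre : ∀ w ∈ Metric.ball (0:ℂ) 1, b < (Z w).re := by
    intro w hw
    have h1 := hw1 w hw
    have hn : 0 < Complex.normSq (1 - w) := Complex.normSq_pos.2 h1
    have hw' : Complex.normSq w < 1 := by
      rw [Complex.normSq_eq_norm_sq]
      have : ‖w‖ < 1 := by simpa using hw
      nlinarith [norm_nonneg w]
    have e : (Z w).re - b = x₀ * (1 - Complex.normSq w) / Complex.normSq (1 - w) := by
      simp only [hZ, Complex.div_re]
      field_simp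
      simp only [Complex.normSq_apply, hx₀, add_re, mul_re, sub_re, conj_re, conj_im, add_im, mul_im,
        sub_im, one_re, one_im, ofReal_re, ofReal_im, re_ofNat, im_ofNat]
      ring
    have : 0 < (Z w).re - b := by
      rw [e]; apply div_pos _ hn; apply mul_pos hx₀p; linarith
    linarith
  set φ : ℂ → ℂ := fun w => (G (Z w) - G s₀) / (G (Z w) + (starRingEnd ℂ) (G s₀)) with hφ
  have hden : ∀ w ∈ Metric.ball (0:ℂ) 1, G (Z w) + (starRingEnd ℂ) (G s₀) ≠ 0 := by
    intro w hw h0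
    have h1 := hpos _ (hZre w hw)
    have := congrArg Complex.re h0
    simp at this
    linarith
  have hφd : DifferentiableOn ℂ φ (Metric.ball 0 1) := by
    have hZd : DifferentiableOn ℂ Z (Metric.ball 0 1) := by
      intro w hw
      have := hw1 w hw
      exact (DifferentiableAt.div (by fun_prop) (by fun_prop) this).differentiableWithinAt
    have hGZ : DifferentiableOn ℂ (fun w => G (Z w)) (Metric.ball 0 1) :=
      hG.comp hZd fun w hw => hZre w hw
    exact (hGZ.sub_const _).div (hGZ.add_const _) hden
  have hφm : Set.MapsTo φ (Metric.ball 0 1) (Metric.closedBall 0 1) := by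
    intro w hw
    rw [mem_closedBall_zero_iff, hφ]
    simp only [norm_div]
    apply div_le_one_of_le₀ _ (norm_nonneg _)
    apply le_of_sq_le_sq _ (norm_nonneg _)
    rw [← Complex.normSq_eq_norm_sq, ← Complex.normSq_eq_norm_sq]
    have h1 := hpos _ (hZre w hw)
    simp only [Complex.normSq_apply, sub_re, sub_im, add_re, add_im, conj_re, conj_im]
    rw [← hF]
    nlinarith
  have hZ0 : Z 0 = s₀ := by simp [hZ]
  have hφ0 : φ 0 = 0 := by simp [hφ, hZ0]
  set D := ‖s + (starRingEnd ℂ) s₀ - 2 * b‖ with hD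
  have hsq : D ^ 2 - ‖s - s₀‖ ^ 2 = 4 * x * x₀ := by
    rw [hD, ← Complex.normSq_eq_norm_sq, ← Complex.normSq_eq_norm_sq]
    simp only [Complex.normSq_apply, sub_re, sub_im, add_re, add_im, conj_re, conj_im, hx, hx₀,
      mul_re, mul_im, ofReal_re, ofReal_im, re_ofNat, im_ofNat]
    ring
  have hlt : ‖s - s₀‖ < D := by
    apply lt_of_pow_lt_pow_left₀ 2 (norm_nonneg _)
    nlinarith [mul_pos hxp hx₀p]
  have hDpos : 0 < D := (norm_nonneg _).trans_lt hlt
  set den := s + (starRingEnd ℂ) s₀ - 2 * b with hden'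
  have hdne : den ≠ 0 := by rw [← norm_pos_iff]; exact hDpos
  set w := (s - s₀) / den with hw
  have hwn : ‖w‖ = ‖s - s₀‖ / D := by rw [hw, norm_div]
  have hwlt : ‖w‖ < 1 := by rw [hwn, div_lt_one hDpos]; exact hlt
  have hwb : w ∈ Metric.ball (0:ℂ) 1 := by simpa using hwlt
  have hZw : Z w = s := by
    have h1 := hw1 w hwb
    simp only [hZ]
    rw [div_eq_iff h1, hw]
    field_simp
    rw [hden']; ring
  have hS := Complex.norm_le_norm_of_mapsTo_ball hφd hφm hφ0 hwlt
  have hne := hden w hwb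
  rw [hZw] at hne
  have hφw : φ w = (G s - G s₀) / (G s + (starRingEnd ℂ) (G s₀)) := by simp only [hφ, hZw]
  have hkey : G s - G s₀ = φ w * ((G s - G s₀) + (2 * F : ℝ)) := by
    rw [hφw]
    have : (G s - G s₀) + ((2 * F : ℝ) : ℂ) = G s + (starRingEnd ℂ) (G s₀) := by
      have := Complex.add_conj (G s₀)
      rw [← hF] at this
      rw [← this]; ring
    rw [this, div_mul_cancel₀ _ hne]
  have hn1 : ‖G s - G s₀‖ ≤ ‖w‖ * (‖G s - G s₀‖ + 2 * F) := by
    calc ‖G s - G s₀‖ = ‖φ w‖ * ‖(G s - G s₀) + (2 * F : ℝ)‖ := by rw [← norm_mul, ← hkey]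
      _ ≤ ‖w‖ * (‖G s - G s₀‖ + 2 * F) := by
        gcongr
        refine (norm_add_le _ _).trans ?_
        rw [Complex.norm_real, Real.norm_of_nonneg (by positivity)]
  rw [hwn, div_mul_eq_mul_div, le_div_iff₀ hDpos] at hn1
  rw [le_div_iff₀ (by positivity)]
  set N := ‖G s - G s₀‖
  set r := ‖s - s₀‖
  have hr : 0 ≤ r := norm_nonneg _
  have h2 : N * (D - r) ≤ 2 * F * r := by linarith
  have h3 : N * (4 * x * x₀) ≤ 2 * F * r * (D + r) := by
    rw [← hsq]
    calc N * (D ^ 2 - r ^ 2) = N * (D - r) * (D + r) := by ring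
      _ ≤ _ := by gcongr
  have h4 : 2 * F * r * (D + r) ≤ 2 * F * r * (2 * D) := by gcongr; linarith
  nlinarith

open Filter Topology in
lemma IsLogL.re_deriv_ge {q : ℕ} [NeZero q] {χ : DirichletCharacter ℂ q} (hχ : χ ≠ 1) {ℓ : ℂ → ℂ}
    (h : IsLogL χ ℓ) {s : ℂ} (hs : 1 / 2 < s.re) : -(2500 * MM q s.im) ≤ (deriv ℓ s).re := by
  have hd : HasDerivAt ℓ (deriv ℓ s) s :=
    (h.diff.differentiableAt ((isOpen_half _).mem_nhds hs)).hasDerivAt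
  set M := MM q s.im
  set v : ℝ → ℝ := fun x => (ℓ (s + x)).re - (ℓ (s - x)).re + 5000 * x * M with hv
  have h1 : HasDerivAt (fun x : ℝ => (ℓ (s + x)).re) (deriv ℓ s).re 0 := by
    have e1 : HasDerivAt (fun z : ℂ => ℓ (s + z)) (deriv ℓ s) ((0:ℝ):ℂ) := by
      have := HasDerivAt.comp_const_add (f := ℓ) (f' := deriv ℓ s) s (0:ℂ) (by simpa using hd)
      simpa using this
    exact e1.real_of_complex
  have h2 : HasDerivAt (fun x : ℝ => (ℓ (s - x)).re) (-(deriv ℓ s)).re 0 := by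
    have e1 : HasDerivAt (fun z : ℂ => ℓ (s - z)) (-deriv ℓ s) ((0:ℝ):ℂ) := by
      have := HasDerivAt.comp_const_sub (f := ℓ) (f' := deriv ℓ s) s (0:ℂ) (by simpa using hd)
      simpa using this
    exact e1.real_of_complex
  have h3 : HasDerivAt v ((deriv ℓ s).re - (-(deriv ℓ s)).re + 5000 * M) 0 := by
    refine (h1.sub h2).add ?_
    have := ((hasDerivAt_id (0:ℝ)).const_mul 5000).mul_const M
    simpa using this
  have hv0 : v 0 = 0 := by simp [hv]
  have hvn : ∀ᶠ x in 𝓝[>] (0:ℝ), 0 ≤ v x := by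
    have : 0 < min (2 / 5) (s.re - 1 / 2) := by
      apply lt_min <;> linarith
    filter_upwards [Ioo_mem_nhdsGT this] with x hx
    obtain ⟨hx0, hx1⟩ := hx
    have hxa := hx1.trans_le (min_le_left _ _)
    have hxb := hx1.trans_le (min_le_right _ _)
    have hr := LFunction_reflect hχ h (c := s.re) hs hx0.le hxa.le s.im
    have e1 : (⟨s.re - x, s.im⟩ : ℂ) = s - x := by apply Complex.ext <;> simp
    have e2 : (⟨s.re + x, s.im⟩ : ℂ) = s + x := by apply Complex.ext <;> simp
    rw [e1, e2, ← h.exp_eq _ (by simp; linarith), ← h.exp_eq _ (by simp; linarith),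
      Complex.norm_exp, Complex.norm_exp, ← Real.exp_add, Real.exp_le_exp] at hr
    simp only [hv]
    linarith
  have h4 := h3.tendsto_slope
  have h5 : Tendsto (slope v 0) (𝓝[>] 0) (𝓝 ((deriv ℓ s).re - (-(deriv ℓ s)).re + 5000 * M)) :=
    h4.mono_left (nhdsWithin_mono _ fun x hx => ne_of_gt hx)
  have h6 := ge_of_tendsto h5 (b := 0) (by
    filter_upwards [hvn, self_mem_nhdsWithin] with x hx hx0
    rw [slope_def_field, hv0]
    have : (0:ℝ) < x := hx0
    apply div_nonneg <;> linarith)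
  simp at h6
  linarith

/-- the auxiliary function of positive real part -/
noncomputable def auxG (q : ℕ) (ℓ : ℂ → ℂ) (s : ℂ) : ℂ :=
  deriv ℓ s + (2500 * Real.log q + 2501 : ℝ) + 2500 * Complex.log (s + 2)

lemma auxG_diff {q : ℕ} [NeZero q] {χ : DirichletCharacter ℂ q} {ℓ : ℂ → ℂ}
    (h : IsLogL χ ℓ) : DifferentiableOn ℂ (auxG q ℓ) {s : ℂ | 1 / 2 < s.re} := by
  unfold auxG
  refine ((h.diff.deriv (isOpen_half _)).add_const _).add (DifferentiableOn.const_mul ?_ _)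
  intro s hs
  have hs' : 1 / 2 < s.re := hs
  refine DifferentiableAt.differentiableWithinAt ?_
  refine DifferentiableAt.clog (by fun_prop) (Or.inl ?_)
  simp; linarith

lemma auxG_pos {q : ℕ} [NeZero q] {χ : DirichletCharacter ℂ q} (hχ : χ ≠ 1) {ℓ : ℂ → ℂ}
    (h : IsLogL χ ℓ) {s : ℂ} (hs : 1 / 2 < s.re) : 0 < (auxG q ℓ s).re := by
  have h1 := h.re_deriv_ge hχ hs
  unfold auxG
  have e : ((deriv ℓ s + (2500 * Real.log q + 2501 : ℝ) + 2500 * Complex.log (s + 2))).re =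
      (deriv ℓ s).re + (2500 * Real.log q + 2501) + 2500 * Real.log ‖s + 2‖ := by
    simp [Complex.log_re]
  rw [e]
  unfold MM at h1
  have h2 : (2 + |s.im|) / 2 ≤ ‖s + 2‖ := by
    have a1 := Complex.abs_re_le_norm (s + 2)
    have a2 := Complex.abs_im_le_norm (s + 2)
    simp only [add_re, add_im, re_ofNat, im_ofNat, add_zero] at a1 a2
    have := le_abs_self (s.re + 2)
    linarith
  have h3 : Real.log (2 + |s.im|) - Real.log 2 ≤ Real.log ‖s + 2‖ := by
    rw [← Real.log_div (by positivity) (by norm_num)]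
    exact Real.log_le_log (by positivity) h2
  have := Real.log_two_lt_d9
  linarith

/-! ### A7: the Perron kernel -/

open MeasureTheory

lemma integrable_inv_sq_add_sq {c : ℝ} (hc : 0 < c) :
    Integrable (fun v : ℝ => (c ^ 2 + v ^ 2)⁻¹) := by
  have h := (integrable_inv_one_add_sq.comp_div hc.ne').const_mul (c ^ 2)⁻¹
  refine h.congr (Filter.Eventually.of_forall fun v => ?_)
  simp only
  rw [← mul_inv]
  congr 1
  field_simp

lemma integral_inv_sq_add_sq_pi {c : ℝ} (hc : 0 < c) :
    ∫ v : ℝ, (c ^ 2 + v ^ 2)⁻¹ = π / c := by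
  have h := Measure.integral_comp_div (fun x : ℝ => (1 + x ^ 2)⁻¹) c
  rw [integral_univ_inv_one_add_sq] at h
  have e : ∀ v : ℝ, (c ^ 2 + v ^ 2)⁻¹ = (c ^ 2)⁻¹ * (1 + (v / c) ^ 2)⁻¹ := by
    intro v
    rw [← mul_inv]
    congr 1
    field_simp
  simp_rw [e]
  rw [integral_const_mul, h, abs_of_pos hc, smul_eq_mul]
  field_simp

lemma norm_add_mul_I_sq (c v : ℝ) : ‖(c + v * I : ℂ)‖ ^ 2 = c ^ 2 + v ^ 2 := by
  rw [← Complex.normSq_eq_norm_sq, Complex.normSq_add_mul_I]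

lemma le_norm_add_mul_I {c : ℝ} (v : ℝ) : c ≤ ‖(c + v * I : ℂ)‖ := by
  have := Complex.abs_re_le_norm (c + v * I)
  simp at this
  exact (le_abs_self c).trans this

lemma norm_add_mul_I_pos {c : ℝ} (hc : 0 < c) (v : ℝ) : 0 < ‖(c + v * I : ℂ)‖ :=
  hc.trans_le (le_norm_add_mul_I v)

lemma inv_norm_pow_le {c : ℝ} (hc : 0 < c) (v : ℝ) (n : ℕ) :
    (‖(c + v * I : ℂ)‖ ^ (n + 2))⁻¹ ≤ (c ^ n)⁻¹ * (c ^ 2 + v ^ 2)⁻¹ := by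
  rw [pow_add, mul_inv, norm_add_mul_I_sq]
  gcongr
  exact le_norm_add_mul_I v

lemma integrable_inv_pow {c : ℝ} (hc : 0 < c) (n : ℕ) :
    Integrable (fun v : ℝ => ((c + v * I : ℂ) ^ (n + 2))⁻¹) := by
  refine ((integrable_inv_sq_add_sq hc).const_mul (c ^ n)⁻¹).mono' ?_ ?_
  · apply Continuous.aestronglyMeasurable
    refine Continuous.inv₀ (by fun_prop) fun v => ?_
    apply pow_ne_zero
    rw [← norm_pos_iff]; exact norm_add_mul_I_pos hc v
  · refine Filter.Eventually.of_forall fun v => ?_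
    rw [norm_inv, norm_pow]
    exact inv_norm_pow_le hc v n

open Filter Topology in
lemma tendsto_pow_mul_cexp {z : ℂ} (hz : 0 < z.re) (n : ℕ) :
    Tendsto (fun x : ℝ => (x:ℂ) ^ n * Complex.exp (-z * x)) atTop (𝓝 0) := by
  rw [tendsto_zero_iff_norm_tendsto_zero]
  have h := tendsto_rpow_mul_exp_neg_mul_atTop_nhds_zero n z.re hz
  refine h.congr' ?_
  filter_upwards [eventually_gt_atTop 0] with x hx
  rw [norm_mul, norm_pow, Complex.norm_exp, Complex.norm_real, Real.norm_of_nonneg hx.le]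
  simp

lemma integrableOn_pow_mul_exp {c : ℝ} (hc : 0 < c) (n : ℕ) :
    IntegrableOn (fun x : ℝ => x ^ n * Real.exp (-c * x)) (Set.Ioi 0) := by
  have h := integrableOn_rpow_mul_exp_neg_mul_rpow (p := 1) (s := n) (b := c)
    (by have : (0:ℝ) ≤ n := by positivity
        linarith) one_pos hc
  simpa using h

open Filter Topology in
lemma integral_pow_mul_cexp {z : ℂ} (hz : 0 < z.re) (n : ℕ) :
    ∫ x : ℝ in Set.Ioi 0, (x:ℂ) ^ n * Complex.exp (-z * x) = n.factorial / z ^ (n + 1) := by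
  have hz0 : z ≠ 0 := by intro h; simp [h] at hz
  have hintg : ∀ n : ℕ, IntegrableOn (fun x : ℝ => (x:ℂ) ^ n * Complex.exp (-z * x)) (Set.Ioi 0) := by
    intro n
    refine (integrableOn_pow_mul_exp hz n).mono' ?_ ?_
    · apply Continuous.aestronglyMeasurable; fun_prop
    · refine (ae_restrict_iff' measurableSet_Ioi).2 (Eventually.of_forall fun x hx => ?_)
      rw [norm_mul, norm_pow, Complex.norm_exp, Complex.norm_real, Real.norm_of_nonneg (le_of_lt hx)]
      simp
  have hexp : ∀ x : ℝ, HasDerivAt (fun y : ℝ => Complex.exp (-z * y))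
      (Complex.exp (-z * x) * (-z)) x := by
    intro x
    have := ((hasDerivAt_id (x:ℂ)).const_mul (-z)).cexp
    simpa using this.comp_ofReal
  induction n with
  | zero =>
    have h1 := integral_Ioi_of_hasDerivAt_of_tendsto' (a := 0) (m := 0)
      (f := fun x : ℝ => Complex.exp (-z * x)) (fun x _ => hexp x)
      (by simpa [IntegrableOn] using (hintg 0).mul_const (-z))
      (by simpa using tendsto_pow_mul_cexp hz 0)
    rw [integral_mul_const] at h1
    simp only [pow_zero, one_mul, ofReal_zero, mul_zero, Complex.exp_zero, Nat.factorial_zero,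
      Nat.cast_one, zero_add, pow_one] at h1 ⊢
    rw [eq_div_iff hz0]
    linear_combination -h1
  | succ n ih =>
    have h1 := integral_Ioi_of_hasDerivAt_of_tendsto' (a := 0) (m := 0)
      (f := fun x : ℝ => (x:ℂ) ^ (n + 1) * Complex.exp (-z * x))
      (f' := fun x : ℝ => ((n:ℂ) + 1) * ((x:ℂ) ^ n * Complex.exp (-z * x)) -
        z * ((x:ℂ) ^ (n + 1) * Complex.exp (-z * x))) (fun x _ => by
        have hp : HasDerivAt (fun y : ℝ => (y:ℂ) ^ (n + 1)) (((n:ℂ) + 1) * (x:ℂ) ^ n) x := by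
          have := (hasDerivAt_pow (n + 1) (x:ℂ)).comp_ofReal
          simpa using this
        refine (hp.mul (hexp x)).congr_deriv ?_
        ring)
      (((hintg n).const_mul _).sub ((hintg (n + 1)).const_mul _))
      (tendsto_pow_mul_cexp hz (n + 1))
    rw [integral_sub ((hintg n).const_mul _) ((hintg (n + 1)).const_mul _), integral_const_mul,
      integral_const_mul, ih] at h1
    simp only [ofReal_zero, ne_eq, Nat.add_eq_zero_iff, one_ne_zero, and_false, not_false_eq_true,
      zero_pow, zero_mul, sub_zero] at h1
    rw [Nat.factorial_succ, pow_succ z (n + 1), ← div_div, eq_div_iff hz0]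
    push_cast
    rw [mul_div_assoc]
    linear_combination -h1

open FourierTransform in
lemma perron_kernel {n : ℕ} (hn : n ≠ 0) {c : ℝ} (hc : 0 < c) (u : ℝ) :
    ∫ v : ℝ, Complex.exp (u * (c + v * I)) * (n.factorial / (c + v * I) ^ (n + 1)) =
      2 * π * ((max u 0 ^ n : ℝ) : ℂ) := by
  set f : ℝ → ℂ := fun x => ((max x 0 ^ n * Real.exp (-c * x) : ℝ) : ℂ) with hf
  have hfc : Continuous f := by fun_prop
  have hfi : Integrable f := by
    have h1 : Integrable (Set.indicator (Set.Ioi 0) fun x : ℝ => x ^ n * Real.exp (-c * x)) :=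
      (integrable_indicator_iff measurableSet_Ioi).2 (integrableOn_pow_mul_exp hc n)
    have h2 : Integrable (fun x : ℝ => max x 0 ^ n * Real.exp (-c * x)) := by
      refine h1.congr (Filter.Eventually.of_forall fun x => ?_)
      simp only [Set.indicator_apply, Set.mem_Ioi]
      split_ifs with hx
      · rw [max_eq_left hx.le]
      · rw [max_eq_right (not_lt.1 hx)]; simp [hn]
    exact h2.ofReal
  have hFf : ∀ ξ : ℝ, 𝓕 f ξ = n.factorial / (c + (2 * π * ξ : ℝ) * I) ^ (n + 1) := by
    intro ξ
    rw [Real.fourier_eq', ← integral_pow_mul_cexp (n := n) (z := c + (2 * π * ξ : ℝ) * I) (by simpa using hc),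
      ← integral_indicator measurableSet_Ioi]
    congr 1
    ext x
    simp only [Set.indicator_apply, Set.mem_Ioi, hf, smul_eq_mul]
    split_ifs with hx
    · rw [max_eq_left hx.le]
      push_cast
      rw [mul_left_comm, ← Complex.exp_add]
      congr 2
      simp; ring
    · rw [max_eq_right (not_lt.1 hx)]; simp [hn]
  have hFi : Integrable (𝓕 f) := by
    obtain ⟨m, rfl⟩ := Nat.exists_eq_succ_of_ne_zero hn
    have h1 := ((integrable_inv_pow hc m).const_mul (m.succ.factorial : ℂ)).comp_mul_left' (show (2 * π) ≠ 0 by positivity)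
    refine h1.congr (Filter.Eventually.of_forall fun ξ => ?_)
    simp only
    rw [hFf, div_eq_mul_inv]
  have hinv := congrFun (hfc.fourierInv_fourier_eq hfi hFi) u
  rw [Real.fourierInv_eq'] at hinv
  simp only [hFf, smul_eq_mul] at hinv
  have hsub := Measure.integral_comp_mul_left
    (fun v : ℝ => Complex.exp (u * (v * I)) * (n.factorial / (c + v * I) ^ (n + 1))) (2 * π)
  have e1 : ∫ v : ℝ, Complex.exp (u * (c + v * I)) * (n.factorial / (c + v * I) ^ (n + 1)) =
      Complex.exp (u * c) * ∫ v : ℝ, Complex.exp (u * (v * I)) * (n.factorial / (c + v * I) ^ (n + 1)) := by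
    rw [← integral_const_mul]
    congr 1; ext v
    rw [← mul_assoc, ← Complex.exp_add]; congr 2; ring
  have e2 : ∫ (x : ℝ), Complex.exp (u * (((2 * π * x : ℝ) : ℂ) * I)) * (n.factorial / (c + ((2 * π * x : ℝ):ℂ) * I) ^ (n + 1)) = f u := by
    rw [← hinv]
    congr 1; ext x
    congr 2
    simp; ring
  rw [e2] at hsub
  rw [e1]
  have hpi : (0:ℝ) < 2 * π := by positivity
  rw [abs_of_pos (by positivity), Complex.real_smul] at hsub
  have e3 : ∫ v : ℝ, Complex.exp (u * (v * I)) * (n.factorial / (c + v * I) ^ (n + 1)) = (2 * π : ℝ) * f u := by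
    rw [hsub, ← mul_assoc, ← Complex.ofReal_mul, mul_inv_cancel₀ hpi.ne']; simp
  rw [e3, hf]
  push_cast
  have : Complex.exp (u * c) * Complex.exp (-c * u) = 1 := by
    rw [← Complex.exp_add]; simp [mul_comm]
  linear_combination (2 * π * (((max u 0 : ℝ)):ℂ) ^ n) * this

/-! ### A8: contour shift and Perron formula for ℓ -/

open MeasureTheory

open Filter Topology in
lemma vertical_shift {H : ℂ → ℂ} {c d B : ℝ} {U : Set ℂ} (hcd : c ≤ d)
    (hU : {z : ℂ | c ≤ z.re ∧ z.re ≤ d} ⊆ U)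
    (hd : DifferentiableOn ℂ H U)
    (hb : ∀ z : ℂ, c ≤ z.re → z.re ≤ d → ‖H z‖ ≤ B * (1 + z.im ^ 2)⁻¹) :
    (∀ x, c ≤ x → x ≤ d → Integrable (fun v : ℝ => H (x + v * I))) ∧
    ∫ v : ℝ, H (c + v * I) = ∫ v : ℝ, H (d + v * I) := by
  have hintg : ∀ x, c ≤ x → x ≤ d → Integrable (fun v : ℝ => H (x + v * I)) := by
    intro x hx1 hx2
    have hc : Continuous (fun v : ℝ => H (x + v * I)) := by
      have h1 : ContinuousOn (H ∘ fun v : ℝ => (x + v * I : ℂ)) Set.univ := by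
        refine hd.continuousOn.comp (by fun_prop) ?_
        intro v _
        apply hU
        simp [hx1, hx2]
      exact continuousOn_univ.1 h1
    refine (integrable_inv_one_add_sq.const_mul B).mono' hc.aestronglyMeasurable ?_
    refine Eventually.of_forall fun v => ?_
    have := hb (x + v * I) (by simpa using hx1) (by simpa using hx2)
    simpa using this
  refine ⟨hintg, ?_⟩
  have hrect : ∀ T : ℝ, (∫ v in (-T)..T, H (d + v * I)) - (∫ v in (-T)..T, H (c + v * I)) =
      I * ((∫ x in c..d, H (x + (-T : ℝ) * I)) - (∫ x in c..d, H (x + (T : ℝ) * I))) := by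
    intro T
    have h := Complex.integral_boundary_rect_eq_zero_of_differentiableOn H ⟨c, -T⟩ ⟨d, T⟩ (by
      refine hd.mono fun z hz => hU ?_
      rw [Complex.mem_reProdIm] at hz
      simp only [Set.uIcc_of_le hcd] at hz
      exact hz.1)
    simp only [smul_eq_mul] at h
    linear_combination (-I) * h + ((∫ v in (-T)..T, H (d + v * I)) -
      (∫ v in (-T)..T, H (c + v * I))) * I_mul_I
  have hB : 0 ≤ B := by
    have := (norm_nonneg _).trans (hb ⟨c, 0⟩ le_rfl hcd)
    simpa using this
  have hedge : ∀ T : ℝ, ‖∫ x in c..d, H (x + (T : ℝ) * I)‖ ≤ B * (1 + T ^ 2)⁻¹ * |d - c| := by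
    intro T
    refine intervalIntegral.norm_integral_le_of_norm_le_const fun x hx => ?_
    rw [Set.uIoc_of_le hcd] at hx
    have := hb (x + T * I) (by simpa using hx.1.le) (by simpa using hx.2)
    simpa using this
  have hz : Tendsto (fun T : ℝ => 2 * (B * (1 + T ^ 2)⁻¹ * |d - c|)) atTop (𝓝 0) := by
    have h1 : Tendsto (fun T : ℝ => (1 + T ^ 2)⁻¹) atTop (𝓝 0) := by
      apply tendsto_inv_atTop_zero.comp
      apply tendsto_atTop_add_const_left
      exact tendsto_pow_atTop two_ne_zero
    have := ((h1.const_mul B).mul_const |d - c|).const_mul 2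
    simpa using this
  have hdiff : Tendsto (fun T : ℝ => (∫ v in (-T)..T, H (d + v * I)) -
      (∫ v in (-T)..T, H (c + v * I))) atTop (𝓝 0) := by
    refine squeeze_zero_norm (fun T => ?_) hz
    rw [hrect, norm_mul, norm_I, one_mul]
    have a1 := hedge (-T)
    have a2 := hedge T
    rw [neg_sq] at a1
    refine (norm_sub_le _ _).trans ?_
    linarith
  have l1 := intervalIntegral_tendsto_integral (hintg d hcd le_rfl) tendsto_neg_atTop_atBot tendsto_id
  have l2 := intervalIntegral_tendsto_integral (hintg c le_rfl hcd) tendsto_neg_atTop_atBot tendsto_id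
  have := tendsto_nhds_unique (l1.sub l2) hdiff
  exact (sub_eq_zero.1 this).symm

/-- Smoothed prime sum. -/
noncomputable def SS {q : ℕ} (χ : DirichletCharacter ℂ q) (X : ℝ) (s : ℂ) : ℂ :=
  ∑ n ∈ Finset.Icc 1 ⌊Real.exp X⌋₊, logCoef χ n * (n:ℂ) ^ (-s) * (((1 - Real.log n / X) ^ 4 : ℝ) : ℂ)

lemma perron_series {q : ℕ} [NeZero q] (χ : DirichletCharacter ℂ q) {X : ℝ} (hX : 0 < X) {s : ℂ}
    (hs : 1 / 2 < s.re) :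
    ∫ v : ℝ, LSeries (logCoef χ) (s + ((2:ℝ) + v * I)) *
      (Complex.exp (X * ((2:ℝ) + v * I)) * (24 / ((2:ℝ) + v * I) ^ 5)) = 2 * π * (X:ℂ) ^ 4 * SS χ X s := by
  set F : ℕ → ℝ → ℂ := fun n v => LSeries.term (logCoef χ) (s + ((2:ℝ) + v * I)) n *
      (Complex.exp (X * ((2:ℝ) + v * I)) * (24 / ((2:ℝ) + v * I) ^ 5)) with hF
  have hFeq : ∀ n : ℕ, n ≠ 0 → ∀ v : ℝ, F n v = (logCoef χ n * (n:ℂ) ^ (-s)) *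
      (Complex.exp ((X - Real.log n : ℝ) * ((2:ℝ) + v * I)) * (24 / ((2:ℝ) + v * I) ^ 5)) := by
    intro n hn v
    have hn0 : (n:ℂ) ≠ 0 := by exact_mod_cast hn
    simp only [hF]
    rw [LSeries.term_of_ne_zero hn, div_eq_mul_inv, ← Complex.cpow_neg, neg_add, Complex.cpow_add _ _ hn0,
      Complex.cpow_def_of_ne_zero hn0 (-((2:ℝ) + v * I))]
    have : Complex.exp ((X - Real.log n : ℝ) * ((2:ℝ) + v * I)) =
        Complex.exp (Complex.log n * -((2:ℝ) + v * I)) * Complex.exp (X * ((2:ℝ) + v * I)) := by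
      rw [← Complex.exp_add]
      congr 1
      rw [← Complex.natCast_log]
      push_cast; ring
    rw [this]; ring
  have hF0 : ∀ v, F 0 v = 0 := by intro v; simp [hF]
  have h2 : (0:ℝ) < 2 := by norm_num
  have hki : ∀ u : ℝ, Integrable (fun v : ℝ => Complex.exp (u * ((2:ℝ) + v * I)) * (24 / ((2:ℝ) + v * I) ^ 5)) := by
    intro u
    refine ((integrable_inv_pow h2 3).const_mul 24).bdd_mul (c := Real.exp (u * 2)) ?_ ?_
    · apply Continuous.aestronglyMeasurable; fun_prop
    · refine Filter.Eventually.of_forall fun v => ?_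
      rw [Complex.norm_exp]; simp
  have hFi : ∀ n, Integrable (F n) := by
    intro n
    rcases eq_or_ne n 0 with rfl | hn
    · rw [show F 0 = fun _ => 0 from funext hF0]; exact integrable_zero _ _ _
    · rw [show F n = _ from funext (hFeq n hn)]
      exact (hki _).const_mul _
  have hmain := integral_tsum_of_summable_integral_norm (F := F) hFi (by
    set g : ℝ → ℝ := fun v => ‖Complex.exp (X * ((2:ℝ) + v * I)) * (24 / ((2:ℝ) + v * I) ^ 5)‖
    have hg : Integrable g := (hki X).norm
    refine Summable.of_nonneg_of_le (fun n => integral_nonneg fun v => norm_nonneg _) (fun n => ?_)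
      ((Real.summable_one_div_nat_pow.2 (one_lt_two)).mul_right (∫ v, g v))
    rw [← integral_const_mul]
    refine integral_mono (hFi n).norm (hg.const_mul _) fun v => ?_
    simp only [hF, norm_mul]
    rw [← norm_mul]
    refine mul_le_mul_of_nonneg_right ?_ (norm_nonneg _)
    rcases eq_or_ne n 0 with rfl | hn
    · simp
    · rw [LSeries.term_of_ne_zero hn, norm_div, Complex.norm_natCast_cpow_of_pos (Nat.pos_of_ne_zero hn)]
      apply div_le_div₀ zero_le_one (norm_logCoef_le χ n) (by positivity)
      have h1 : (1:ℝ) ≤ n := by exact_mod_cast Nat.pos_of_ne_zero hn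
      rw [← Real.rpow_natCast]
      apply Real.rpow_le_rpow_of_exponent_le h1
      simp; linarith)
  have hL : ∀ v : ℝ, ∑' n, F n v = LSeries (logCoef χ) (s + ((2:ℝ) + v * I)) *
      (Complex.exp (X * ((2:ℝ) + v * I)) * (24 / ((2:ℝ) + v * I) ^ 5)) := by
    intro v
    simp only [hF]
    rw [tsum_mul_right]; rfl
  simp_rw [hL] at hmain
  rw [← hmain]
  have hval : ∀ n : ℕ, n ≠ 0 → ∫ v, F n v =
      (logCoef χ n * (n:ℂ) ^ (-s)) * (2 * π * ((max (X - Real.log n) 0 ^ 4 : ℝ) : ℂ)) := by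
    intro n hn
    rw [show F n = _ from funext (hFeq n hn), integral_const_mul]
    have := perron_kernel (n := 4) (by norm_num) h2 (X - Real.log n)
    rw [← this]
    norm_num [Nat.factorial]
  rw [tsum_eq_sum (s := Finset.Icc 1 ⌊Real.exp X⌋₊)]
  · unfold SS
    rw [Finset.mul_sum]
    refine Finset.sum_congr rfl fun n hn => ?_
    rw [Finset.mem_Icc] at hn
    have hn0 : n ≠ 0 := by omega
    rw [hval n hn0]
    have hle : (n:ℝ) ≤ Real.exp X := (Nat.le_floor_iff (Real.exp_pos X).le).1 hn.2
    have hlog : Real.log n ≤ X := by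
      rw [Real.log_le_iff_le_exp (by exact_mod_cast Nat.pos_of_ne_zero hn0)]; exact hle
    rw [max_eq_left (by linarith)]
    have : X - Real.log n = X * (1 - Real.log n / X) := by field_simp
    rw [this]
    push_cast
    ring
  · intro n hn
    rcases eq_or_ne n 0 with rfl | hn0
    · simp [hF0]
    · rw [hval n hn0]
      have hlt : Real.exp X < n := by
        rw [Finset.mem_Icc] at hn
        have : ⌊Real.exp X⌋₊ < n := by omega
        exact (Nat.floor_lt (Real.exp_pos X).le).1 this
      have : X ≤ Real.log n := by
        rw [Real.le_log_iff_exp_le (by exact_mod_cast Nat.pos_of_ne_zero hn0)]; exact hlt.le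
      rw [max_eq_right (by linarith)]
      simp

lemma perron_logL {q : ℕ} [NeZero q] {χ : DirichletCharacter ℂ q} (hχ : χ ≠ 1) {ℓ : ℂ → ℂ}
    (h : IsLogL χ ℓ) {X c : ℝ} (hX : 0 < X) (hc : 0 < c) (hc2 : c ≤ 2) {s : ℂ} (hs : 1 / 2 < s.re) :
    Integrable (fun v : ℝ => ℓ (s + (c + v * I)) *
      (Complex.exp (X * (c + v * I)) * (24 / (c + v * I) ^ 5))) ∧
    ∫ v : ℝ, ℓ (s + (c + v * I)) *
      (Complex.exp (X * (c + v * I)) * (24 / (c + v * I) ^ 5)) = 2 * π * (X:ℂ) ^ 4 * SS χ X s := by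
  have hq := two_le_q hχ
  set M := MM q s.im with hM
  have hM1 : 1 < M := MM_gt_one hq _
  set ε := min (s.re - 1 / 2) 1 with hε
  have hεp : 0 < ε := by apply lt_min <;> linarith
  set c₀ := min c 1 with hc₀
  have hc₀p : 0 < c₀ := lt_min hc one_pos
  have hc₀1 : c₀ ≤ 1 := min_le_right _ _
  set H : ℂ → ℂ := fun z => ℓ (s + z) * (Complex.exp (X * z) * (24 / z ^ 5)) with hH
  have hdiff : DifferentiableOn ℂ H {z | 0 < z.re} := by
    have h1 : DifferentiableOn ℂ (fun z => ℓ (s + z)) {z | 0 < z.re} := by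
      refine h.diff.comp (by fun_prop) fun z hz => ?_
      have : 0 < z.re := hz
      show 1 / 2 < (s + z).re
      simp only [add_re]; linarith
    refine h1.mul (DifferentiableOn.mul (by fun_prop) ?_)
    refine DifferentiableOn.div (by fun_prop) (by fun_prop) fun z hz => ?_
    apply pow_ne_zero
    intro h0
    have : 0 < z.re := hz
    simp [h0] at this
  have key := vertical_shift (H := H) (c := c) (d := 2)
    (B := 30 / ε * (2 * (M + 1)) * (Real.exp (X * 2) * 24) * (c₀ ^ 6)⁻¹) hc2
    (fun z hz => show 0 < z.re from hc.trans_le hz.1) hdiff (by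
      intro z hz1 hz2
      simp only [hH, norm_mul, norm_div, norm_pow]
      have b1 : ‖ℓ (s + z)‖ ≤ 30 / ε * (M + |z.im|) := by
        refine (h.norm_le hχ hεp (min_le_right _ _) ?_).trans ?_
        · simp only [add_re]; linarith [min_le_left (s.re - 1 / 2) 1]
        · gcongr
          simp only [add_im]
          exact MM_add_le _ _
      have b2 : ‖Complex.exp (X * z)‖ ≤ Real.exp (X * 2) := by
        rw [Complex.norm_exp, Complex.re_ofReal_mul]
        gcongr
      have hzr : c₀ ≤ ‖z‖ := (min_le_left _ _).trans (hz1.trans ((le_abs_self _).trans (abs_re_le_norm z)))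
      have hzi : |z.im| ≤ ‖z‖ := abs_im_le_norm z
      have hzp : 0 < ‖z‖ := hc₀p.trans_le hzr
      have b3 : (M + |z.im|) / ‖z‖ ^ 5 ≤ 2 * (M + 1) * ((c₀ ^ 6)⁻¹ * (1 + z.im ^ 2)⁻¹) := by
        have i1 : c₀ ^ 2 * (1 + z.im ^ 2) ≤ 2 * ‖z‖ ^ 2 := by
          have : z.im ^ 2 ≤ ‖z‖ ^ 2 := by rw [← sq_abs]; gcongr
          have a2 : c₀ ^ 2 ≤ ‖z‖ ^ 2 := by gcongr
          have a3 : c₀ ^ 2 ≤ 1 := by nlinarith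
          nlinarith [sq_nonneg z.im]
        have i2 : c₀ * (M + |z.im|) ≤ (M + 1) * ‖z‖ := by nlinarith
        have i1' : c₀ ^ 2 * (1 + z.im ^ 2) ≤ ‖z‖ ^ 2 + ‖z‖ ^ 2 := by linarith
        have i3 : c₀ ^ 2 * (1 + z.im ^ 2) * (c₀ * (M + |z.im|)) * c₀ ^ 3 ≤ 2 * ‖z‖ ^ 2 * ((M + 1) * ‖z‖) * (c₀ * ‖z‖ ^ 2) := by
          gcongr
          calc c₀ ^ 3 = c₀ * c₀ ^ 2 := by ring
            _ ≤ c₀ * ‖z‖ ^ 2 := by gcongr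
        rw [div_le_iff₀ (by positivity), ← mul_inv, ← div_eq_mul_inv, div_mul_eq_mul_div, le_div_iff₀ (by positivity)]
        have i4 : c₀ * ‖z‖ ^ 5 ≤ 1 * ‖z‖ ^ 5 := by gcongr
        nlinarith
      calc ‖ℓ (s + z)‖ * (‖Complex.exp (X * z)‖ * (‖(24:ℂ)‖ / ‖z‖ ^ 5))
          ≤ 30 / ε * (M + |z.im|) * (Real.exp (X * 2) * (24 / ‖z‖ ^ 5)) := by
            gcongr
            simp
        _ = 30 / ε * (Real.exp (X * 2) * 24) * ((M + |z.im|) / ‖z‖ ^ 5) := by ring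
        _ ≤ 30 / ε * (Real.exp (X * 2) * 24) * (2 * (M + 1) * ((c₀ ^ 6)⁻¹ * (1 + z.im ^ 2)⁻¹)) := by gcongr
        _ = _ := by ring)
  refine ⟨by simpa [hH] using key.1 c le_rfl hc2, ?_⟩
  have e := key.2
  simp only [hH] at e
  rw [e, ← perron_series χ hX hs]
  congr 1
  ext v
  rw [h.eq_series _ (by simp; linarith)]

/-! ### A9: upper bound for log |L| by a short prime sum -/

open MeasureTheory

lemma log_diff_le {w s : ℂ} (hw : 1 / 2 < w.re) (hs : 1 / 2 < s.re) :
    ‖Complex.log (w + 2) - Complex.log (s + 2)‖ ≤ 1 * ‖w - s‖ := by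
  refine Convex.norm_image_sub_le_of_norm_hasDerivWithin_le (f := fun z => Complex.log (z + 2))
    (f' := fun z => (z + 2)⁻¹) (s := {z : ℂ | 1 / 2 < z.re})
    (fun z hz => ?_) (fun z hz => ?_) (convex_halfSpace_re_gt _) hs hw
  · have hz' : 1 / 2 < z.re := hz
    have h1 : z + 2 ∈ slitPlane := Or.inl (by simp; linarith)
    have := ((hasDerivAt_id z).add_const 2).clog h1
    simpa using this.hasDerivWithinAt
  · have hz' : 1 / 2 < z.re := hz
    rw [norm_inv]
    apply inv_le_one_of_one_le₀
    have := (le_abs_self _).trans (abs_re_le_norm (z + 2))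
    simp at this
    linarith

lemma taylor_rem {q : ℕ} [NeZero q] {χ : DirichletCharacter ℂ q} (hχ : χ ≠ 1) {ℓ : ℂ → ℂ}
    (h : IsLogL χ ℓ) {a : ℝ} (ha : 0 < a) {s z : ℂ} (hs : s.re = 1 / 2 + a) (hz : 0 < z.re) :
    ‖ℓ (s + z) - ℓ s - deriv ℓ s * z‖ ≤
      ‖z‖ ^ 2 * ((auxG q ℓ s).re * (‖z‖ + 2 * a) / a ^ 2 + 2500) := by
  have hs2 : 1 / 2 < s.re := by rw [hs]; linarith
  set F := (auxG q ℓ s).re with hF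
  have hF0 : 0 < F := auxG_pos hχ h hs2
  set K := ‖z‖ * (F * (‖z‖ + 2 * a) / a ^ 2 + 2500) with hK
  have hseg : ∀ w ∈ segment ℝ s (s + z), s.re ≤ w.re ∧ ‖w - s‖ ≤ ‖z‖ := by
    rintro w hw
    rw [segment_eq_image'] at hw
    obtain ⟨θ, hθ, rfl⟩ := hw
    simp only [add_sub_cancel_left]
    constructor
    · simp; exact mul_nonneg hθ.1 hz.le
    · rw [norm_smul, Real.norm_of_nonneg hθ.1]
      exact mul_le_of_le_one_left (norm_nonneg _) hθ.2
  have hbd : ∀ w ∈ segment ℝ s (s + z), ‖deriv ℓ w - deriv ℓ s‖ ≤ K := by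
    intro w hw
    obtain ⟨h1, h2⟩ := hseg w hw
    have hw2 : 1 / 2 < w.re := by linarith
    have e : deriv ℓ w - deriv ℓ s = (auxG q ℓ w - auxG q ℓ s) -
        2500 * (Complex.log (w + 2) - Complex.log (s + 2)) := by
      unfold auxG; ring
    have b1 := halfplane_schwarz_pick (b := 1 / 2) (by exact_mod_cast auxG_diff h)
      (fun s hs => auxG_pos hχ h hs) hw2 hs2
    have b2 := log_diff_le hw2 hs2
    have e2 : ‖w + (starRingEnd ℂ) s - 2 * ((1 / 2 : ℝ) : ℂ)‖ ≤ ‖z‖ + 2 * a := by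
      have : w + (starRingEnd ℂ) s - 2 * ((1 / 2 : ℝ) : ℂ) = (w - s) + ((2 * a : ℝ) : ℂ) := by
        apply Complex.ext <;> simp [hs] <;> ring
      rw [this]
      refine (norm_add_le _ _).trans ?_
      rw [Complex.norm_real, Real.norm_of_nonneg (by positivity)]
      linarith
    rw [← hF] at b1
    have b3 : F * (‖w - s‖ * ‖w + (starRingEnd ℂ) s - 2 * ((1 / 2 : ℝ) : ℂ)‖) /
      ((w.re - 1 / 2) * (s.re - 1 / 2)) ≤ F * (‖z‖ * (‖z‖ + 2 * a)) / (a * a) := by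
      gcongr <;> linarith
    rw [e]
    refine (norm_sub_le _ _).trans ?_
    rw [norm_mul, hK]
    have : ‖(2500:ℂ)‖ = 2500 := by simp
    rw [this]
    have e4 : ‖z‖ * (F * (‖z‖ + 2 * a) / a ^ 2 + 2500) =
      F * (‖z‖ * (‖z‖ + 2 * a)) / (a * a) + 2500 * ‖z‖ := by
      field_simp
    rw [e4]
    linarith
  have hmv := Convex.norm_image_sub_le_of_norm_hasDerivWithin_le (f := fun w => ℓ w - deriv ℓ s * w)
    (f' := fun w => deriv ℓ w - deriv ℓ s) (s := segment ℝ s (s + z)) (x := s) (y := s + z) (C := K)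
    (fun w hw => by
      have hw2 : 1 / 2 < w.re := by linarith [(hseg w hw).1]
      have hd : HasDerivAt ℓ (deriv ℓ w) w :=
        (h.diff.differentiableAt ((isOpen_half _).mem_nhds hw2)).hasDerivAt
      have := hd.sub ((hasDerivAt_id w).const_mul (deriv ℓ s))
      simp only [mul_one] at this
      exact this.hasDerivWithinAt)
    hbd (convex_segment _ _) (left_mem_segment _ _ _) (right_mem_segment _ _ _)
  have e : ℓ (s + z) - ℓ s - deriv ℓ s * z =
      (ℓ (s + z) - deriv ℓ s * (s + z)) - (ℓ s - deriv ℓ s * s) := by ring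
  rw [e]
  refine hmv.trans_eq ?_
  rw [add_sub_cancel_left, hK]; ring

lemma re_logL_le {q : ℕ} [NeZero q] {χ : DirichletCharacter ℂ q} (hχ : χ ≠ 1) {ℓ : ℂ → ℂ}
    (h : IsLogL χ ℓ) {X : ℝ} (hX : 50 ≤ X) (t : ℝ) :
    (ℓ ⟨1 / 2 + 40 / X, t⟩).re ≤ (SS χ X ⟨1 / 2 + 40 / X, t⟩).re + 10000 * (Real.log q / X) +
      1000 * Real.log (2 + |t|) := by
  have hX0 : 0 < X := by linarith
  set a : ℝ := 40 / X with ha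
  have hap : 0 < a := by positivity
  set c : ℝ := 1 / X with hc
  have hcp : 0 < c := by positivity
  have hc2 : c ≤ 2 := by rw [hc, div_le_iff₀ hX0]; linarith
  have hXc : X * c = 1 := by rw [hc]; field_simp
  set s : ℂ := ⟨1 / 2 + a, t⟩ with hs
  have hsr : s.re = 1 / 2 + a := rfl
  have hs2 : 1 / 2 < s.re := by rw [hsr]; linarith
  set F := (auxG q ℓ s).re with hF
  have hF0 : 0 < F := auxG_pos hχ h hs2
  set k : ℝ → ℂ := fun v => Complex.exp (X * (c + v * I)) * (24 / (c + v * I) ^ 5) with hk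
  obtain ⟨hi1, hv1⟩ := perron_logL hχ h hX0 hcp hc2 hs2
  have hne : ∀ v : ℝ, (c + v * I : ℂ) ≠ 0 := fun v => by
    rw [← norm_pos_iff]; exact norm_add_mul_I_pos hcp v
  have hex : ∀ v : ℝ, ‖Complex.exp (X * (c + v * I))‖ ≤ Real.exp 1 := by
    intro v
    rw [Complex.norm_exp, Complex.re_ofReal_mul]; simp [hXc]
  have hmeas : AEStronglyMeasurable (fun v : ℝ => Complex.exp (X * (c + v * I))) := by
    apply Continuous.aestronglyMeasurable; fun_prop
  have hki : Integrable k := by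
    refine ((integrable_inv_pow hcp 3).const_mul 24).bdd_mul (c := Real.exp 1) hmeas
      (Filter.Eventually.of_forall hex)
  have hkv : ∫ v, k v = 2 * π * (X:ℂ) ^ 4 := by
    have := perron_kernel (n := 4) (by norm_num) hcp X
    rw [max_eq_left hX0.le] at this
    simp only [hk]
    push_cast at this
    rw [← this]; norm_num [Nat.factorial]
  have hzk : ∀ v : ℝ, (c + v * I) * k v = 4 * (Complex.exp (X * (c + v * I)) * (6 / (c + v * I) ^ 4)) := by
    intro v
    have := hne v
    simp only [hk]
    field_simp
    norm_num
  have hzki : Integrable (fun v : ℝ => (c + v * I) * k v) := by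
    simp_rw [hzk]
    refine Integrable.const_mul ?_ _
    exact ((integrable_inv_pow hcp 2).const_mul 6).bdd_mul (c := Real.exp 1) hmeas
      (Filter.Eventually.of_forall hex)
  have hzkv : ∫ v : ℝ, (c + v * I) * k v = 4 * (2 * π * (X:ℂ) ^ 3) := by
    simp_rw [hzk]
    rw [integral_const_mul]
    have := perron_kernel (n := 3) (by norm_num) hcp X
    rw [max_eq_left hX0.le] at this
    push_cast at this
    rw [← this]; norm_num [Nat.factorial]
  set R : ℝ → ℂ := fun v => (ℓ (s + (c + v * I)) - ℓ s - deriv ℓ s * (c + v * I)) * k v with hR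
  have hRv : ∫ v, R v = 2 * π * (X:ℂ) ^ 4 * SS χ X s - ℓ s * (2 * π * (X:ℂ) ^ 4) -
      deriv ℓ s * (4 * (2 * π * (X:ℂ) ^ 3)) := by
    rw [← hv1, ← hkv, ← hzkv, ← integral_const_mul, ← integral_const_mul, ← integral_sub hi1 (hki.const_mul _),
      ← integral_sub (by exact hi1.sub (hki.const_mul _)) (hzki.const_mul _)]
    congr 1; ext v
    simp only [hR, hk]; ring
  set W := Real.exp 1 * 24 * (F * 81 * X ^ 2 / 1600 + 2500 * X) with hW
  have hRb : ‖∫ v, R v‖ ≤ W * (π * X) := by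
    have : π * X = π / c := by rw [hc]; field_simp
    rw [this, ← integral_inv_sq_add_sq_pi hcp, ← integral_const_mul]
    refine norm_integral_le_of_norm_le ((integrable_inv_sq_add_sq hcp).const_mul W)
      (Filter.Eventually.of_forall fun v => ?_)
    have h1 := taylor_rem hχ h hap hsr (z := c + v * I) (by simpa using hcp)
    set r := ‖(c + v * I : ℂ)‖ with hr
    have hrc : c ≤ r := le_norm_add_mul_I v
    have hrp : 0 < r := hcp.trans_le hrc
    simp only [hR, hk, norm_mul, norm_div, norm_pow]
    rw [← hr, ← norm_add_mul_I_sq, ← hr]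
    have hXr : 1 ≤ X * r := by rw [← hXc]; gcongr
    have h24 : ‖(24:ℂ)‖ = 24 := by simp
    rw [h24]
    calc _ ≤ r ^ 2 * (F * (r + 2 * a) / a ^ 2 + 2500) * (Real.exp 1 * (24 / r ^ 5)) := by
          gcongr
          exact hex v
      _ = Real.exp 1 * 24 * ((F * (r + 2 * a) / a ^ 2 + 2500) / r) * (r ^ 2)⁻¹ := by
          field_simp
      _ ≤ W * (r ^ 2)⁻¹ := by
          rw [hW]
          gcongr
          rw [div_le_iff₀ hrp, ha]
          have : F * (r + 2 * (40 / X)) / (40 / X) ^ 2 = F * (X ^ 2 * r + 80 * X) / 1600 := by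
            field_simp
            ring
          rw [this]
          have i1 : X ^ 2 * r + 80 * X ≤ 81 * (X ^ 2 * r) := by nlinarith
          have i2 : F * (X ^ 2 * r + 80 * X) ≤ F * (81 * (X ^ 2 * r)) := by gcongr
          have i3 : 2500 ≤ 2500 * (X * r) := by linarith
          nlinarith
  rw [hRv] at hRb
  have e1 : 2 * π * (X:ℂ) ^ 4 * SS χ X s - ℓ s * (2 * π * (X:ℂ) ^ 4) -
      deriv ℓ s * (4 * (2 * π * (X:ℂ) ^ 3)) =
      ((2 * π * X ^ 4 : ℝ) : ℂ) * (SS χ X s - ℓ s - ((4 / X : ℝ) : ℂ) * deriv ℓ s) := by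
    have : (X:ℂ) ≠ 0 := by exact_mod_cast hX0.ne'
    push_cast
    field_simp
  rw [e1, norm_mul, Complex.norm_real, Real.norm_of_nonneg (by positivity)] at hRb
  have hpi := Real.pi_pos
  have hRb2 : ‖SS χ X s - ℓ s - ((4 / X : ℝ) : ℂ) * deriv ℓ s‖ ≤ 2 * F / X + 40 := by
    have he := Real.exp_one_lt_d9
    have e2 : W * (π * X) = (2 * π * X ^ 4) * (Real.exp 1 * (F * 972 / 1600 / X + 30000 / X ^ 2)) := by
      rw [hW]; field_simp; ring
    rw [e2] at hRb
    have := le_of_mul_le_mul_left hRb (by positivity)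
    refine this.trans ?_
    have j1 : 30000 / X ^ 2 ≤ 12 := by
      rw [div_le_iff₀ (by positivity)]; nlinarith
    have j2 : 0 < F / X := by positivity
    have j3 : F * 972 / 1600 / X = (972 / 1600) * (F / X) := by ring
    have j4 : 2 * F / X = 2 * (F / X) := by ring
    rw [j3, j4]
    have j5 : 0 ≤ 30000 / X ^ 2 := by positivity
    nlinarith
  have hre := (abs_re_le_norm _).trans hRb2
  have hre2 := neg_le_of_abs_le hre
  simp only [sub_re, Complex.re_ofReal_mul] at hre2
  have hFe : F = (deriv ℓ s).re + (2500 * Real.log q + 2501) + 2500 * Real.log ‖s + 2‖ := by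
    rw [hF]; unfold auxG; simp [Complex.log_re]
  have hn : ‖s + 2‖ ≤ 2 * (2 + |t|) := by
    have b := Complex.norm_le_abs_re_add_abs_im (s + 2)
    have : a ≤ 4 / 5 := by rw [ha, div_le_iff₀ hX0]; linarith
    simp only [add_re, add_im, hs, re_ofNat, im_ofNat, add_zero] at b
    rw [abs_of_pos (by linarith)] at b
    linarith [abs_nonneg t]
  have hnp : 0 < ‖s + 2‖ := by
    rw [norm_pos_iff]; intro h0
    have := congrArg Complex.re h0
    simp [hs] at this; linarith
  have hl : Real.log ‖s + 2‖ ≤ Real.log 2 + Real.log (2 + |t|) := by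
    rw [← Real.log_mul (by norm_num) (by positivity)]
    exact Real.log_le_log hnp hn
  have hl2 : Real.log 2 ≤ Real.log (2 + |t|) := Real.log_le_log (by norm_num) (by linarith [abs_nonneg t])
  have hlg := Real.log_two_gt_d9
  have hlg' := Real.log_two_lt_d9
  set T := Real.log (2 + |t|)
  set Q := Real.log q
  have hinv : 1 / X ≤ 1 / 50 := by gcongr
  have hd : (deriv ℓ s).re ≥ F - 2500 * Q - 2501 - 2500 * (Real.log 2 + T) := by linarith
  have hd2 : 4 / X * (deriv ℓ s).re ≥ 4 / X * (F - 2500 * Q - 2501 - 2500 * (Real.log 2 + T)) := by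
    gcongr
  have ex : 4 / X * (F - 2500 * Q - 2501 - 2500 * (Real.log 2 + T)) =
    4 * (F / X) - 10000 * (Q / X) - (1 / X) * (10004 + 10000 * (Real.log 2 + T)) := by
    field_simp; ring
  rw [ex] at hd2
  have j4 : 2 * F / X = 2 * (F / X) := by ring
  rw [j4] at hre2
  have j2 : 0 < F / X := by positivity
  have j6 : (1 / X) * (10004 + 10000 * (Real.log 2 + T)) ≤ (1 / 50) * (10004 + 10000 * (Real.log 2 + T)) := by
    apply mul_le_mul_of_nonneg_right hinv; linarith
  linarith

/-- Main result of Part A. -/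
lemma log_L_le {q : ℕ} [NeZero q] {χ : DirichletCharacter ℂ q} (hχ : χ ≠ 1)
    (hRH : dirichletRH χ) {X δ : ℝ} (hX : 50 ≤ X) (hδ : 0 < δ) (hδ' : δ ≤ 40 / X) (t : ℝ) :
    ‖DirichletCharacter.LFunction χ ⟨1 / 2 + δ, t⟩‖ ≤
      Real.exp ((SS χ X ⟨1 / 2 + 40 / X, t⟩).re + 110000 * (Real.log q / X) +
      3000 * Real.log (2 + |t|)) := by
  obtain ⟨ℓ, h⟩ := exists_logL hχ (LFunction_ne_zero_of_RH hχ hRH)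
  have hX0 : 0 < X := by linarith
  have h1 := re_logL_le hχ h hX t
  have ha : 40 / X ≤ 4 / 5 := by rw [div_le_iff₀ hX0]; linarith
  have h2 := LFunction_reflect hχ h (c := 1 / 2 + (δ + 40 / X) / 2) (x := (40 / X - δ) / 2)
    (by have : 0 < 40 / X := by positivity
        linarith) (by linarith) (by linarith) t
  have e1 : (1 / 2 + (δ + 40 / X) / 2 - (40 / X - δ) / 2) = 1 / 2 + δ := by ring
  have e2 : (1 / 2 + (δ + 40 / X) / 2 + (40 / X - δ) / 2) = 1 / 2 + 40 / X := by ring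
  rw [e1, e2] at h2
  refine h2.trans ?_
  rw [← h.exp_eq _ (by show (1/2 : ℝ) < 1 / 2 + 40 / X; linarith), Complex.norm_exp, ← Real.exp_add]
  apply Real.exp_le_exp.2
  have hM := MM_gt_one (two_le_q hχ) t
  have h3 : 5000 * ((40 / X - δ) / 2) * MM q t ≤ 5000 * ((40 / X) / 2) * MM q t := by
    gcongr; linarith
  have hT : 0 ≤ Real.log (2 + |t|) := Real.log_nonneg (by linarith [abs_nonneg t])
  have h4 : 5000 * ((40 / X) / 2) * MM q t ≤ 100000 * (Real.log q / X) + 2000 * Real.log (2 + |t|) := by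
    unfold MM
    have : 5000 * ((40 / X) / 2) * (Real.log q + Real.log (2 + |t|)) =
      100000 * (Real.log q / X) + (2500 * (40 / X)) * Real.log (2 + |t|) := by ring
    rw [this]
    have : 2500 * (40 / X) ≤ 2000 := by linarith
    nlinarith
  linarith

/-! ### B1: majorisation of character averages by a random model -/

set_option linter.unusedSectionVars false

section Maj

variable {σ : Type*} [Fintype σ] [DecidableEq σ]

/-- integer attached to an exponent vector -/
def vv (pr : σ → ℕ) (α : σ → ℕ) : ℕ := ∏ x, pr x ^ α x

/-- random model -/
noncomputable def rf (ω : σ → Fin 4) (α : σ → ℕ) : ℂ := ∏ x, (I ^ (ω x).val) ^ α x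

lemma vv_add (pr : σ → ℕ) (α β : σ → ℕ) : vv pr (α + β) = vv pr α * vv pr β := by
  simp [vv, pow_add, Finset.prod_mul_distrib]

lemma rf_add (ω : σ → Fin 4) (α β : σ → ℕ) : rf ω (α + β) = rf ω α * rf ω β := by
  simp [rf, pow_add, Finset.prod_mul_distrib]

/-- expectation over the random model -/
noncomputable def EX (h : (σ → Fin 4) → ℂ) : ℂ := (∑ ω, h ω) / 4 ^ (Fintype.card σ)

inductive Maj {q : ℕ} (pr : σ → ℕ) :
    ℝ → (DirichletCharacter ℂ q → ℂ) → ((σ → Fin 4) → ℂ) → Prop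
  | mono (D : ℝ) (α β : σ → ℕ) (c : ℂ) (c' : ℝ) (hc : ‖c‖ ≤ c')
      (hD : c ≠ 0 → (vv pr α : ℝ) ≤ D ∧ (vv pr β : ℝ) ≤ D) :
      Maj pr D (fun χ => c * (χ (vv pr α : ℕ) * (starRingEnd ℂ) (χ (vv pr β : ℕ))))
        (fun ω => c' * (rf ω α * (starRingEnd ℂ) (rf ω β)))
  | add (D : ℝ) (u u' : DirichletCharacter ℂ q → ℂ) (h h' : (σ → Fin 4) → ℂ) :
      Maj pr D u h → Maj pr D u' h' → Maj pr D (fun χ => u χ + u' χ) (fun ω => h ω + h' ω)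

variable {q : ℕ} {pr : σ → ℕ}

lemma Maj.congr {D : ℝ} {u u' : DirichletCharacter ℂ q → ℂ} {h h' : (σ → Fin 4) → ℂ}
    (H : Maj pr D u h) (hu : ∀ χ, u χ = u' χ) (hh : ∀ ω, h ω = h' ω) : Maj pr D u' h' := by
  obtain rfl : u = u' := funext hu
  obtain rfl : h = h' := funext hh
  exact H

lemma Maj.le {D D' : ℝ} {u : DirichletCharacter ℂ q → ℂ} {h : (σ → Fin 4) → ℂ}
    (H : Maj pr D u h) (hD : D ≤ D') : Maj pr D' u h := by
  induction H with
  | mono α β c c' hc hl =>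
    exact Maj.mono _ α β c c' hc fun h0 => ⟨(hl h0).1.trans hD, (hl h0).2.trans hD⟩
  | add u u' h h' _ _ ih ih' => exact Maj.add _ _ _ _ _ ih ih'

lemma Maj.kill {D D' : ℝ} {u : DirichletCharacter ℂ q → ℂ} {h : (σ → Fin 4) → ℂ}
    (H : Maj pr D u h) : Maj pr D' (fun _ : DirichletCharacter ℂ q => 0) h := by
  induction H with
  | mono α β c c' hc hl =>
    refine (Maj.mono D' α β 0 c' (by simpa using (norm_nonneg c).trans hc) (by simp)).congr ?_ ?_ <;> simp
  | add u u' h h' _ _ ih ih' =>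
    exact (Maj.add _ _ _ _ _ ih ih').congr (by simp) (by simp)

lemma Maj.mul {D D' : ℝ} {u u' : DirichletCharacter ℂ q → ℂ} {h h' : (σ → Fin 4) → ℂ}
    (H : Maj pr D u h) (H' : Maj pr D' u' h') :
    Maj pr (D * D') (fun χ => u χ * u' χ) (fun ω => h ω * h' ω) := by
  induction H with
  | mono α β c c' hc hl =>
    induction H' with
    | mono α₂ β₂ c₂ c₂' hc₂ hl₂ =>
      refine (Maj.mono (D * D') (α + α₂) (β + β₂) (c * c₂) (c' * c₂') ?_ ?_).congr ?_ ?_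
      · rw [norm_mul]
        exact mul_le_mul hc hc₂ (norm_nonneg _) ((norm_nonneg c).trans hc)
      · intro h0
        obtain ⟨h1, h2⟩ := hl (left_ne_zero_of_mul h0)
        obtain ⟨h3, h4⟩ := hl₂ (right_ne_zero_of_mul h0)
        rw [vv_add, vv_add]
        push_cast
        have : (0:ℝ) ≤ vv pr α := Nat.cast_nonneg _
        exact ⟨mul_le_mul h1 h3 (Nat.cast_nonneg _) (this.trans h1),
          mul_le_mul h2 h4 (Nat.cast_nonneg _) (this.trans h1)⟩
      · intro χ
        simp only [vv_add, Nat.cast_mul, map_mul]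
        ring
      · intro ω
        simp only [rf_add, map_mul]
        push_cast
        ring
    | add u u' h h' _ _ ih ih' =>
      refine (Maj.add _ _ _ _ _ ih ih').congr ?_ ?_ <;> intros <;> ring
  | add u u' h h' _ _ ih ih' =>
    refine (Maj.add _ _ _ _ _ ih ih').congr ?_ ?_ <;> intros <;> ring

lemma Maj.const (c : ℂ) (c' : ℝ) (hc : ‖c‖ ≤ c') : Maj (q := q) pr 1 (fun _ => c) (fun _ => (c' : ℂ)) := by
  refine (Maj.mono 1 0 0 c c' hc ?_).congr ?_ ?_
  · intro _; simp [vv]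
  · intro χ; simp [vv]
  · intro ω; simp [rf]

lemma Maj.smul {D : ℝ} {u : DirichletCharacter ℂ q → ℂ} {h : (σ → Fin 4) → ℂ}
    (H : Maj pr D u h) {r : ℝ} (hr : 0 ≤ r) : Maj pr D (fun χ => r * u χ) (fun ω => r * h ω) := by
  have := (Maj.const (q := q) (pr := pr) (r : ℂ) r (by simp [abs_of_nonneg hr])).mul H
  rwa [one_mul] at this

lemma Maj.pow {D : ℝ} {u : DirichletCharacter ℂ q → ℂ} {h : (σ → Fin 4) → ℂ}
    (H : Maj pr D u h) (n : ℕ) : Maj pr (D ^ n) (fun χ => u χ ^ n) (fun ω => h ω ^ n) := by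
  induction n with
  | zero =>
    simpa using Maj.const (q := q) (pr := pr) 1 1 (by simp)
  | succ n ih =>
    refine ((ih.mul H).le (by rw [pow_succ])).congr ?_ ?_ <;> intros <;> ring

lemma Maj.sum {ι : Type*} (s : Finset ι) {D : ℝ} {u : ι → DirichletCharacter ℂ q → ℂ}
    {h : ι → (σ → Fin 4) → ℂ} (H : ∀ i ∈ s, Maj pr D (u i) (h i)) :
    Maj pr D (fun χ => ∑ i ∈ s, u i χ) (fun ω => ∑ i ∈ s, h i ω) := by
  classical
  induction s using Finset.induction_on with
  | empty =>
    exact (Maj.kill (Maj.const (q := q) (pr := pr) 0 0 (by simp))).congr (by simp) (by simp)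
  | insert i s hi ih =>
    refine (Maj.add _ _ _ _ _ (H i (Finset.mem_insert_self _ _))
      (ih fun j hj => H j (Finset.mem_insert_of_mem hj))).congr ?_ ?_ <;> intros <;>
      rw [Finset.sum_insert hi]

lemma Maj.prod {ι : Type*} (s : Finset ι) {D : ι → ℝ} {u : ι → DirichletCharacter ℂ q → ℂ}
    {h : ι → (σ → Fin 4) → ℂ} (H : ∀ i ∈ s, Maj pr (D i) (u i) (h i)) :
    Maj pr (∏ i ∈ s, D i) (fun χ => ∏ i ∈ s, u i χ) (fun ω => ∏ i ∈ s, h i ω) := by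
  classical
  induction s using Finset.induction_on with
  | empty =>
    simpa using Maj.const (q := q) (pr := pr) 1 1 (by simp)
  | insert i s hi ih =>
    rw [Finset.prod_insert hi]
    refine ((H i (Finset.mem_insert_self _ _)).mul
      (ih fun j hj => H j (Finset.mem_insert_of_mem hj))).congr ?_ ?_ <;> intros <;>
      rw [Finset.prod_insert hi]

/-- truncated exponential -/
noncomputable def EE (n : ℕ) (z : ℂ) : ℂ := ∑ r ∈ Finset.range (n + 1), z ^ r / r.factorial

lemma Maj.EE {D : ℝ} (hD : 1 ≤ D) {u : DirichletCharacter ℂ q → ℂ} {h : (σ → Fin 4) → ℂ}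
    (H : Maj pr D u h) {n M : ℕ} (hn : n ≤ M) :
    Maj pr (D ^ n) (fun χ => EE n (u χ)) (fun ω => _root_.EE M (h ω)) := by
  have hterm : ∀ r ∈ Finset.range (M + 1), Maj pr (D ^ n)
      (fun χ => if r ∈ Finset.range (n + 1) then (u χ) ^ r / (r.factorial : ℂ) else 0)
      (fun ω => (h ω) ^ r / (r.factorial : ℂ)) := by
    intro r _
    have h1 : Maj pr (D ^ r) (fun χ => (u χ) ^ r / (r.factorial : ℂ)) (fun ω => (h ω) ^ r / (r.factorial : ℂ)) := by
      refine ((H.pow r).smul (r := (r.factorial : ℝ)⁻¹) (by positivity)).congr ?_ ?_ <;> intros <;>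
        push_cast <;> ring
    by_cases hr : r ∈ Finset.range (n + 1)
    · simp only [hr, if_true]
      refine h1.le (pow_le_pow_right₀ hD ?_)
      rw [Finset.mem_range] at hr; omega
    · simp only [hr, if_false]
      exact h1.kill
  refine (Maj.sum _ hterm).congr ?_ ?_
  · intro χ
    rw [_root_.EE, ← Finset.sum_filter]
    refine Finset.sum_congr ?_ fun _ _ => rfl
    ext r
    simp only [Finset.mem_filter, Finset.mem_range]
    omega
  · intro ω; rfl

lemma sum_four (z : ℂ) (hz : z ^ 4 = 1) : ∑ j : Fin 4, z ^ (j : ℕ) = if z = 1 then 4 else 0 := by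
  rw [Fin.sum_univ_four]
  split_ifs with h
  · rw [h]; norm_num
  · have h1 : (z - 1) * (1 + z + z ^ 2 + z ^ 3) = 0 := by linear_combination hz
    have h2 := (mul_eq_zero.1 h1).resolve_left (sub_ne_zero.2 h)
    simpa using h2

lemma EX_prod (g : σ → Fin 4 → ℂ) : EX (fun ω => ∏ x, g x (ω x)) = ∏ x, ((∑ j, g x j) / 4) := by
  unfold EX
  rw [Finset.prod_div_distrib, Finset.prod_const, Finset.card_univ]
  congr 1
  rw [Finset.prod_univ_sum, Fintype.piFinset_univ]

lemma EX_mono (α β : σ → ℕ) : EX (fun ω => rf ω α * (starRingEnd ℂ) (rf ω β)) = 1 ∨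
    (EX (fun ω => rf ω α * (starRingEnd ℂ) (rf ω β)) = 0 ∧ α ≠ β) := by
  set z : σ → ℂ := fun x => I ^ α x * (-I) ^ β x with hz
  have h4 : ∀ x, z x ^ 4 = 1 := by
    intro x
    have h1 : (I:ℂ) ^ 4 = 1 := I_pow_four
    have h2 : (-I:ℂ) ^ 4 = 1 := by rw [neg_pow]; norm_num
    simp only [hz]
    rw [mul_pow, ← pow_mul, ← pow_mul, mul_comm (α x), mul_comm (β x), pow_mul, pow_mul, h1, h2]
    simp
  have e : (fun ω : σ → Fin 4 => rf ω α * (starRingEnd ℂ) (rf ω β)) =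
      fun ω => ∏ x, (fun (x : σ) (j : Fin 4) => z x ^ (j : ℕ)) x (ω x) := by
    ext ω
    simp only [rf, map_prod, map_pow, conj_I, ← Finset.prod_mul_distrib, hz]
    refine Finset.prod_congr rfl fun x _ => ?_
    rw [mul_pow, ← pow_mul, ← pow_mul, ← pow_mul, ← pow_mul, mul_comm (α x), mul_comm (β x)]
  rw [e, EX_prod (fun x j => z x ^ (j:ℕ))]
  simp only [sum_four _ (h4 _)]
  by_cases hall : ∀ x, z x = 1
  · left
    simp [hall]
  · right
    push Not at hall
    obtain ⟨x, hx⟩ := hall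
    refine ⟨Finset.prod_eq_zero (Finset.mem_univ x) (by simp [hx]), ?_⟩
    rintro rfl
    apply hx
    simp only [hz]
    rw [← mul_pow]
    simp

lemma vv_inj (hpr : Function.Injective pr) (hp : ∀ x, (pr x).Prime) {α β : σ → ℕ}
    (h : vv pr α = vv pr β) : α = β := by
  have key : ∀ (α : σ → ℕ) (x : σ), (vv pr α).factorization (pr x) = α x := by
    intro α x
    unfold vv
    rw [Nat.factorization_prod fun y _ => pow_ne_zero _ (hp y).ne_zero]
    rw [Finset.sum_apply']
    rw [Finset.sum_eq_single x]
    · rw [(hp x).factorization_pow]; simp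
    · intro y _ hy
      rw [(hp y).factorization_pow, Finsupp.single_eq_of_ne]
      intro h; exact hy (hpr h.symm)
    · simp
  ext x
  rw [← key α x, h, key β x]

lemma Maj.bound [NeZero q] (hpr : Function.Injective pr) (hp : ∀ x, (pr x).Prime)
    {D : ℝ} (hDq : D < q) {u : DirichletCharacter ℂ q → ℂ} {h : (σ → Fin 4) → ℂ}
    (H : Maj pr D u h) : ‖∑ χ, u χ‖ ≤ (q.totient : ℝ) * (EX h).re := by
  induction H with
  | mono α β c c' hc hl =>
    have hc' : 0 ≤ c' := (norm_nonneg c).trans hc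
    have e : EX (fun ω => (c':ℂ) * (rf ω α * (starRingEnd ℂ) (rf ω β))) =
        c' * EX (fun ω => (rf ω α * (starRingEnd ℂ) (rf ω β))) := by
      simp only [EX, ← Finset.mul_sum, mul_div_assoc]
    have hE0 : 0 ≤ (EX (fun ω => (rf ω α * (starRingEnd ℂ) (rf ω β)))).re := by
      rcases EX_mono α β with h | h
      · rw [h]; simp
      · rw [h.1]; simp
    rw [e, Complex.re_ofReal_mul, ← Finset.mul_sum, norm_mul]
    rcases eq_or_ne c 0 with rfl | hc0
    · simp only [norm_zero, zero_mul]; positivity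
    obtain ⟨ha, hb⟩ := hl hc0
    have ha' : vv pr α < q := by exact_mod_cast ha.trans_lt hDq
    have hb' : vv pr β < q := by exact_mod_cast hb.trans_lt hDq
    by_cases hu : IsUnit ((vv pr β : ℕ) : ZMod q)
    · have horth := DirichletCharacter.sum_char_inv_mul_char_eq ℂ (n := q) hu (vv pr α : ZMod q)
      have e2 : ∑ χ : DirichletCharacter ℂ q, χ (vv pr α : ℕ) * (starRingEnd ℂ) (χ (vv pr β : ℕ)) =
          ∑ χ : DirichletCharacter ℂ q, χ ((vv pr β : ℕ) : ZMod q)⁻¹ * χ (vv pr α : ℕ) := by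
        refine Finset.sum_congr rfl fun χ _ => ?_
        rw [mul_comm]
        congr 1
        rw [starRingEnd_apply, MulChar.star_apply', MulChar.inv_apply]
        obtain ⟨b, hb⟩ := hu
        rw [← hb, ZMod.inv_coe_unit]
        simp
      rw [e2, horth]
      split_ifs with hmod
      · have hv : vv pr β = vv pr α := by
          rw [ZMod.natCast_eq_natCast_iff'] at hmod
          rwa [Nat.mod_eq_of_lt ha', Nat.mod_eq_of_lt hb'] at hmod
        have hab := vv_inj hpr hp hv
        rcases EX_mono α β with h | h
        · rw [h]; simp; rw [mul_comm]; gcongr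
        · exact absurd hab.symm h.2
      · simp only [norm_zero, mul_zero]; positivity
    · have : ∀ χ : DirichletCharacter ℂ q, χ (vv pr β : ℕ) = 0 := fun χ => χ.map_nonunit hu
      simp only [this, map_zero, mul_zero, Finset.sum_const_zero, norm_zero]; positivity
  | add u u' h h' _ _ ih ih' =>
    rw [Finset.sum_add_distrib]
    have : EX (fun ω => h ω + h' ω) = EX h + EX h' := by
      simp only [EX, Finset.sum_add_distrib, add_div]
    rw [this, add_re, mul_add]
    exact (norm_add_le _ _).trans (add_le_add ih ih')

end Maj

/-! ### B2: expectations in the random model -/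

/-- average of `exp (a Re f + b Re f^2)` over fourth roots of unity -/
noncomputable def avg (a b : ℝ) : ℝ := (Real.exp b * Real.cosh a + Real.exp (-b)) / 2

lemma avg_pos (a b : ℝ) : 0 < avg a b := by
  unfold avg
  have := Real.cosh_pos a
  positivity

lemma avg_zero : avg 0 0 = 1 := by
  unfold avg; norm_num

lemma avg_le_good (c d : ℝ) (hd : 0 ≤ d) : avg c d ≤ Real.exp (Real.exp d * c ^ 2 / 4 + d ^ 2 / 2) := by
  set G := Real.exp (c ^ 2 / 4) - 1 with hG
  have hG0 : 0 ≤ G := by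
    have := Real.add_one_le_exp (c ^ 2 / 4)
    have := sq_nonneg c
    simp only [hG]; linarith
  have h1 : Real.cosh c ≤ 1 + 2 * G := by
    have e : Real.cosh c = 2 * Real.cosh (c / 2) ^ 2 - 1 := by
      have := Real.cosh_two_mul (c / 2)
      rw [show 2 * (c / 2) = c by ring] at this
      have h2 := Real.cosh_sq (c / 2)
      rw [this]; linarith
    have h2 : Real.cosh (c / 2) ^ 2 ≤ Real.exp (c ^ 2 / 4) := by
      have h3 := Real.cosh_le_exp_half_sq (c / 2)
      calc Real.cosh (c / 2) ^ 2 ≤ (Real.exp ((c / 2) ^ 2 / 2)) ^ 2 := by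
            have := Real.cosh_pos (c / 2)
            gcongr
        _ = Real.exp (c ^ 2 / 4) := by
            rw [← Real.exp_nat_mul]; congr 1; push_cast; ring
    rw [e]; simp only [hG]; linarith
  have hch := Real.one_le_cosh d
  have h2 : avg c d ≤ Real.cosh d * (1 + Real.exp d / Real.cosh d * G) := by
    have : Real.cosh d * (1 + Real.exp d / Real.cosh d * G) = Real.cosh d + Real.exp d * G := by
      have : Real.cosh d ≠ 0 := (Real.cosh_pos d).ne'
      field_simp
    rw [this, Real.cosh_eq d]
    unfold avg
    have := mul_le_mul_of_nonneg_left h1 (Real.exp_pos d).le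
    nlinarith
  have hlam : 1 ≤ Real.exp d / Real.cosh d := by
    rw [le_div_iff₀ (Real.cosh_pos d), one_mul, Real.cosh_eq]
    have : Real.exp (-d) ≤ Real.exp d := Real.exp_le_exp.2 (by linarith)
    linarith
  have h3 : 1 + Real.exp d / Real.cosh d * G ≤ Real.exp (Real.exp d * c ^ 2 / 4) := by
    have hb := one_add_mul_self_le_rpow_one_add (s := G) (by linarith) hlam
    refine hb.trans ?_
    have : 1 + G = Real.exp (c ^ 2 / 4) := by simp only [hG]; ring
    rw [this, ← Real.exp_mul]
    apply Real.exp_le_exp.2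
    have h5 : Real.exp d / Real.cosh d ≤ Real.exp d := div_le_self (Real.exp_pos d).le hch
    nlinarith [sq_nonneg c]
  calc avg c d ≤ _ := h2
    _ ≤ Real.exp (d ^ 2 / 2) * Real.exp (Real.exp d * c ^ 2 / 4) := by
        refine mul_le_mul (Real.cosh_le_exp_half_sq d) h3 ?_ (Real.exp_pos _).le
        positivity
    _ = _ := by rw [← Real.exp_add]; congr 1; ring

lemma exp_le_cosh_add {R z : ℝ} (hR : 0 < R) (h1 : -R ≤ z) (h2 : z ≤ R) :
    Real.exp z ≤ Real.cosh R + z / R * Real.sinh R := by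
  have ha : 0 ≤ (R - z) / (2 * R) := div_nonneg (by linarith) (by linarith)
  have hb : 0 ≤ (R + z) / (2 * R) := div_nonneg (by linarith) (by linarith)
  have hab : (R - z) / (2 * R) + (R + z) / (2 * R) = 1 := by field_simp; ring
  have hc := convexOn_exp.2 (Set.mem_univ (-R)) (Set.mem_univ R) ha hb hab
  simp only [smul_eq_mul] at hc
  have e : (R - z) / (2 * R) * -R + (R + z) / (2 * R) * R = z := by field_simp; ring
  rw [e] at hc
  refine hc.trans (le_of_eq ?_)
  rw [Real.cosh_eq, Real.sinh_eq]
  field_simp; ring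

lemma avg_le_bad (c d : ℝ) : avg c d ≤ Real.exp (c ^ 2 + d ^ 2) := by
  set R := |c| + |d| with hR
  rcases eq_or_lt_of_le (show 0 ≤ R by positivity) with h0 | h0
  · have hc : |c| = 0 := by have := abs_nonneg c; have := abs_nonneg d; linarith
    have hd : |d| = 0 := by have := abs_nonneg c; have := abs_nonneg d; linarith
    rw [abs_eq_zero] at hc hd
    subst hc; subst hd
    simp [avg_zero]
  have a1 := abs_le.1 (le_refl |c|)
  have a2 := abs_le.1 (le_refl |d|)
  have e1 := exp_le_cosh_add (z := c + d) h0 (by linarith) (by linarith)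
  have e2 := exp_le_cosh_add (z := -c + d) h0 (by linarith) (by linarith)
  have e3 := exp_le_cosh_add (z := -d) h0 (by linarith) (by linarith)
  have hav : avg c d = (Real.exp (c + d) + Real.exp (-c + d) + 2 * Real.exp (-d)) / 4 := by
    unfold avg; rw [Real.cosh_eq, Real.exp_add, Real.exp_add]; ring
  have h1 : avg c d ≤ Real.cosh R := by
    rw [hav]
    have : (c + d) / R * Real.sinh R + (-c + d) / R * Real.sinh R + 2 * (-d / R * Real.sinh R) = 0 := by
      ring
    linarith
  refine h1.trans ((Real.cosh_le_exp_half_sq R).trans (Real.exp_le_exp.2 ?_))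
  have : R ^ 2 ≤ 2 * (c ^ 2 + d ^ 2) := by
    rw [← sq_abs c, ← sq_abs d, hR]; nlinarith [sq_nonneg (|c| - |d|)]
  linarith

set_option linter.unusedSectionVars false

section Model

variable {σ : Type*} [Fintype σ] [DecidableEq σ]

/-- real part of the random value -/
noncomputable def xx (j : Fin 4) : ℝ := (I ^ (j : ℕ)).re
/-- real part of the square of the random value -/
noncomputable def yy (j : Fin 4) : ℝ := ((I ^ (j : ℕ)) ^ 2).re

/-- linear form in the random model -/
noncomputable def HR (w C D : σ → ℝ) (ω : σ → Fin 4) : ℝ := ∑ x, w x * (C x * xx (ω x) + D x * yy (ω x))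

lemma EX_exp (w C D : σ → ℝ) : EX (fun ω => (Real.exp (HR w C D ω) : ℂ)) =
    ((∏ x, avg (w x * C x) (w x * D x) : ℝ) : ℂ) := by
  have e : (fun ω : σ → Fin 4 => (Real.exp (HR w C D ω) : ℂ)) =
      fun ω => ∏ x, (fun (x : σ) (j : Fin 4) => (Real.exp (w x * (C x * xx j + D x * yy j)) : ℂ)) x (ω x) := by
    ext ω
    unfold HR
    rw [Real.exp_sum]
    push_cast
    rfl
  rw [e, EX_prod (fun (x : σ) (j : Fin 4) => (Real.exp (w x * (C x * xx j + D x * yy j)) : ℂ))]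
  rw [Complex.ofReal_prod]
  refine Finset.prod_congr rfl fun x _ => ?_
  rw [← Complex.ofReal_sum]
  rw [show (4:ℂ) = ((4:ℝ):ℂ) by norm_num, ← Complex.ofReal_div]
  congr 1
  have x0 : xx 0 = 1 := by simp [xx]
  have x1 : xx 1 = 0 := by simp [xx]
  have x2 : xx 2 = -1 := by simp [xx]
  have x3 : xx 3 = 0 := by simp [xx, pow_succ]
  have y0 : yy 0 = 1 := by simp [yy]
  have y1 : yy 1 = -1 := by simp [yy]
  have y2 : yy 2 = 1 := by simp [yy]
  have y3 : yy 3 = -1 := by simp [yy, pow_succ]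
  rw [Fin.sum_univ_four, x0, x1, x2, x3, y0, y1, y2, y3]
  unfold avg
  rw [Real.cosh_eq]
  have a1 : w x * (C x * 1 + D x * 1) = w x * D x + w x * C x := by ring
  have a2 : w x * (C x * 0 + D x * -1) = -(w x * D x) := by ring
  have a3 : w x * (C x * -1 + D x * 1) = w x * D x + -(w x * C x) := by ring
  rw [a1, a2, a3, Real.exp_add, Real.exp_add]
  ring

variable {q : ℕ} {pr : σ → ℕ}

/-- character side linear form -/
noncomputable def YC (pr : σ → ℕ) (B : Finset σ) (c d : σ → ℂ) (χ : DirichletCharacter ℂ q) : ℝ :=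
  ∑ x ∈ B, (c x * χ (pr x) + d x * χ (pr x) ^ 2).re

lemma vv_single (x : σ) (n : ℕ) : vv pr (Pi.single x n) = pr x ^ n := by
  unfold vv
  rw [Finset.prod_eq_single x]
  · simp
  · intro y _ hy; simp [hy]
  · simp

lemma rf_single (ω : σ → Fin 4) (x : σ) (n : ℕ) : rf ω (Pi.single x n) = (I ^ (ω x).val) ^ n := by
  unfold rf
  rw [Finset.prod_eq_single x]
  · simp
  · intro y _ hy; simp [hy]
  · simp

lemma vv_zero : vv pr 0 = 1 := by simp [vv]
lemma rf_zero (ω : σ → Fin 4) : rf ω 0 = 1 := by simp [rf]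

lemma Maj.YC {P : ℝ} (hpos : ∀ x, 1 ≤ pr x) {B : Finset σ} (hP1 : 1 ≤ P) (hP : ∀ x ∈ B, (pr x : ℝ) ^ 2 ≤ P)
    {c d : σ → ℂ} {C D : σ → ℝ} (hc : ∀ x ∈ B, ‖c x‖ ≤ C x) (hd : ∀ x ∈ B, ‖d x‖ ≤ D x) :
    Maj pr P (fun χ : DirichletCharacter ℂ q => (YC pr B c d χ : ℂ))
      (fun ω => (HR (fun x => if x ∈ B then 1 else 0) C D ω : ℂ)) := by
  have half : ∀ z : ℂ, ((z.re : ℝ) : ℂ) = (1/2) * z + (1/2) * (starRingEnd ℂ) z := by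
    intro z
    have := Complex.add_conj z
    push_cast at this
    linear_combination (-1/2) * this
  have key : ∀ x ∈ B, Maj pr P (fun χ : DirichletCharacter ℂ q => (((c x * χ (pr x) + d x * χ (pr x) ^ 2).re : ℝ) : ℂ))
      (fun ω => ((C x * xx (ω x) + D x * yy (ω x) : ℝ) : ℂ)) := by
    intro x hx
    have hsq := hP x hx
    have hp1 : (1:ℝ) ≤ pr x := by exact_mod_cast hpos x
    have hle : (pr x : ℝ) ≤ P := by nlinarith
    have n1 : ‖(1/2 : ℂ) * c x‖ ≤ 1/2 * C x := by
      rw [norm_mul]; have := hc x hx; norm_num; linarith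
    have n2 : ‖(1/2 : ℂ) * d x‖ ≤ 1/2 * D x := by
      rw [norm_mul]; have := hd x hx; norm_num; linarith
    have n3 : ‖(1/2 : ℂ) * (starRingEnd ℂ) (c x)‖ ≤ 1/2 * C x := by
      rw [norm_mul, RCLike.norm_conj]; have := hc x hx; norm_num; linarith
    have n4 : ‖(1/2 : ℂ) * (starRingEnd ℂ) (d x)‖ ≤ 1/2 * D x := by
      rw [norm_mul, RCLike.norm_conj]; have := hd x hx; norm_num; linarith
    have m1 := Maj.mono (q := q) (pr := pr) P (Pi.single x 1) 0 _ _ n1 (by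
      intro _; rw [vv_single, vv_zero]; push_cast; rw [pow_one]; exact ⟨hle, hP1⟩)
    have m2 := Maj.mono (q := q) (pr := pr) P (Pi.single x 2) 0 _ _ n2 (by
      intro _; rw [vv_single, vv_zero]; push_cast; exact ⟨hsq, hP1⟩)
    have m3 := Maj.mono (q := q) (pr := pr) P 0 (Pi.single x 1) _ _ n3 (by
      intro _; rw [vv_single, vv_zero]; push_cast; rw [pow_one]; exact ⟨hP1, hle⟩)
    have m4 := Maj.mono (q := q) (pr := pr) P 0 (Pi.single x 2) _ _ n4 (by
      intro _; rw [vv_single, vv_zero]; push_cast; exact ⟨hP1, hsq⟩)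
    refine (((m1.add _ _ _ _ _ m2).add _ _ _ _ _ (m3.add _ _ _ _ _ m4))).congr ?_ ?_
    · intro χ
      rw [half]
      simp only [vv_single, vv_zero, map_add, map_mul, map_pow, Nat.cast_one, map_one, Nat.cast_pow]
      ring
    · intro ω
      simp only [rf_single, rf_zero, xx, yy]
      push_cast
      rw [half, half]
      simp only [map_pow, map_one]
      ring
  refine (Maj.sum B key).congr ?_ ?_
  · intro χ; unfold _root_.YC; push_cast; rfl
  · intro ω; unfold HR; push_cast
    simp only [apply_ite, ite_mul, one_mul, zero_mul, Complex.ofReal_one, Complex.ofReal_zero]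
    rw [Finset.sum_ite_mem, Finset.univ_inter]

/-- real truncated exponential -/
noncomputable def EEr (n : ℕ) (y : ℝ) : ℝ := ∑ r ∈ Finset.range (n + 1), y ^ r / r.factorial

lemma EE_ofReal (n : ℕ) (y : ℝ) : EE n (y : ℂ) = (EEr n y : ℂ) := by
  simp [EE, EEr]

lemma EEr_tendsto (y : ℝ) : Filter.Tendsto (fun M => EEr M y) Filter.atTop (nhds (Real.exp y)) := by
  have h := (NormedSpace.expSeries_div_hasSum_exp (𝔸 := ℝ) y).tendsto_sum_nat
  rw [← Real.exp_eq_exp_ℝ] at h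
  exact h.comp (Filter.tendsto_add_atTop_nat 1)

lemma EX_re (g : (σ → Fin 4) → ℝ) : (EX (fun ω => (g ω : ℂ))).re = (∑ ω, g ω) / 4 ^ (Fintype.card σ) := by
  unfold EX
  rw [← Complex.ofReal_sum, show (4:ℂ) = ((4:ℝ):ℂ) by norm_num, ← Complex.ofReal_pow, ← Complex.ofReal_div,
    Complex.ofReal_re]

lemma pow_le_exp (m : ℕ) {μ : ℝ} (hμ : 0 < μ) (y : ℝ) :
    y ^ (2 * m) ≤ (2 * m).factorial / μ ^ (2 * m) * (Real.exp (μ * y) + Real.exp (-(μ * y))) := by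
  have h1 : |μ * y| ^ (2 * m) / (2 * m).factorial ≤ Real.exp |μ * y| := by
    exact Real.pow_div_factorial_le_exp _ (abs_nonneg _) _
  have h2 : Real.exp |μ * y| ≤ Real.exp (μ * y) + Real.exp (-(μ * y)) := by
    have a := Real.exp_pos (μ * y)
    have b := Real.exp_pos (-(μ * y))
    rcases abs_choice (μ * y) with h | h <;> rw [h] <;> linarith
  have h3 : |μ * y| ^ (2 * m) = μ ^ (2 * m) * y ^ (2 * m) := by
    rw [Even.pow_abs (even_two_mul m), mul_pow]
  rw [h3] at h1
  have hf : (0:ℝ) < (2 * m).factorial := by positivity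
  have hm : 0 < μ ^ (2 * m) := by positivity
  rw [div_le_iff₀ hf] at h1
  rw [div_mul_eq_mul_div, le_div_iff₀ hm]
  calc y ^ (2 * m) * μ ^ (2 * m) = μ ^ (2 * m) * y ^ (2 * m) := mul_comm _ _
    _ ≤ _ := h1
    _ ≤ _ := by rw [mul_comm]; gcongr

lemma HR_add (w w' C D : σ → ℝ) (ω : σ → Fin 4) : HR (fun x => w x + w' x) C D ω = HR w C D ω + HR w' C D ω := by
  unfold HR; rw [← Finset.sum_add_distrib]; refine Finset.sum_congr rfl fun x _ => ?_; ring

lemma HR_smul (a : ℝ) (w C D : σ → ℝ) (ω : σ → Fin 4) : HR (fun x => a * w x) C D ω = a * HR w C D ω := by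
  unfold HR; rw [Finset.mul_sum]; refine Finset.sum_congr rfl fun x _ => ?_; ring

lemma HR_biUnion (S : Finset ℕ) (B : ℕ → Finset σ) (hdis : Set.PairwiseDisjoint (S : Set ℕ) B) (C D : σ → ℝ) (ω : σ → Fin 4) :
    HR (fun x => if x ∈ S.biUnion B then 1 else 0) C D ω =
    ∑ i ∈ S, HR (fun x => if x ∈ B i then 1 else 0) C D ω := by
  have e : ∀ T : Finset σ, HR (fun x => if x ∈ T then 1 else 0) C D ω = ∑ x ∈ T, (C x * xx (ω x) + D x * yy (ω x)) := by
    intro T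
    unfold HR
    simp only [ite_mul, one_mul, zero_mul]
    rw [Finset.sum_ite_mem, Finset.univ_inter]
  simp only [e]
  rw [Finset.sum_biUnion hdis]

lemma prod_avg_le (U B' : Finset σ) (hdis : Disjoint U B') (C D : σ → ℝ) (hD : ∀ x, 0 ≤ D x) (μ : ℝ) :
    ∏ x, avg (((if x ∈ U then 1 else 0) + μ * (if x ∈ B' then 1 else 0)) * C x)
      (((if x ∈ U then 1 else 0) + μ * (if x ∈ B' then 1 else 0)) * D x) ≤
    Real.exp (∑ x ∈ U, (Real.exp (D x) * C x ^ 2 / 4 + D x ^ 2 / 2)) *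
      Real.exp (μ ^ 2 * ∑ x ∈ B', (C x ^ 2 + D x ^ 2)) := by
  rw [Finset.mul_sum, ← Real.exp_add, ← Finset.univ_inter U, ← Finset.univ_inter B', ← Finset.sum_ite_mem,
    ← Finset.sum_ite_mem, ← Finset.sum_add_distrib, Real.exp_sum]
  simp only [Finset.univ_inter]
  refine Finset.prod_le_prod (fun x _ => (avg_pos _ _).le) fun x _ => ?_
  by_cases h1 : x ∈ U
  · have h2 : x ∉ B' := Finset.disjoint_left.1 hdis h1
    simp only [h1, h2, if_true, if_false, mul_zero, add_zero, one_mul]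
    exact avg_le_good _ _ (hD x)
  · by_cases h2 : x ∈ B'
    · simp only [h1, h2, if_true, if_false, mul_one, zero_add]
      refine (avg_le_bad _ _).trans (le_of_eq ?_)
      congr 1; ring
    · simp [h1, h2, avg_zero]

theorem model_bound [NeZero q] (hpr : Function.Injective pr) (hp : ∀ x, (pr x).Prime)
    (S : Finset ℕ) (B : ℕ → Finset σ) (hdis : Set.PairwiseDisjoint (S : Set ℕ) B)
    (B' : Finset σ) (hdis' : Disjoint (S.biUnion B) B')
    (C D : σ → ℝ) (hD : ∀ x, 0 ≤ D x)
    (c d : ℕ → σ → ℂ) (hc : ∀ i ∈ S, ∀ x ∈ B i, ‖c i x‖ ≤ C x) (hd : ∀ i ∈ S, ∀ x ∈ B i, ‖d i x‖ ≤ D x)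
    (c' d' : σ → ℂ) (hc' : ∀ x ∈ B', ‖c' x‖ ≤ C x) (hd' : ∀ x ∈ B', ‖d' x‖ ≤ D x)
    (P : ℕ → ℝ) (hP1 : ∀ i ∈ S, 1 ≤ P i) (hP : ∀ i ∈ S, ∀ x ∈ B i, (pr x : ℝ) ^ 2 ≤ P i)
    (P' : ℝ) (hP1' : 1 ≤ P') (hP' : ∀ x ∈ B', (pr x : ℝ) ^ 2 ≤ P')
    (n : ℕ → ℕ) (m : ℕ) (hlen : (∏ i ∈ S, (P i ^ n i) ^ 2) * P' ^ (2 * m) < q) {μ : ℝ} (hμ : 0 < μ) :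
    ∑ χ : DirichletCharacter ℂ q, (∏ i ∈ S, EEr (n i) (YC pr (B i) (c i) (d i) χ / 2) ^ 2) *
      YC pr B' c' d' χ ^ (2 * m) ≤
    q.totient * (2 * ((2 * m).factorial / μ ^ (2 * m)) *
      (Real.exp (∑ x ∈ S.biUnion B, (Real.exp (D x) * C x ^ 2 / 4 + D x ^ 2 / 2)) *
      Real.exp (μ ^ 2 * ∑ x ∈ B', (C x ^ 2 + D x ^ 2)))) := by
  classical
  set hi : ℕ → (σ → Fin 4) → ℝ := fun i => HR (fun x => if x ∈ B i then 1 else 0) C D with hhi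
  set h' : (σ → Fin 4) → ℝ := HR (fun x => if x ∈ B' then 1 else 0) C D with hh'
  have hpos : ∀ x, 1 ≤ pr x := fun x => (hp x).one_lt.le
  set LHS := ∑ χ : DirichletCharacter ℂ q, (∏ i ∈ S, EEr (n i) (YC pr (B i) (c i) (d i) χ / 2) ^ 2) *
      YC pr B' c' d' χ ^ (2 * m) with hL
  have step : ∀ M, (∀ i ∈ S, n i ≤ M) → LHS ≤ q.totient *
      ((∑ ω, (∏ i ∈ S, EEr M (hi i ω / 2) ^ 2) * h' ω ^ (2 * m)) / 4 ^ (Fintype.card σ)) := by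
    intro M hM
    have m1 : ∀ i ∈ S, Maj (q := q) pr ((P i ^ n i) ^ 2)
        (fun χ => EE (n i) ((1/2:ℝ) * (YC pr (B i) (c i) (d i) χ : ℂ)) ^ 2)
        (fun ω => EE M ((1/2:ℝ) * (hi i ω : ℂ)) ^ 2) := by
      intro i hiS
      exact (Maj.EE (hP1 i hiS) ((Maj.YC hpos (hP1 i hiS) (hP i hiS) (hc i hiS) (hd i hiS)).smul
        (by norm_num)) (hM i hiS)).pow 2
    have m2 := (Maj.prod S m1).mul ((Maj.YC (q := q) hpos hP1' hP' hc' hd').pow (2 * m))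
    have m3 := m2.bound hpr hp hlen
    have e1 : ∑ χ : DirichletCharacter ℂ q, (∏ i ∈ S, EE (n i) ((1/2:ℝ) * (YC pr (B i) (c i) (d i) χ : ℂ)) ^ 2) *
        (YC pr B' c' d' χ : ℂ) ^ (2 * m) = (LHS : ℂ) := by
      rw [hL]
      push_cast
      refine Finset.sum_congr rfl fun χ _ => ?_
      congr 1
      refine Finset.prod_congr rfl fun i _ => ?_
      rw [← EE_ofReal]
      push_cast
      congr 2; ring
    have e2 : (fun ω => (∏ i ∈ S, EE M ((1/2:ℝ) * (hi i ω : ℂ)) ^ 2) * (h' ω : ℂ) ^ (2 * m)) =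
        fun ω => (((∏ i ∈ S, EEr M (hi i ω / 2) ^ 2) * h' ω ^ (2 * m) : ℝ) : ℂ) := by
      ext ω
      push_cast
      congr 1
      refine Finset.prod_congr rfl fun i _ => ?_
      rw [← EE_ofReal]
      push_cast
      congr 2; ring
    rw [e1, e2, EX_re] at m3
    refine le_trans ?_ m3
    rw [Complex.norm_real]
    exact le_abs_self _
  have lim : LHS ≤ q.totient *
      ((∑ ω, (∏ i ∈ S, Real.exp (hi i ω / 2) ^ 2) * h' ω ^ (2 * m)) / 4 ^ (Fintype.card σ)) := by
    refine ge_of_tendsto (x := Filter.atTop) (f := fun M => (q.totient : ℝ) *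
      ((∑ ω, (∏ i ∈ S, EEr M (hi i ω / 2) ^ 2) * h' ω ^ (2 * m)) / 4 ^ (Fintype.card σ))) ?_ ?_
    · refine Filter.Tendsto.const_mul _ (Filter.Tendsto.div_const (tendsto_finset_sum _ fun ω _ => ?_) _)
      refine Filter.Tendsto.mul_const _ (tendsto_finset_prod _ fun i _ => ?_)
      exact (EEr_tendsto _).pow 2
    · filter_upwards [Filter.eventually_ge_atTop (∑ i ∈ S, n i)] with M hM
      exact step M fun i hiS => (Finset.single_le_sum (f := n) (fun _ _ => Nat.zero_le _) hiS).trans hM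
  refine lim.trans (mul_le_mul_of_nonneg_left ?_ (Nat.cast_nonneg _))
  set U := S.biUnion B with hU
  set w : ℝ → σ → ℝ := fun a x => (if x ∈ U then 1 else 0) + a * (if x ∈ B' then 1 else 0) with hw
  have hwH : ∀ a ω, HR (w a) C D ω = (∑ i ∈ S, hi i ω) + a * h' ω := by
    intro a ω
    simp only [hw, hhi, hh']
    rw [HR_add, HR_smul, HR_biUnion S B hdis]
  have pt : ∀ ω, (∏ i ∈ S, Real.exp (hi i ω / 2) ^ 2) * h' ω ^ (2 * m) ≤
      (2 * m).factorial / μ ^ (2 * m) * (Real.exp (HR (w μ) C D ω) + Real.exp (HR (w (-μ)) C D ω)) := by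
    intro ω
    have e : (∏ i ∈ S, Real.exp (hi i ω / 2) ^ 2) = Real.exp (∑ i ∈ S, hi i ω) := by
      rw [Real.exp_sum]
      refine Finset.prod_congr rfl fun i _ => ?_
      rw [← Real.exp_nat_mul]; congr 1; push_cast; ring
    rw [e, hwH, hwH, Real.exp_add, Real.exp_add]
    have := mul_le_mul_of_nonneg_left (pow_le_exp m hμ (h' ω)) (Real.exp_pos (∑ i ∈ S, hi i ω)).le
    refine this.trans (le_of_eq ?_)
    rw [neg_mul]
    ring
  have hE : ∀ a, (∑ ω, Real.exp (HR (w a) C D ω)) / 4 ^ (Fintype.card σ) ≤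
      Real.exp (∑ x ∈ U, (Real.exp (D x) * C x ^ 2 / 4 + D x ^ 2 / 2)) *
      Real.exp (a ^ 2 * ∑ x ∈ B', (C x ^ 2 + D x ^ 2)) := by
    intro a
    rw [← EX_re, EX_exp, Complex.ofReal_re]
    exact prod_avg_le U B' hdis' C D hD a
  calc (∑ ω, (∏ i ∈ S, Real.exp (hi i ω / 2) ^ 2) * h' ω ^ (2 * m)) / 4 ^ (Fintype.card σ)
      ≤ (∑ ω, (2 * m).factorial / μ ^ (2 * m) * (Real.exp (HR (w μ) C D ω) + Real.exp (HR (w (-μ)) C D ω)))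
        / 4 ^ (Fintype.card σ) := by
        exact div_le_div_of_nonneg_right (Finset.sum_le_sum fun ω _ => pt ω) (by positivity)
    _ = (2 * m).factorial / μ ^ (2 * m) * ((∑ ω, Real.exp (HR (w μ) C D ω)) / 4 ^ (Fintype.card σ) +
        (∑ ω, Real.exp (HR (w (-μ)) C D ω)) / 4 ^ (Fintype.card σ)) := by
        rw [← Finset.mul_sum, Finset.sum_add_distrib]; ring
    _ ≤ (2 * m).factorial / μ ^ (2 * m) * (_ + _) :=
        mul_le_mul_of_nonneg_left (add_le_add (hE μ) (hE (-μ))) (by positivity)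
    _ = _ := by rw [neg_sq]; ring

end Model

/-! ### B3: sums over primes -/

lemma prod_primes_dvd_factorial (N : ℕ) : ∏ p ∈ Nat.primesLE N, p ^ (N / p) ∣ N.factorial := by
  refine Finset.prod_dvd_of_isRelPrime ?_ ?_
  · intro p hp p' hp' hne
    simp only [Finset.mem_coe, Nat.mem_primesLE] at hp hp'
    exact (Nat.coprime_iff_isRelPrime.1 (((Nat.coprime_primes hp.2 hp'.2).2 hne).pow _ _))
  · intro p hp
    simp only [Nat.mem_primesLE] at hp
    rw [hp.2.pow_dvd_factorial_iff (Nat.lt_succ_self _)]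
    have hlog : 1 ∈ Finset.Ico 1 (Nat.log p N).succ := by
      rw [Finset.mem_Ico]
      have := Nat.log_pos hp.2.one_lt hp.1
      omega
    have := Finset.single_le_sum (f := fun i => N / p ^ i) (fun _ _ => Nat.zero_le _) hlog
    simpa using this

lemma mertens_one (N : ℕ) (hN : 1 ≤ N) : ∑ p ∈ Nat.primesLE N, Real.log p / p ≤ Real.log N + Real.log 4 := by
  have hN0 : (0:ℝ) < N := by exact_mod_cast hN
  have h1 : ∑ p ∈ Nat.primesLE N, ((N / p : ℕ) : ℝ) * Real.log p ≤ N * Real.log N := by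
    have hd := Nat.le_of_dvd (Nat.factorial_pos N) (prod_primes_dvd_factorial N)
    have h2 : (∏ p ∈ Nat.primesLE N, (p:ℝ) ^ (N / p)) ≤ (N:ℝ) ^ N := by
      have := hd.trans (Nat.factorial_le_pow N)
      exact_mod_cast this
    have hpos : ∀ p ∈ Nat.primesLE N, (0:ℝ) < p := by
      intro p hp
      exact_mod_cast (Nat.mem_primesLE.1 hp).2.pos
    have h3 := Real.log_le_log (Finset.prod_pos fun p hp => pow_pos (hpos p hp) _) h2
    rw [Real.log_prod fun p hp => (pow_pos (hpos p hp) _).ne', Real.log_pow] at h3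
    simpa [Real.log_pow] using h3
  have h2 : ∑ p ∈ Nat.primesLE N, Real.log p ≤ Real.log 4 * N := by
    rw [← Chebyshev.theta_eq_sum_primesLE_log]
    exact Chebyshev.theta_le_log4_mul_x hN0.le
  have h3 : ∑ p ∈ Nat.primesLE N, (N:ℝ) * (Real.log p / p) ≤
      ∑ p ∈ Nat.primesLE N, (((N / p : ℕ) : ℝ) * Real.log p + Real.log p) := by
    refine Finset.sum_le_sum fun p hp => ?_
    have hp1 := (Nat.mem_primesLE.1 hp).2
    have hpos : (0:ℝ) < p := by exact_mod_cast hp1.pos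
    have hlog : 0 ≤ Real.log p := Real.log_nonneg (by exact_mod_cast hp1.one_lt.le)
    have h4 : (N:ℝ) / p ≤ ((N / p : ℕ) : ℝ) + 1 := by
      have := Nat.lt_floor_add_one ((N:ℝ) / p)
      rw [Nat.floor_div_eq_div] at this
      exact this.le
    calc (N:ℝ) * (Real.log p / p) = (N:ℝ) / p * Real.log p := by ring
      _ ≤ (((N / p : ℕ) : ℝ) + 1) * Real.log p := by gcongr
      _ = _ := by ring
  rw [← Finset.mul_sum, Finset.sum_add_distrib] at h3
  have h5 : (N:ℝ) * ∑ p ∈ Nat.primesLE N, Real.log p / p ≤ N * (Real.log N + Real.log 4) := by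
    linarith
  exact le_of_mul_le_mul_left h5 hN0

/-- primes up to `e^X` -/
noncomputable def PX (X : ℝ) : Finset ℕ := Nat.primesLE ⌊Real.exp X⌋₊

lemma mem_PX {X : ℝ} {p : ℕ} : p ∈ PX X ↔ p.Prime ∧ Real.log p ≤ X := by
  unfold PX
  rw [Nat.mem_primesLE, Nat.le_floor_iff (Real.exp_pos X).le]
  constructor
  · rintro ⟨h1, h2⟩
    have : (0:ℝ) < p := by exact_mod_cast h2.pos
    exact ⟨h2, (Real.log_le_iff_le_exp this).2 h1⟩
  · rintro ⟨h2, h1⟩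
    have : (0:ℝ) < p := by exact_mod_cast h2.pos
    exact ⟨(Real.log_le_iff_le_exp this).1 h1, h2⟩

lemma mertens_PX {X : ℝ} (hX : 0 ≤ X) : ∑ p ∈ PX X, Real.log p / p ≤ X + 2 := by
  have h1 : 1 ≤ ⌊Real.exp X⌋₊ := by
    rw [Nat.one_le_floor_iff]; exact Real.one_le_exp hX
  have h := mertens_one _ h1
  have h2 : Real.log (⌊Real.exp X⌋₊ : ℝ) ≤ X := by
    rw [Real.log_le_iff_le_exp (by exact_mod_cast h1)]
    exact Nat.floor_le (Real.exp_pos X).le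
  have h3 : Real.log 4 ≤ 2 := by
    rw [show (4:ℝ) = 2 ^ 2 by norm_num, Real.log_pow]
    have := Real.log_two_lt_d9
    push_cast; linarith
  unfold PX; linarith

lemma sum_inv_sq_le (s : Finset ℕ) : ∑ n ∈ s, (1:ℝ) / (n:ℝ) ^ 2 ≤ 2 := by
  have h := hasSum_zeta_two
  have h1 := sum_le_hasSum s (fun n _ => by positivity) h
  have : π ^ 2 / 6 ≤ 2 := by
    have := Real.pi_lt_d2
    have := Real.pi_pos
    nlinarith
  linarith

lemma block_var {X : ℝ} (hX : 10 ≤ X) (s : Finset ℕ) (hs : ∀ p ∈ s, p ∈ PX (2 * X) ∧ X ≤ Real.log p) :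
    ∑ p ∈ s, (1:ℝ) / p ≤ 3 := by
  have h1 : ∑ p ∈ s, (1:ℝ) / p ≤ ∑ p ∈ s, (1 / X) * (Real.log p / p) := by
    refine Finset.sum_le_sum fun p hp => ?_
    have := (hs p hp).2
    have hp1 := (mem_PX.1 (hs p hp).1).1
    have : (0:ℝ) < p := by exact_mod_cast hp1.pos
    rw [div_mul_div_comm, one_mul, div_le_div_iff₀ this (by positivity)]
    nlinarith
  have h2 : ∑ p ∈ s, Real.log p / p ≤ ∑ p ∈ PX (2 * X), Real.log p / p := by
    refine Finset.sum_le_sum_of_subset_of_nonneg (fun p hp => (hs p hp).1) fun p hp _ => ?_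
    have hp1 := (mem_PX.1 hp).1
    have : 0 ≤ Real.log p := Real.log_nonneg (by exact_mod_cast hp1.one_lt.le)
    positivity
  have h3 := mertens_PX (X := 2 * X) (by linarith)
  rw [← Finset.mul_sum] at h1
  calc _ ≤ _ := h1
    _ ≤ 1 / X * (2 * X + 2) := by gcongr; linarith
    _ ≤ 3 := by rw [div_mul_eq_mul_div, div_le_iff₀ (by linarith)]; linarith

lemma zeta_bound {s : ℂ} (hs : 1 < s.re) : ‖riemannZeta s‖ ≤ ‖s‖ / ‖s - 1‖ + ‖s‖ := by
  have hO : (fun n : ℕ => ∑ k ∈ Finset.Icc 1 n, ‖(1 : ℕ → ℂ) k‖) =O[Filter.atTop] fun n : ℕ => (n : ℝ) ^ (1:ℝ) := by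
    refine Asymptotics.isBigO_of_le _ fun n => ?_
    simp
  have h1 := LSeries_eq_mul_integral' (1 : ℕ → ℂ) zero_le_one hs hO
  rw [LSeries_one_eq_riemannZeta hs] at h1
  have hi1 : MeasureTheory.IntegrableOn (fun t : ℝ => (t : ℂ) ^ (-s)) (Set.Ioi 1) :=
    integrableOn_Ioi_cpow_of_lt (by simpa using by linarith) one_pos
  have hi2 : MeasureTheory.IntegrableOn (fun t : ℝ => t ^ (-(s.re + 1))) (Set.Ioi 1) :=
    integrableOn_Ioi_rpow_of_lt (by linarith) one_pos
  have v1 : ∫ t in Set.Ioi (1:ℝ), (t : ℂ) ^ (-s) = 1 / (s - 1) := by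
    rw [integral_Ioi_cpow_of_lt (by simpa using by linarith) one_pos]
    simp only [ofReal_one, one_cpow]
    rw [show -s + 1 = -(s - 1) by ring, neg_div_neg_eq]
  have v2 : ∫ t in Set.Ioi (1:ℝ), t ^ (-(s.re + 1)) = 1 / s.re := by
    rw [integral_Ioi_rpow_of_lt (by linarith) one_pos]
    simp only [one_rpow]
    rw [show -(s.re + 1) + 1 = -s.re by ring, neg_div_neg_eq]
  have bd : ∀ t ∈ Set.Ioi (1:ℝ), ‖(∑ k ∈ Finset.Icc 1 ⌊t⌋₊, (1 : ℕ → ℂ) k) * (t:ℂ) ^ (-(s + 1)) - (t:ℂ) ^ (-s)‖ ≤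
      t ^ (-(s.re + 1)) := by
    intro t ht
    have ht0 : (0:ℝ) < t := lt_trans one_pos ht
    have e : (t:ℂ) ^ (-s) = t * (t:ℂ) ^ (-(s + 1)) := by
      rw [show -s = 1 + -(s + 1) by ring, Complex.cpow_add _ _ (by exact_mod_cast ht0.ne'), Complex.cpow_one]
    have e2 : (∑ k ∈ Finset.Icc 1 ⌊t⌋₊, (1 : ℕ → ℂ) k) = ((⌊t⌋₊ : ℝ) : ℂ) := by simp
    rw [e, e2, ← sub_mul, norm_mul, Complex.norm_cpow_eq_rpow_re_of_pos ht0, ← Complex.ofReal_sub, Complex.norm_real]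
    have h3 : ‖(⌊t⌋₊ : ℝ) - t‖ ≤ 1 := by
      rw [Real.norm_eq_abs, abs_le]
      have := Nat.floor_le ht0.le
      have := Nat.lt_floor_add_one t
      constructor <;> linarith
    have e3 : (-(s + 1)).re = -(s.re + 1) := by simp [add_comm]
    rw [e3]
    exact mul_le_of_le_one_left (Real.rpow_nonneg ht0.le _) h3
  have hmeas : MeasureTheory.AEStronglyMeasurable
      (fun t : ℝ => (∑ k ∈ Finset.Icc 1 ⌊t⌋₊, (1 : ℕ → ℂ) k) * (t:ℂ) ^ (-(s + 1)) - (t:ℂ) ^ (-s))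
      (MeasureTheory.volume.restrict (Set.Ioi 1)) := by
    simp only [Pi.one_apply, Finset.sum_const, Nat.card_Icc, add_tsub_cancel_right, nsmul_eq_mul, mul_one]
    apply Measurable.aestronglyMeasurable
    have hf : Measurable fun t : ℝ => ((⌊t⌋₊ : ℕ) : ℂ) := by
      exact (measurable_from_top (f := fun n : ℕ => (n : ℂ))).comp Nat.measurable_floor
    exact (hf.mul (by fun_prop)).sub (by fun_prop)
  have hid : MeasureTheory.IntegrableOn
      (fun t : ℝ => (∑ k ∈ Finset.Icc 1 ⌊t⌋₊, (1 : ℕ → ℂ) k) * (t:ℂ) ^ (-(s + 1)) - (t:ℂ) ^ (-s)) (Set.Ioi 1) :=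
    MeasureTheory.Integrable.mono' hi2 hmeas
      ((MeasureTheory.ae_restrict_iff' measurableSet_Ioi).2 (Filter.Eventually.of_forall bd))
  have hsum : ∫ t in Set.Ioi (1:ℝ), (∑ k ∈ Finset.Icc 1 ⌊t⌋₊, (1 : ℕ → ℂ) k) * (t:ℂ) ^ (-(s + 1)) =
      (∫ t in Set.Ioi (1:ℝ), ((∑ k ∈ Finset.Icc 1 ⌊t⌋₊, (1 : ℕ → ℂ) k) * (t:ℂ) ^ (-(s + 1)) - (t:ℂ) ^ (-s))) + 1 / (s - 1) := by
    rw [← v1, ← MeasureTheory.integral_add hid hi1]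
    simp
  have hb : ‖∫ t in Set.Ioi (1:ℝ), ((∑ k ∈ Finset.Icc 1 ⌊t⌋₊, (1 : ℕ → ℂ) k) * (t:ℂ) ^ (-(s + 1)) - (t:ℂ) ^ (-s))‖ ≤ 1 := by
    refine (MeasureTheory.norm_integral_le_of_norm_le hi2
      ((MeasureTheory.ae_restrict_iff' measurableSet_Ioi).2 (Filter.Eventually.of_forall bd))).trans ?_
    rw [v2, div_le_one (by linarith)]; linarith
  rw [h1, hsum, mul_add]
  refine (norm_add_le _ _).trans ?_
  rw [norm_mul, norm_mul, norm_div, norm_one, mul_one_div]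
  have := mul_le_mul_of_nonneg_left hb (norm_nonneg s)
  linarith

lemma prime_sum_le {X τ : ℝ} (hX : 1 ≤ X) :
    Summable (fun p : Nat.Primes => ((p : ℕ) : ℂ) ^ (-((1 + 1 / X : ℝ) + τ * I : ℂ))) ∧
    (∑' p : Nat.Primes, ((p : ℕ) : ℂ) ^ (-((1 + 1 / X : ℝ) + τ * I : ℂ))).re ≤
      Real.log (1 / (|τ| + 1 / X)) + 2 * Real.log (2 + |τ|) + 4 := by
  set s : ℂ := (1 + 1 / X : ℝ) + τ * I with hs
  have hX0 : 0 < 1 / X := by positivity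
  have hX1 : 1 / X ≤ 1 := by rw [div_le_one (by linarith)]; exact hX
  have hre : s.re = 1 + 1 / X := by simp [hs]
  have him : s.im = τ := by simp [hs]
  have h1 : 1 < s.re := by rw [hre]; linarith
  have hn : ∀ p : Nat.Primes, ‖((p : ℕ) : ℂ) ^ (-s)‖ = ((p : ℕ) : ℝ) ^ (-s.re) := by
    intro p
    rw [Complex.norm_natCast_cpow_of_pos p.2.pos]; simp
  have hsn : Summable fun p : Nat.Primes => ‖((p : ℕ) : ℂ) ^ (-s)‖ := by
    simp only [hn]
    exact Nat.Primes.summable_rpow.2 (by linarith)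
  have hsz := hsn.of_norm
  refine ⟨hsz, ?_⟩
  have hle : ∀ p : Nat.Primes, ‖((p : ℕ) : ℂ) ^ (-s)‖ ≤ 1 / (p : ℕ) := by
    intro p
    have : (1:ℝ) ≤ ((p:ℕ):ℝ) := by exact_mod_cast p.2.one_lt.le
    have e : 1 / ((p:ℕ):ℝ) = ((p:ℕ):ℝ) ^ (-1:ℝ) := by rw [Real.rpow_neg_one, one_div]
    rw [hn, e]
    exact Real.rpow_le_rpow_of_exponent_le this (by linarith)
  have hhalf : ∀ p : Nat.Primes, ‖((p : ℕ) : ℂ) ^ (-s)‖ ≤ 1 / 2 := by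
    intro p
    refine (hle p).trans ?_
    have : (2:ℝ) ≤ (p : ℕ) := by exact_mod_cast p.2.two_le
    gcongr
  have hdiff : ∀ p : Nat.Primes, ‖-Complex.log (1 - ((p : ℕ) : ℂ) ^ (-s)) - ((p : ℕ) : ℂ) ^ (-s)‖ ≤ 1 / ((p : ℕ) : ℝ) ^ 2 := by
    intro p
    set z := ((p : ℕ) : ℂ) ^ (-s)
    have hz := hhalf p
    have := Complex.norm_log_one_add_sub_self_le (z := -z) (by rw [norm_neg]; linarith)
    rw [norm_neg] at this
    have e : -Complex.log (1 - z) - z = -(Complex.log (1 + -z) - -z) := by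
      rw [← sub_eq_add_neg]; ring
    rw [e, norm_neg]
    refine this.trans ?_
    have h2 : (1 - ‖z‖)⁻¹ ≤ 2 := by
      rw [inv_le_comm₀ (by linarith) (by norm_num)]; linarith
    have h3 : ‖z‖ ^ 2 ≤ (1 / ((p : ℕ) : ℝ)) ^ 2 := by
      have := hle p
      gcongr
    calc ‖z‖ ^ 2 * (1 - ‖z‖)⁻¹ / 2 ≤ ‖z‖ ^ 2 * 2 / 2 := by gcongr
      _ = ‖z‖ ^ 2 := by ring
      _ ≤ _ := by rw [one_div_pow] at h3; exact h3
  have hs2 : Summable fun p : Nat.Primes => 1 / ((p : ℕ) : ℝ) ^ 2 := by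
    exact hasSum_zeta_two.summable.comp_injective (i := fun p : Nat.Primes => (p : ℕ)) Subtype.val_injective
  have hs2v : ∑' p : Nat.Primes, 1 / ((p : ℕ) : ℝ) ^ 2 ≤ 2 := by
    refine hs2.tsum_le_of_sum_le fun F => ?_
    have := sum_inv_sq_le (F.map ⟨fun p : Nat.Primes => (p : ℕ), Subtype.val_injective⟩)
    rwa [Finset.sum_map] at this
  have hsd : Summable fun p : Nat.Primes => -Complex.log (1 - ((p : ℕ) : ℂ) ^ (-s)) - ((p : ℕ) : ℂ) ^ (-s) :=
    Summable.of_norm_bounded hs2 hdiff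
  have hsl : Summable fun p : Nat.Primes => -Complex.log (1 - ((p : ℕ) : ℂ) ^ (-s)) := by
    simpa using hsd.add hsz
  have hexp := riemannZeta_eulerProduct_exp_log h1
  have hnorm : ‖riemannZeta s‖ = Real.exp (∑' p : Nat.Primes, -Complex.log (1 - ((p : ℕ) : ℂ) ^ (-s))).re := by
    rw [← hexp, Complex.norm_exp]
  have hdb : ‖∑' p : Nat.Primes, (-Complex.log (1 - ((p : ℕ) : ℂ) ^ (-s)) - ((p : ℕ) : ℂ) ^ (-s))‖ ≤ 2 :=
    (tsum_of_norm_bounded hs2.hasSum hdiff).trans hs2v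
  have heq : (∑' p : Nat.Primes, ((p : ℕ) : ℂ) ^ (-s)).re =
      Real.log ‖riemannZeta s‖ -
      (∑' p : Nat.Primes, (-Complex.log (1 - ((p : ℕ) : ℂ) ^ (-s)) - ((p : ℕ) : ℂ) ^ (-s))).re := by
    rw [hnorm, Real.log_exp, hsl.tsum_sub hsz, Complex.sub_re]; ring
  have h5 := (abs_le.1 ((Complex.abs_re_le_norm _).trans hdb)).1
  have hz := zeta_bound h1
  set d := |τ| + 1 / X with hd
  have hd0 : 0 < d := by positivity
  have hsn2 : ‖s‖ ≤ 2 + |τ| := by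
    refine (Complex.norm_le_abs_re_add_abs_im s).trans ?_
    rw [hre, him, abs_of_pos (by linarith)]; linarith
  have hs1 : d / 2 ≤ ‖s - 1‖ := by
    have a := Complex.abs_re_le_norm (s - 1)
    have b := Complex.abs_im_le_norm (s - 1)
    simp only [sub_re, one_re, sub_im, one_im, sub_zero, hre, him, add_sub_cancel_left] at a b
    rw [abs_of_pos hX0] at a
    rw [hd]; linarith
  have hb : ‖riemannZeta s‖ ≤ 2 * (2 + |τ|) ^ 2 * (1 / d) := by
    have hτ := abs_nonneg τ
    calc ‖riemannZeta s‖ ≤ _ := hz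
      _ ≤ (2 + |τ|) / (d / 2) + (2 + |τ|) := by gcongr
      _ ≤ (2 + |τ|) / (d / 2) + (2 + |τ|) * ((1 + |τ|) / d) := by
          have : 1 ≤ (1 + |τ|) / d := by rw [le_div_iff₀ hd0, hd]; linarith
          nlinarith
      _ = (2 + |τ|) * (3 + |τ|) * (1 / d) := by field_simp; ring
      _ ≤ (2 + |τ|) * (2 * (2 + |τ|)) * (1 / d) := by
          gcongr
          linarith
      _ = _ := by ring
  have hzpos : 0 < ‖riemannZeta s‖ := by rw [hnorm]; exact Real.exp_pos _
  have h6 : Real.log ‖riemannZeta s‖ ≤ Real.log 2 + 2 * Real.log (2 + |τ|) + Real.log (1 / d) := by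
    refine (Real.log_le_log hzpos hb).trans (le_of_eq ?_)
    have hτ := abs_nonneg τ
    rw [Real.log_mul (by positivity) (by positivity), Real.log_mul (by norm_num) (by positivity), Real.log_pow]
    push_cast; ring
  have := Real.log_two_lt_d9
  rw [heq]; linarith

/-- the Dirichlet polynomial coefficient `∑ a_k p^{-i t_k}` -/
noncomputable def gp {ι : Type*} [Fintype ι] (a t : ι → ℝ) (p : ℕ) : ℂ := ∑ k, a k * (p : ℂ) ^ (-(t k * I : ℂ))

lemma norm_natCast_cpow_I {p : ℕ} (hp : 0 < p) (t : ℝ) : ‖(p : ℂ) ^ (-(t * I : ℂ))‖ = 1 := by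
  rw [Complex.norm_natCast_cpow_of_pos hp]; simp

lemma gp_norm_le {ι : Type*} [Fintype ι] (a t : ι → ℝ) (ha : ∀ k, 0 ≤ a k) {p : ℕ} (hp : 0 < p) :
    ‖gp a t p‖ ≤ ∑ k, a k := by
  unfold gp
  refine (norm_sum_le _ _).trans (Finset.sum_le_sum fun k _ => ?_)
  rw [norm_mul, norm_natCast_cpow_I hp, mul_one, Complex.norm_real, Real.norm_of_nonneg (ha k)]

lemma gp_sq {ι : Type*} [Fintype ι] (a t : ι → ℝ) {p : ℕ} (hp : 0 < p) (u : ℝ) :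
    ‖gp a t p‖ ^ 2 * (p : ℝ) ^ (-u) =
    ∑ k, ∑ l, a k * a l * ((p : ℂ) ^ (-((u : ℝ) + (t k - t l : ℝ) * I : ℂ))).re := by
  have hp0 : (p : ℂ) ≠ 0 := by exact_mod_cast hp.ne'
  have h1 : ((‖gp a t p‖ ^ 2 * (p : ℝ) ^ (-u) : ℝ) : ℂ) =
      ∑ k, ∑ l, ((a k * a l : ℝ) : ℂ) * (p : ℂ) ^ (-((u : ℝ) + (t k - t l : ℝ) * I : ℂ)) := by
    push_cast
    rw [← Complex.mul_conj']
    rw [Complex.ofReal_cpow (by positivity)]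
    unfold gp
    rw [map_sum, Finset.sum_mul_sum, Finset.sum_mul]
    refine Finset.sum_congr rfl fun k _ => ?_
    rw [Finset.sum_mul]
    refine Finset.sum_congr rfl fun l _ => ?_
    have hconj : (starRingEnd ℂ) ((p : ℂ) ^ (-(t l * I : ℂ))) = (p : ℂ) ^ ((t l * I : ℂ)) := by
      have h := Complex.cpow_conj (p : ℂ) (-(t l * I : ℂ)) (by
        rw [Complex.natCast_arg]; exact Real.pi_pos.ne)
      rw [Complex.conj_natCast] at h
      rw [← h]
      simp
    rw [map_mul, hconj, Complex.conj_ofReal]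
    have e : -((u : ℂ) + ((t k : ℂ) - (t l : ℂ)) * I) = -(t k * I) + (t l * I) + -(u : ℂ) := by ring
    rw [e, Complex.cpow_add _ _ hp0, Complex.cpow_add _ _ hp0]
    push_cast
    ring
  have h2 := congrArg Complex.re h1
  rw [Complex.ofReal_re] at h2
  rw [h2, Complex.re_sum]
  refine Finset.sum_congr rfl fun k _ => ?_
  rw [Complex.re_sum]
  refine Finset.sum_congr rfl fun l _ => ?_
  rw [Complex.re_ofReal_mul]

theorem main_sum {ι : Type*} [Fintype ι] (a t : ι → ℝ) (ha : ∀ k, 0 ≤ a k) {X : ℝ} (hX : 1 ≤ X) :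
    ∑ p ∈ PX X, ‖gp a t p‖ ^ 2 / p ≤
    (∑ k, ∑ l, a k * a l * (Real.log (1 / (|t k - t l| + 1 / X)) + 2 * Real.log (2 + |t k - t l|) + 4)) +
      3 * (∑ k, a k) ^ 2 := by
  set A := ∑ k, a k with hA
  have hA0 : 0 ≤ A := Finset.sum_nonneg fun k _ => ha k
  set f : ℕ → ℝ := fun p => ‖gp a t p‖ ^ 2 * (p : ℝ) ^ (-(1 + 1 / X)) with hf
  have hX0 : 0 < X := by linarith
  have s1 : ∑ p ∈ PX X, ‖gp a t p‖ ^ 2 / p ≤ ∑ p ∈ PX X, (f p + A ^ 2 / X * (Real.log p / p)) := by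
    refine Finset.sum_le_sum fun p hp => ?_
    have hp1 := (mem_PX.1 hp).1
    have hp0 : (0:ℝ) < p := by exact_mod_cast hp1.pos
    have hg := gp_norm_le a t ha hp1.pos
    have e : (p:ℝ) ^ (-(1 + 1 / X)) = 1 / p * Real.exp (-(Real.log p / X)) := by
      rw [neg_add, Real.rpow_add hp0, Real.rpow_neg_one, Real.rpow_def_of_pos hp0, one_div]
      ring_nf
    have h1 := Real.add_one_le_exp (-(Real.log p / X))
    have h0 : 0 ≤ Real.log p / X := div_nonneg (Real.log_nonneg (by exact_mod_cast hp1.one_lt.le)) hX0.le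
    simp only [hf]
    rw [e]
    have h2 : ‖gp a t p‖ ^ 2 ≤ A ^ 2 := by gcongr
    have h3 : ‖gp a t p‖ ^ 2 * (1 - Real.exp (-(Real.log p / X))) ≤ A ^ 2 * (Real.log p / X) := by
      calc ‖gp a t p‖ ^ 2 * (1 - Real.exp (-(Real.log p / X))) ≤ ‖gp a t p‖ ^ 2 * (Real.log p / X) := by
            apply mul_le_mul_of_nonneg_left _ (sq_nonneg _); linarith
        _ ≤ _ := mul_le_mul_of_nonneg_right h2 h0
    have h4 := mul_le_mul_of_nonneg_right h3 (show 0 ≤ 1 / (p:ℝ) by positivity)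
    have e2 : A ^ 2 / X * (Real.log p / p) = A ^ 2 * (Real.log p / X) * (1 / p) := by ring
    have e3 : ‖gp a t p‖ ^ 2 / p = ‖gp a t p‖ ^ 2 * (1 / p) := by ring
    rw [e2, e3]
    nlinarith
  have s2 : ∑ p ∈ PX X, A ^ 2 / X * (Real.log p / p) ≤ 3 * A ^ 2 := by
    rw [← Finset.mul_sum]
    calc A ^ 2 / X * ∑ p ∈ PX X, Real.log p / p ≤ A ^ 2 / X * (X + 2) := by
          gcongr; exact mertens_PX hX0.le
      _ = A ^ 2 * ((X + 2) / X) := by ring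
      _ ≤ A ^ 2 * 3 := by
          gcongr; rw [div_le_iff₀ hX0]; linarith
      _ = _ := by ring
  have hsum : ∀ k l, HasSum (fun p : Nat.Primes => a k * a l * (((p : ℕ) : ℂ) ^ (-((1 + 1 / X : ℝ) + (t k - t l : ℝ) * I : ℂ))).re)
      (a k * a l * (∑' p : Nat.Primes, ((p : ℕ) : ℂ) ^ (-((1 + 1 / X : ℝ) + (t k - t l : ℝ) * I : ℂ))).re) := by
    intro k l
    have := (prime_sum_le (τ := t k - t l) hX).1.hasSum
    exact (Complex.hasSum_re this).mul_left _
  have hfs : HasSum (fun p : Nat.Primes => f p) (∑ k, ∑ l, a k * a l *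
      (∑' p : Nat.Primes, ((p : ℕ) : ℂ) ^ (-((1 + 1 / X : ℝ) + (t k - t l : ℝ) * I : ℂ))).re) := by
    have e : (fun p : Nat.Primes => f p) = fun p : Nat.Primes => ∑ k, ∑ l, a k * a l *
        (((p : ℕ) : ℂ) ^ (-((1 + 1 / X : ℝ) + (t k - t l : ℝ) * I : ℂ))).re := by
      ext p
      exact gp_sq a t p.2.pos _
    rw [e]
    exact hasSum_sum fun k _ => hasSum_sum fun l _ => hsum k l
  have s3 : ∑ p ∈ PX X, f p ≤ ∑ k, ∑ l, a k * a l *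
      (∑' p : Nat.Primes, ((p : ℕ) : ℂ) ^ (-((1 + 1 / X : ℝ) + (t k - t l : ℝ) * I : ℂ))).re := by
    rw [← Finset.sum_subtype_of_mem (p := Nat.Prime) f (fun p hp => (mem_PX.1 hp).1)]
    exact sum_le_hasSum (ι := Nat.Primes) ((PX X).subtype Nat.Prime : Finset Nat.Primes)
      (fun p _ => by simp only [hf]; positivity) hfs
  rw [Finset.sum_add_distrib] at s1
  have s4 : ∑ k, ∑ l, a k * a l *
      (∑' p : Nat.Primes, ((p : ℕ) : ℂ) ^ (-((1 + 1 / X : ℝ) + (t k - t l : ℝ) * I : ℂ))).re ≤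
      ∑ k, ∑ l, a k * a l * (Real.log (1 / (|t k - t l| + 1 / X)) + 2 * Real.log (2 + |t k - t l|) + 4) :=
    Finset.sum_le_sum fun k _ => Finset.sum_le_sum fun l _ =>
      mul_le_mul_of_nonneg_left (prime_sum_le hX).2 (mul_nonneg (ha k) (ha l))
  linarith

/-! ### B4: decomposition of the smoothed prime sum -/

lemma sum_primePow_PX (f : ℕ → ℂ) {X : ℝ} (hX : 0 ≤ X) {N : ℕ} (hN : X / Real.log 2 ≤ N) :
    ∑ n ∈ Finset.Icc 1 ⌊Real.exp X⌋₊ with IsPrimePow n, f n = ∑ k ∈ Finset.Icc 1 N, ∑ p ∈ PX (X / k), f (p ^ k) := by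
  have h := Chebyshev.sum_PrimePow_eq_sum_sum' f (x := Real.exp X) (Real.exp_pos X).le (N := N) (by
    rw [Real.log_exp]; exact Nat.floor_le_of_le hN)
  have e : Finset.Icc 1 ⌊Real.exp X⌋₊ = Finset.Ioc 0 ⌊Real.exp X⌋₊ := by ext; simp [Nat.succ_le_iff]
  rw [e, h]
  refine Finset.sum_congr rfl fun k _ => Finset.sum_congr ?_ fun _ _ => rfl
  ext p
  rw [← Real.exp_mul, mul_one_div]
  simp only [PX, Finset.mem_filter, Finset.mem_Ioc, Nat.mem_primesLE]
  constructor
  · rintro ⟨⟨_, h⟩, h'⟩; exact ⟨h, h'⟩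
  · rintro ⟨h, h'⟩; exact ⟨⟨h'.pos, h⟩, h'⟩

/-- prime coefficient -/
noncomputable def c1 (X t : ℝ) (p : ℕ) : ℂ :=
  (p : ℂ) ^ (-(⟨1 / 2 + 40 / X, t⟩ : ℂ)) * (((1 - Real.log p / X) ^ 4 : ℝ) : ℂ)

/-- prime square coefficient -/
noncomputable def c2 (X t : ℝ) (p : ℕ) : ℂ :=
  if p ∈ PX (X / 2) then (1 / 2) * ((p ^ 2 : ℕ) : ℂ) ^ (-(⟨1 / 2 + 40 / X, t⟩ : ℂ)) *
    (((1 - 2 * Real.log p / X) ^ 4 : ℝ) : ℂ) else 0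

lemma norm_term_le {X t : ℝ} (hX : 0 < X) {n : ℕ} (hn : 1 ≤ n) (hnX : Real.log n ≤ X) {z : ℂ} (hz : ‖z‖ ≤ 1) :
    ‖z * (n:ℂ) ^ (-(⟨1 / 2 + 40 / X, t⟩ : ℂ)) * (((1 - Real.log n / X) ^ 4 : ℝ) : ℂ)‖ ≤ (n:ℝ) ^ (-(1/2 : ℝ)) := by
  have hn1 : (1:ℝ) ≤ n := by exact_mod_cast hn
  rw [norm_mul, norm_mul, Complex.norm_natCast_cpow_of_pos (by omega), Complex.norm_real, Real.norm_eq_abs]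
  have h1 : |(1 - Real.log n / X) ^ 4| ≤ 1 := by
    rw [abs_pow]
    apply pow_le_one₀ (abs_nonneg _)
    have h0 : 0 ≤ Real.log n / X := div_nonneg (Real.log_nonneg hn1) hX.le
    have h2 : Real.log n / X ≤ 1 := by rw [div_le_one hX]; exact hnX
    rw [abs_le]; constructor <;> linarith
  have h3 : (n:ℝ) ^ (-(⟨1 / 2 + 40 / X, t⟩ : ℂ)).re ≤ (n:ℝ) ^ (-(1/2 : ℝ)) := by
    apply Real.rpow_le_rpow_of_exponent_le hn1
    have : 0 < 40 / X := by positivity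
    simp only [neg_re]; linarith
  have h4 : 0 ≤ (n:ℝ) ^ (-(⟨1 / 2 + 40 / X, t⟩ : ℂ)).re := by positivity
  calc _ ≤ 1 * (n:ℝ) ^ (-(1/2 : ℝ)) * 1 := by gcongr
    _ = _ := by ring

lemma logCoef_prime_pow {q : ℕ} (χ : DirichletCharacter ℂ q) {p k : ℕ} (hp : p.Prime) (hk : k ≠ 0) :
    logCoef χ (p ^ k) = χ p ^ k * ((1 / k : ℝ) : ℂ) := by
  unfold logCoef
  rw [ArithmeticFunction.vonMangoldt_apply_pow hk, ArithmeticFunction.vonMangoldt_apply_prime hp]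
  have hl : Real.log p ≠ 0 := (Real.log_pos (by exact_mod_cast hp.one_lt)).ne'
  have hk0 : (k:ℝ) ≠ 0 := by exact_mod_cast hk
  have e : Real.log p / Real.log ((p ^ k : ℕ) : ℝ) = 1 / k := by
    push_cast
    rw [Real.log_pow]; field_simp
  rw [e]
  push_cast
  rw [map_pow]

lemma norm_c1_le {X t : ℝ} (hX : 0 < X) {p : ℕ} (hp : p ∈ PX X) : ‖c1 X t p‖ ≤ 1 := by
  have h := mem_PX.1 hp
  have h1 := norm_term_le (t := t) hX h.1.one_lt.le h.2 (z := 1) (by simp)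
  rw [one_mul] at h1
  refine h1.trans ?_
  exact Real.rpow_le_one_of_one_le_of_nonpos (by exact_mod_cast h.1.one_lt.le) (by norm_num)

lemma sq_mem {X : ℝ} {p : ℕ} (hp : p ∈ PX (X / 2)) : Real.log ((p ^ 2 : ℕ) : ℝ) ≤ X := by
  have := (mem_PX.1 hp).2
  push_cast
  rw [Real.log_pow]; push_cast; linarith

lemma norm_c2_le {X t : ℝ} (hX : 0 < X) {p : ℕ} : ‖c2 X t p‖ ≤ 1 := by
  unfold c2
  split_ifs with hp
  · have h := mem_PX.1 hp
    have h1 := norm_term_le (t := t) hX (n := p ^ 2) (Nat.one_le_pow _ _ h.1.pos) (sq_mem hp) (z := 1 / 2) (by norm_num)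
    have e : Real.log ((p ^ 2 : ℕ) : ℝ) / X = 2 * Real.log p / X := by
      push_cast
      rw [Real.log_pow]; push_cast; ring
    rw [e] at h1
    refine h1.trans ?_
    exact Real.rpow_le_one_of_one_le_of_nonpos (by exact_mod_cast (Nat.one_le_pow _ _ h.1.pos)) (by norm_num)
  · simp

theorem SS_decomp : ∃ K : ℝ, 0 ≤ K ∧ ∀ (q : ℕ) (χ : DirichletCharacter ℂ q) (X t : ℝ), 50 ≤ X →
    ‖SS χ X ⟨1 / 2 + 40 / X, t⟩ - ∑ p ∈ PX X \ PX 50, (c1 X t p * χ p + c2 X t p * χ p ^ 2)‖ ≤ K := by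
  have hZs : Summable fun n : ℕ => (n : ℝ) ^ (-(3/2) : ℝ) := Real.summable_nat_rpow.2 (by norm_num)
  set Z := ∑' n : ℕ, (n : ℝ) ^ (-(3/2) : ℝ) with hZ
  have hZ0 : 0 ≤ Z := tsum_nonneg fun n => by positivity
  set θ : ℝ := (2:ℝ) ^ (-(1/2) : ℝ) with hθ
  have hθ0 : 0 < θ := by positivity
  have hθ1 : θ < 1 := Real.rpow_lt_one_of_one_lt_of_neg (by norm_num) (by norm_num)
  refine ⟨2 * (PX 50).card + Z * (1 - θ)⁻¹, by
    have : 0 ≤ (1 - θ)⁻¹ := inv_nonneg.2 (by linarith)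
    positivity, ?_⟩
  intro q χ X t hX
  have hX0 : 0 < X := by linarith
  set F : ℕ → ℂ := fun n => logCoef χ n * (n:ℂ) ^ (-(⟨1 / 2 + 40 / X, t⟩ : ℂ)) * (((1 - Real.log n / X) ^ 4 : ℝ) : ℂ) with hF
  obtain ⟨N0, hN0⟩ := exists_nat_ge (X / Real.log 2)
  set N := N0 + 2 with hN
  have hNN : X / Real.log 2 ≤ (N : ℝ) := by rw [hN]; push_cast; linarith
  have e1 : SS χ X ⟨1 / 2 + 40 / X, t⟩ = ∑ k ∈ Finset.Icc 1 N, ∑ p ∈ PX (X / k), F (p ^ k) := by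
    rw [← sum_primePow_PX F hX0.le hNN, Finset.sum_filter]
    unfold SS
    refine Finset.sum_congr rfl fun n _ => ?_
    split_ifs with h
    · rfl
    · have : logCoef χ n = 0 := by
        unfold logCoef
        rw [ArithmeticFunction.vonMangoldt_eq_zero_iff.2 h]; simp
      rw [this]; ring
  have e2 : Finset.Icc 1 N = insert 1 (insert 2 (Finset.Icc 3 N)) := by
    ext k; simp only [Finset.mem_Icc, Finset.mem_insert]; omega
  have hb : ∀ k : ℕ, 1 ≤ k → ∀ p ∈ PX (X / k), ‖F (p ^ k)‖ ≤ ((p ^ k : ℕ) : ℝ) ^ (-(1/2 : ℝ)) := by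
    intro k hk p hp
    have hp1 := mem_PX.1 hp
    refine norm_term_le hX0 (Nat.one_le_pow _ _ hp1.1.pos) ?_ (norm_logCoef_le _ _)
    push_cast
    rw [Real.log_pow]
    have hk0 : (0:ℝ) < k := by exact_mod_cast hk
    have := hp1.2
    rw [le_div_iff₀ hk0] at this
    linarith
  have hR : ‖∑ k ∈ Finset.Icc 3 N, ∑ p ∈ PX (X / k), F (p ^ k)‖ ≤ Z * (1 - θ)⁻¹ := by
    have hk : ∀ k ∈ Finset.Icc 3 N, ‖∑ p ∈ PX (X / k), F (p ^ k)‖ ≤ Z * θ ^ (k - 3) := by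
      intro k hk
      rw [Finset.mem_Icc] at hk
      refine (norm_sum_le _ _).trans ?_
      have : ∀ p ∈ PX (X / k), ‖F (p ^ k)‖ ≤ (p:ℝ) ^ (-(3/2) : ℝ) * θ ^ (k - 3) := by
        intro p hp
        refine (hb k (by omega) p hp).trans ?_
        have hp2 : (2:ℝ) ≤ p := by exact_mod_cast (mem_PX.1 hp).1.two_le
        obtain ⟨j, rfl⟩ := Nat.exists_eq_add_of_le hk.1
        push_cast
        rw [← Real.rpow_natCast, ← Real.rpow_mul (by linarith)]
        have e : ((3 + j : ℕ) : ℝ) * -(1/2 : ℝ) = -(3/2) + (-(1/2)) * (j:ℝ) := by push_cast; ring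
        rw [e, Real.rpow_add (by linarith), Real.rpow_mul (by linarith), Real.rpow_natCast, Nat.add_sub_cancel_left]
        refine mul_le_mul_of_nonneg_left ?_ (by positivity)
        apply pow_le_pow_left₀ (by positivity)
        exact Real.rpow_le_rpow_of_nonpos (by norm_num) hp2 (by norm_num)
      refine (Finset.sum_le_sum this).trans ?_
      rw [← Finset.sum_mul]
      refine mul_le_mul_of_nonneg_right ?_ (by positivity)
      exact hZs.sum_le_tsum _ (fun n _ => by positivity)
    refine (norm_sum_le _ _).trans ((Finset.sum_le_sum hk).trans ?_)
    rw [← Finset.mul_sum]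
    refine mul_le_mul_of_nonneg_left ?_ hZ0
    rw [← tsum_geometric_of_lt_one hθ0.le hθ1]
    have e : ∑ k ∈ Finset.Icc 3 N, θ ^ (k - 3) = ∑ j ∈ Finset.range (N + 1 - 3), θ ^ j := by
      rw [← Finset.Ico_succ_right_eq_Icc, Finset.sum_Ico_eq_sum_range]
      refine Finset.sum_congr rfl fun j _ => ?_
      rw [Nat.add_sub_cancel_left]
    rw [e]
    exact (summable_geometric_of_lt_one hθ0.le hθ1).sum_le_tsum _ (fun n _ => by positivity)
  have hsub50 : PX 50 ⊆ PX X := fun p hp => mem_PX.2 ⟨(mem_PX.1 hp).1, (mem_PX.1 hp).2.trans hX⟩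
  have t1 : ∑ p ∈ PX X, F p = ∑ p ∈ PX X, c1 X t p * χ p := by
    refine Finset.sum_congr rfl fun p hp => ?_
    have := logCoef_prime_pow χ (mem_PX.1 hp).1 one_ne_zero
    simp only [pow_one, Nat.cast_one, div_one, ofReal_one, mul_one] at this
    simp only [hF, this, c1]
    ring
  have t2 : ∑ p ∈ PX (X / 2), F (p ^ 2) = ∑ p ∈ PX X, c2 X t p * χ p ^ 2 := by
    have hs : PX (X / 2) ⊆ PX X := fun p hp => mem_PX.2 ⟨(mem_PX.1 hp).1, (mem_PX.1 hp).2.trans (by linarith)⟩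
    rw [← Finset.sum_subset hs (f := fun p => c2 X t p * χ p ^ 2)]
    · refine Finset.sum_congr rfl fun p hp => ?_
      have := logCoef_prime_pow χ (mem_PX.1 hp).1 two_ne_zero
      simp only [hF, this, c2, hp, if_true]
      have e : Real.log ((p ^ 2 : ℕ) : ℝ) / X = 2 * Real.log p / X := by
        push_cast
        rw [Real.log_pow]; push_cast; ring
      rw [e]
      push_cast
      ring
    · intro p _ hp; simp [c2, hp]
  have hfin : SS χ X ⟨1 / 2 + 40 / X, t⟩ - ∑ p ∈ PX X \ PX 50, (c1 X t p * χ p + c2 X t p * χ p ^ 2) =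
      ∑ p ∈ PX 50, (c1 X t p * χ p + c2 X t p * χ p ^ 2) +
      ∑ k ∈ Finset.Icc 3 N, ∑ p ∈ PX (X / k), F (p ^ k) := by
    rw [e1, e2, Finset.sum_insert (by simp), Finset.sum_insert (by simp)]
    simp only [Nat.cast_one, div_one, pow_one, Nat.cast_ofNat]
    rw [t1, t2, ← add_assoc, ← Finset.sum_add_distrib, ← Finset.sum_sdiff hsub50]
    ring
  rw [hfin]
  refine (norm_add_le _ _).trans (add_le_add ?_ hR)
  refine (norm_sum_le _ _).trans ?_
  have : ∀ p ∈ PX 50, ‖c1 X t p * χ p + c2 X t p * χ p ^ 2‖ ≤ 2 := by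
    intro p hp
    have h1 := norm_c1_le (t := t) hX0 (hsub50 hp)
    have h2 := norm_c2_le (t := t) hX0 (p := p)
    have h3 : ‖χ p‖ ≤ 1 := χ.norm_le_one _
    have h4 : ‖χ p ^ 2‖ ≤ 1 := by rw [norm_pow]; exact pow_le_one₀ (norm_nonneg _) h3
    refine (norm_add_le _ _).trans ?_
    rw [norm_mul, norm_mul]
    have := mul_le_one₀ h1 (norm_nonneg _) h3
    have := mul_le_one₀ h2 (norm_nonneg _) h4
    linarith
  refine (Finset.sum_le_sum this).trans ?_
  rw [Finset.sum_const, nsmul_eq_mul, mul_comm]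

section comb
variable {ι : Type*} [Fintype ι]

/-- combined prime coefficient -/
noncomputable def cc (a t : ι → ℝ) (X : ℝ) (p : ℕ) : ℂ := ∑ k, a k * c1 X (t k) p
/-- combined prime square coefficient -/
noncomputable def dd (a t : ι → ℝ) (X : ℝ) (p : ℕ) : ℂ := ∑ k, a k * c2 X (t k) p

lemma cpow_split {p : ℕ} (hp : 0 < p) (u t : ℝ) :
    (p : ℂ) ^ (-(⟨u, t⟩ : ℂ)) = ((p:ℝ) ^ (-u) : ℝ) * (p : ℂ) ^ (-(t * I : ℂ)) := by
  have e : -(⟨u, t⟩ : ℂ) = ((-u : ℝ) : ℂ) + -(t * I : ℂ) := by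
    apply Complex.ext <;> simp
  rw [e, Complex.cpow_add _ _ (by exact_mod_cast hp.ne'), Complex.ofReal_cpow (by positivity)]
  simp

lemma norm_cc_le (a t : ι → ℝ) {X : ℝ} (hX : 0 < X) {p : ℕ} (hp : p ∈ PX X) :
    ‖cc a t X p‖ ≤ ‖gp a t p‖ * (p:ℝ) ^ (-(1/2 : ℝ)) := by
  have hp1 := mem_PX.1 hp
  have e : cc a t X p = gp a t p * (((p:ℝ) ^ (-(1/2 + 40/X)) * (1 - Real.log p / X) ^ 4 : ℝ) : ℂ) := by
    unfold cc gp c1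
    rw [Finset.sum_mul]
    refine Finset.sum_congr rfl fun k _ => ?_
    rw [cpow_split hp1.1.pos]
    push_cast
    ring
  rw [e, norm_mul]
  refine mul_le_mul_of_nonneg_left ?_ (norm_nonneg _)
  have h := norm_term_le (t := 0) hX hp1.1.one_lt.le hp1.2 (z := 1) (by simp)
  rw [cpow_split hp1.1.pos] at h
  simpa using h

lemma norm_dd_le (a t : ι → ℝ) (ha : ∀ k, 0 ≤ a k) {X : ℝ} (hX : 0 < X) {p : ℕ} (hp : p.Prime) :
    ‖dd a t X p‖ ≤ (∑ k, a k) / (2 * p) := by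
  unfold dd
  refine (norm_sum_le _ _).trans ?_
  rw [Finset.sum_div]
  refine Finset.sum_le_sum fun k _ => ?_
  rw [norm_mul, Complex.norm_real, Real.norm_of_nonneg (ha k), div_eq_mul_one_div]
  refine mul_le_mul_of_nonneg_left ?_ (ha k)
  have hp0 : (0:ℝ) < p := by exact_mod_cast hp.pos
  unfold c2
  split_ifs with h
  · have h1 := norm_term_le (t := t k) hX (n := p ^ 2) (Nat.one_le_pow _ _ hp.pos) (sq_mem h) (z := 1) (by norm_num)
    have e : Real.log ((p ^ 2 : ℕ) : ℝ) / X = 2 * Real.log p / X := by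
      push_cast
      rw [Real.log_pow]; push_cast; ring
    have e2 : ((p ^ 2 : ℕ) : ℝ) ^ (-(1/2:ℝ)) = 1 / p := by
      push_cast
      rw [← Real.rpow_natCast, ← Real.rpow_mul hp0.le]
      norm_num [Real.rpow_neg_one]
    rw [e, e2, one_mul] at h1
    rw [mul_assoc, norm_mul]
    calc _ ≤ ‖(1 / 2 : ℂ)‖ * (1 / p) := by gcongr
      _ = _ := by norm_num; ring
  · rw [norm_zero]; positivity

end comb

/-! ### B5: combinatorics of Harper's argument -/

lemma exp_le_EEr {V y : ℝ} (hV : 1 ≤ V) (n : ℕ) (hn : 10 * V ≤ n) (hy : |y| ≤ V) :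
    Real.exp y ≤ Real.exp (2 / V) * EEr n (y / 2) ^ 2 := by
  set x := y / 2 with hx
  set M : ℕ := n + 1 with hM
  have hMn : (M : ℝ) = n + 1 := by rw [hM]; push_cast; ring
  have hxV : |x| ≤ M / 20 := by
    rw [hx, abs_div, abs_two]; rw [hMn]; linarith
  have hM10 : 10 * V ≤ M := by rw [hMn]; linarith
  have htail : |Real.exp x - EEr n x| ≤ |x| ^ M / M.factorial * Real.exp |x| := by
    have e : Complex.exp x - ∑ m ∈ Finset.range M, (x:ℂ) ^ m / m.factorial = ((Real.exp x - EEr n x : ℝ) : ℂ) := by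
      simp only [EEr]; push_cast; rfl
    have h3 := Complex.norm_exp_sub_sum_le_exp_norm_sub_sum (x : ℂ) M
    rw [e] at h3
    simp only [Complex.norm_real, Real.norm_eq_abs] at h3
    refine h3.trans ?_
    have h4 : Real.exp |x| = ∑' m : ℕ, |x| ^ m / m.factorial := by
      rw [Real.exp_eq_exp_ℝ, NormedSpace.exp_eq_tsum_div]
    have hs : Summable fun m : ℕ => |x| ^ m / m.factorial := Real.summable_pow_div_factorial _
    have h5 : Real.exp |x| - ∑ m ∈ Finset.range M, |x| ^ m / m.factorial = ∑' m : ℕ, |x| ^ (m + M) / (m + M).factorial := by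
      rw [h4, ← hs.sum_add_tsum_nat_add M, add_sub_cancel_left]
    rw [h5, h4, ← tsum_mul_left]
    refine Summable.tsum_le_tsum (fun k => ?_) ((summable_nat_add_iff M).2 hs) (hs.mul_left _)
    rw [div_mul_div_comm, ← pow_add, add_comm k M]
    gcongr
    exact_mod_cast Nat.le_of_dvd (Nat.factorial_pos _) (Nat.factorial_mul_factorial_dvd_factorial_add M k)
  have he2 : Real.exp 2 ≤ 8 := by
    have : Real.exp 2 = Real.exp 1 ^ 2 := by rw [← Real.exp_nat_mul]; norm_num
    rw [this]; nlinarith [Real.exp_one_lt_d9, Real.exp_one_gt_d9]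
  have h5 : |x| ^ M / M.factorial ≤ Real.exp (0.4 * M) * Real.exp (-(2 * M)) := by
    have h := Real.pow_div_factorial_le_exp (Real.exp 2 * |x|) (by positivity) M
    have h6 : Real.exp (Real.exp 2 * |x|) ≤ Real.exp (0.4 * M) := by
      apply Real.exp_le_exp.2
      have := mul_le_mul he2 hxV (abs_nonneg _) (by norm_num)
      linarith
    have e : (Real.exp 2 * |x|) ^ M / M.factorial = |x| ^ M / M.factorial * Real.exp (2 * M) := by
      rw [mul_pow, ← Real.exp_nat_mul, mul_comm (M:ℝ) 2]; ring
    rw [e] at h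
    rw [Real.exp_neg, ← div_eq_mul_inv, le_div_iff₀ (Real.exp_pos _)]
    linarith
  set ε := Real.exp (-(1.4 * M)) with hε
  have hε0 : 0 < ε := Real.exp_pos _
  have h7 : |Real.exp x - EEr n x| ≤ ε * Real.exp x := by
    refine htail.trans ((mul_le_mul_of_nonneg_right h5 (Real.exp_pos _).le).trans ?_)
    rw [hε, ← Real.exp_add, ← Real.exp_add, ← Real.exp_add]
    apply Real.exp_le_exp.2
    have := neg_abs_le x
    linarith
  have hεV : 2 * ε ≤ 1 / V := by
    rw [hε, Real.exp_neg]
    have h8 : 1.4 * M + 1 ≤ Real.exp (1.4 * M) := Real.add_one_le_exp _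
    rw [mul_inv_le_iff₀ (Real.exp_pos _), one_div_mul_eq_div, le_div_iff₀ (by linarith)]
    linarith
  have hV1 : 1 / V ≤ 1 := by rw [div_le_one (by linarith)]; exact hV
  have h9 : Real.exp x * (1 - ε) ≤ EEr n x := by
    have := (abs_le.1 h7).2; linarith
  have h10 : 1 ≤ (1 - ε) * Real.exp (1 / V) := by
    have : 1 + 1 / V ≤ Real.exp (1 / V) := by linarith [Real.add_one_le_exp (1 / V)]
    have h11 : (1 - ε) * (1 + 1 / V) ≤ (1 - ε) * Real.exp (1 / V) :=
      mul_le_mul_of_nonneg_left this (by linarith)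
    nlinarith
  have h12 : Real.exp x ≤ Real.exp (1 / V) * EEr n x := by
    calc Real.exp x = Real.exp x * 1 := by ring
      _ ≤ Real.exp x * ((1 - ε) * Real.exp (1 / V)) := by gcongr
      _ = Real.exp (1 / V) * (Real.exp x * (1 - ε)) := by ring
      _ ≤ _ := by gcongr
  calc Real.exp y = Real.exp x ^ 2 := by rw [← Real.exp_nat_mul, hx]; push_cast; congr 1; ring
    _ ≤ (Real.exp (1 / V) * EEr n x) ^ 2 := by gcongr
    _ = _ := by rw [mul_pow, ← Real.exp_nat_mul]; push_cast; congr 2; ring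

lemma harper_combi (J : ℕ) (F T : ℝ) (hT : 0 ≤ T) (y : ℕ → ℕ → ℝ) (V E : ℕ → ℝ) (hV : ∀ i, i < J → 0 < V i)
    (hE : ∀ i, 0 ≤ E i)
    (Ψ : ℕ → ℝ → ℝ) (hΨ0 : ∀ i y, 0 ≤ Ψ i y) (hΨ : ∀ i < J, ∀ y, |y| ≤ V i → Real.exp y ≤ Ψ i y) (m : ℕ → ℕ)
    (hF : ∀ l ≤ J, F ≤ T * E l * Real.exp (∑ i ∈ Finset.range l, y i l)) :
    F ≤ T * (E J * ∏ i ∈ Finset.range J, Ψ i (y i J) + ∑ j ∈ Finset.range J, ∑ l ∈ Finset.Ioc j J,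
      E j * (∏ i ∈ Finset.range j, Ψ i (y i j)) * (y j l / V j) ^ (2 * m j)) := by
  have key : ∀ l ≤ J, (∀ i < l, |y i l| ≤ V i) → F ≤ T * (E l * ∏ i ∈ Finset.range l, Ψ i (y i l)) := by
    intro l hl h
    refine (hF l hl).trans ?_
    rw [mul_assoc]
    refine mul_le_mul_of_nonneg_left (mul_le_mul_of_nonneg_left ?_ (hE l)) hT
    rw [Real.exp_sum]
    refine Finset.prod_le_prod (fun i _ => (Real.exp_pos _).le) fun i hi => ?_
    have hi' := Finset.mem_range.1 hi
    exact hΨ i (by omega) _ (h i hi')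
  have hterm : ∀ j l, 0 ≤ E j * (∏ i ∈ Finset.range j, Ψ i (y i j)) * (y j l / V j) ^ (2 * m j) := by
    intro j l
    refine mul_nonneg (mul_nonneg (hE j) (Finset.prod_nonneg fun i _ => hΨ0 i _)) ?_
    rw [pow_mul]; positivity
  have hmain : 0 ≤ E J * ∏ i ∈ Finset.range J, Ψ i (y i J) := mul_nonneg (hE J) (Finset.prod_nonneg fun i _ => hΨ0 i _)
  by_cases h : ∃ j, j < J ∧ ∃ l, j < l ∧ l ≤ J ∧ V j < |y j l|
  · classical
    obtain ⟨hj, l, hjl, hlJ, hbad⟩ := Nat.find_spec h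
    set j := Nat.find h with hjdef
    have hgood : ∀ i < j, |y i j| ≤ V i := by
      intro i hi
      by_contra hc
      push Not at hc
      exact Nat.find_min h hi ⟨by omega, j, hi, hj.le, hc⟩
    refine (key j hj.le hgood).trans (mul_le_mul_of_nonneg_left ?_ hT)
    have h1 : E j * (∏ i ∈ Finset.range j, Ψ i (y i j)) ≤ E j * (∏ i ∈ Finset.range j, Ψ i (y i j)) * (y j l / V j) ^ (2 * m j) := by
      refine le_mul_of_one_le_right (mul_nonneg (hE j) (Finset.prod_nonneg fun i _ => hΨ0 i _)) ?_
      rw [pow_mul, ← sq_abs, abs_div, abs_of_pos (hV j hj)]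
      refine one_le_pow₀ (one_le_pow₀ ?_)
      rw [one_le_div (hV j hj)]; exact hbad.le
    have h2 : E j * (∏ i ∈ Finset.range j, Ψ i (y i j)) * (y j l / V j) ^ (2 * m j) ≤ ∑ l ∈ Finset.Ioc j J,
      E j * (∏ i ∈ Finset.range j, Ψ i (y i j)) * (y j l / V j) ^ (2 * m j) :=
      Finset.single_le_sum (f := fun l => E j * (∏ i ∈ Finset.range j, Ψ i (y i j)) * (y j l / V j) ^ (2 * m j))
        (fun l _ => hterm j l) (Finset.mem_Ioc.2 ⟨hjl, hlJ⟩)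
    have h3 : ∑ l ∈ Finset.Ioc j J,
      E j * (∏ i ∈ Finset.range j, Ψ i (y i j)) * (y j l / V j) ^ (2 * m j) ≤ ∑ j ∈ Finset.range J, ∑ l ∈ Finset.Ioc j J,
      E j * (∏ i ∈ Finset.range j, Ψ i (y i j)) * (y j l / V j) ^ (2 * m j) :=
      Finset.single_le_sum (f := fun j => ∑ l ∈ Finset.Ioc j J, E j * (∏ i ∈ Finset.range j, Ψ i (y i j)) * (y j l / V j) ^ (2 * m j))
        (fun j _ => Finset.sum_nonneg fun l _ => hterm j l) (Finset.mem_range.2 hj)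
    linarith
  · push Not at h
    refine (key J le_rfl fun i hi => h i hi J hi le_rfl).trans (mul_le_mul_of_nonneg_left ?_ hT)
    have : 0 ≤ ∑ j ∈ Finset.range J, ∑ l ∈ Finset.Ioc j J,
      E j * (∏ i ∈ Finset.range j, Ψ i (y i j)) * (y j l / V j) ^ (2 * m j) :=
      Finset.sum_nonneg fun j _ => Finset.sum_nonneg fun l _ => hterm j l
    linarith

/-- real part of a Dirichlet polynomial over primes -/
noncomputable def YN {q : ℕ} (B : Finset ℕ) (c d : ℕ → ℂ) (χ : DirichletCharacter ℂ q) : ℝ :=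
  ∑ p ∈ B, (c p * χ p + d p * χ p ^ 2).re

theorem model_bound_nat {q : ℕ} [NeZero q] (S : Finset ℕ) (B : ℕ → Finset ℕ) (hdis : Set.PairwiseDisjoint (S : Set ℕ) B)
    (B' : Finset ℕ) (hdis' : Disjoint (S.biUnion B) B')
    (hp : ∀ i ∈ S, ∀ p ∈ B i, p.Prime) (hp' : ∀ p ∈ B', p.Prime)
    (C D : ℕ → ℝ) (hD : ∀ x, 0 ≤ D x)
    (c d : ℕ → ℕ → ℂ) (hc : ∀ i ∈ S, ∀ x ∈ B i, ‖c i x‖ ≤ C x) (hd : ∀ i ∈ S, ∀ x ∈ B i, ‖d i x‖ ≤ D x)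
    (c' d' : ℕ → ℂ) (hc' : ∀ x ∈ B', ‖c' x‖ ≤ C x) (hd' : ∀ x ∈ B', ‖d' x‖ ≤ D x)
    (P : ℕ → ℝ) (hP1 : ∀ i ∈ S, 1 ≤ P i) (hP : ∀ i ∈ S, ∀ x ∈ B i, (x : ℝ) ^ 2 ≤ P i)
    (P' : ℝ) (hP1' : 1 ≤ P') (hP' : ∀ x ∈ B', (x : ℝ) ^ 2 ≤ P')
    (n : ℕ → ℕ) (m : ℕ) (hlen : (∏ i ∈ S, (P i ^ n i) ^ 2) * P' ^ (2 * m) < q) {μ : ℝ} (hμ : 0 < μ) :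
    ∑ χ : DirichletCharacter ℂ q, (∏ i ∈ S, EEr (n i) (YN (B i) (c i) (d i) χ / 2) ^ 2) *
      YN B' c' d' χ ^ (2 * m) ≤
    q.totient * (2 * ((2 * m).factorial / μ ^ (2 * m)) *
      (Real.exp (∑ x ∈ S.biUnion B, (Real.exp (D x) * C x ^ 2 / 4 + D x ^ 2 / 2)) *
      Real.exp (μ ^ 2 * ∑ x ∈ B', (C x ^ 2 + D x ^ 2)))) := by
  classical
  set U : Finset ℕ := S.biUnion B ∪ B' with hU
  have hUp : ∀ p ∈ U, p.Prime := by
    intro p h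
    rcases Finset.mem_union.1 h with h | h
    · obtain ⟨i, hi, h⟩ := Finset.mem_biUnion.1 h; exact hp i hi p h
    · exact hp' p h
  set pr : U → ℕ := fun x => x.1 with hpr
  have hsub : ∀ i ∈ S, B i ⊆ U := fun i hi => (Finset.subset_biUnion_of_mem B hi).trans Finset.subset_union_left
  have hsub' : B' ⊆ U := Finset.subset_union_right
  have hsubS : S.biUnion B ⊆ U := Finset.subset_union_left
  set R : Finset ℕ → Finset U := fun Q => Q.subtype (fun x => x ∈ U) with hR
  have hsum : ∀ Q ⊆ U, ∀ f : ℕ → ℝ, ∑ x ∈ R Q, f (pr x) = ∑ p ∈ Q, f p := by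
    intro Q hQ f
    rw [hR]
    exact Finset.sum_subtype_of_mem f (fun x hx => hQ hx)
  have hmem : ∀ Q (x : U), x ∈ R Q ↔ pr x ∈ Q := fun Q x => by simp [hR, hpr]
  have hRU : S.biUnion (fun i => R (B i)) = R (S.biUnion B) := by
    ext x; simp only [Finset.mem_biUnion, hmem]
  have hYC : ∀ Q ⊆ U, ∀ (c d : ℕ → ℂ) (χ : DirichletCharacter ℂ q), YC pr (R Q) (fun x => c (pr x)) (fun x => d (pr x)) χ = YN Q c d χ := by
    intro Q hQ c d χ
    unfold YC YN
    exact hsum Q hQ (fun p => (c p * χ p + d p * χ p ^ 2).re)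
  have h := model_bound (q := q) (pr := pr) Subtype.val_injective (fun x => hUp _ x.2) S (fun i => R (B i))
    (by
      intro i hi j hj hij
      have := hdis hi hj hij
      rw [Function.onFun, Finset.disjoint_left] at this ⊢
      intro x hx hx'
      exact this ((hmem _ _).1 hx) ((hmem _ _).1 hx')) (R B')
    (by
      rw [hRU]
      rw [Finset.disjoint_left] at hdis' ⊢
      intro x hx hx'
      exact hdis' ((hmem _ _).1 hx) ((hmem _ _).1 hx'))
    (fun x => C (pr x)) (fun x => D (pr x)) (fun x => hD _) (fun i x => c i (pr x)) (fun i x => d i (pr x))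
    (fun i hi x hx => hc i hi _ ((hmem _ _).1 hx)) (fun i hi x hx => hd i hi _ ((hmem _ _).1 hx))
    (fun x => c' (pr x)) (fun x => d' (pr x)) (fun x hx => hc' _ ((hmem _ _).1 hx)) (fun x hx => hd' _ ((hmem _ _).1 hx))
    P hP1 (fun i hi x hx => hP i hi _ ((hmem _ _).1 hx)) P' hP1' (fun x hx => hP' _ ((hmem _ _).1 hx)) n m hlen hμ
  rw [hRU, hsum _ hsubS (fun p => Real.exp (D p) * C p ^ 2 / 4 + D p ^ 2 / 2), hsum _ hsub' (fun p => C p ^ 2 + D p ^ 2)] at h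
  refine le_trans (le_of_eq ?_) h
  refine Finset.sum_congr rfl fun χ _ => ?_
  rw [hYC _ hsub']
  congr 1
  exact Finset.prod_congr rfl fun i hi => by rw [hYC _ (hsub i hi)]

/-! ### B6: numerical lemmas for Harper's argument -/

/-- block endpoints -/
noncomputable def XJ (j : ℕ) : ℝ := 50 * 2 ^ j

/-- fourth root of `L / XJ j` -/
noncomputable def nn (L : ℝ) (j : ℕ) : ℝ := (L / XJ j) ^ (1/4 : ℝ)

lemma XJ_pos (j : ℕ) : 0 < XJ j := by unfold XJ; positivity
lemma XJ_succ (j : ℕ) : XJ (j+1) = 2 * XJ j := by unfold XJ; ring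
lemma XJ_ge (j : ℕ) : 50 ≤ XJ j := by
  unfold XJ
  have : (1:ℝ) ≤ 2 ^ j := one_le_pow₀ (by norm_num)
  linarith
lemma XJ_mono {i j : ℕ} (h : i ≤ j) : XJ i ≤ XJ j := by
  unfold XJ; gcongr; norm_num

lemma nn_pos {L : ℝ} (hL : 0 < L) (j : ℕ) : 0 < nn L j := Real.rpow_pos_of_pos (div_pos hL (XJ_pos j)) _
lemma nn_pow {L : ℝ} (hL : 0 < L) (j : ℕ) : nn L j ^ 4 = L / XJ j := by
  unfold nn
  rw [← Real.rpow_natCast, ← Real.rpow_mul (div_pos hL (XJ_pos j)).le]; norm_num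

lemma nn_step {L : ℝ} (hL : 0 < L) (j : ℕ) : 1.18 * nn L (j+1) ≤ nn L j := by
  have h1 := nn_pow hL j
  have h2 := nn_pow hL (j+1)
  rw [XJ_succ] at h2
  have h3 : nn L j ^ 4 = 2 * nn L (j+1) ^ 4 := by
    rw [h1, h2]; have := (XJ_pos j).ne'; field_simp
  refine le_of_pow_le_pow_left₀ (n := 4) (by norm_num) (nn_pos hL j).le ?_
  rw [h3, mul_pow]
  have := pow_pos (nn_pos hL (j+1)) 4
  gcongr; norm_num

lemma nn_anti {L : ℝ} (hL : 0 < L) {i j : ℕ} (h : i ≤ j) : nn L j ≤ nn L i := by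
  unfold nn
  have := XJ_pos i
  have := XJ_pos j
  have := XJ_mono h
  gcongr

lemma sum_inv_nn {L : ℝ} (hL : 0 < L) (l : ℕ) : ∑ j ∈ Finset.range l, 1 / nn L j ≤ 6 / nn L l := by
  induction l with
  | zero => simp only [Finset.range_zero, Finset.sum_empty]; exact (div_pos (by norm_num) (nn_pos hL 0)).le
  | succ l ih =>
    rw [Finset.sum_range_succ]
    have h1 := nn_pos hL l
    have h2 := nn_pos hL (l+1)
    have h3 := nn_step hL l
    calc _ ≤ 6 / nn L l + 1 / nn L l := by gcongr
      _ = 7 / nn L l := by ring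
      _ ≤ 6 / nn L (l+1) := by
        rw [div_le_div_iff₀ h1 h2]; linarith

lemma card_le_nn {L : ℝ} (hL : 0 < L) {j J : ℕ} (hj : j < J) (hJ : 1 ≤ nn L J) : ((Finset.Ioc j J).card : ℝ) ≤ nn L j ^ 4 := by
  rw [Nat.card_Ioc, nn_pow hL]
  have h1 := nn_pow hL J
  have h2 : 1 ≤ nn L J ^ 4 := one_le_pow₀ hJ
  rw [h1, le_div_iff₀ (XJ_pos J), one_mul] at h2
  rw [le_div_iff₀ (XJ_pos j)]
  refine le_trans ?_ h2
  have : XJ J = 2 ^ (J - j) * XJ j := by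
    unfold XJ
    rw [show J = (J - j) + j by omega, pow_add]; simp; ring
  rw [this]
  have := XJ_pos j
  gcongr
  exact_mod_cast Nat.lt_two_pow_self.le

lemma bad_num {C1 K n : ℝ} (hC1 : 0 ≤ C1) (hn : 4 ≤ n) (hK : Real.exp (K + 64 * (C1 + 2)) ≤ 8 * n ^ 2) (m : ℕ) (hm : m = ⌊n ^ 4 / 32⌋₊) :
    n ^ 4 * Real.exp (C1 * n ^ 4) * (2 * (((2 * m).factorial : ℝ) / √m ^ (2 * m)) * Real.exp (√m ^ 2 * K)) / (n ^ 3) ^ (2 * m) ≤ 1 / n := by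
  set N := n ^ 4 with hN
  have hN64 : 256 ≤ N := by
    have : (4:ℝ)^4 ≤ n ^ 4 := by gcongr
    linarith
  have hmle : (m:ℝ) ≤ N / 32 := by rw [hm]; exact Nat.floor_le (by positivity)
  have hmge : N / 64 ≤ m := by
    have := Nat.lt_floor_add_one (N / 32)
    rw [← hm] at this; linarith
  have hm0 : (0:ℝ) < m := by linarith
  rw [pow_mul √_, Real.sq_sqrt hm0.le]
  have hfac : ((2 * m).factorial : ℝ) ≤ (4 * m) ^ m * (m:ℝ) ^ m := by
    have : ((2 * m).factorial : ℝ) ≤ ((2 * m : ℕ) : ℝ) ^ (2 * m) := by exact_mod_cast Nat.factorial_le_pow _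
    refine this.trans (le_of_eq ?_)
    push_cast; rw [pow_mul, ← mul_pow]; ring
  have h1 : ((2 * m).factorial : ℝ) / (m:ℝ) ^ m ≤ (4 * m) ^ m := by
    rw [div_le_iff₀ (by positivity)]; exact hfac
  have h2 : ((4 * m : ℝ)) ^ m ≤ (N / 8) ^ m := by gcongr; linarith
  have hn0 : 0 < n := by linarith
  have h3 : (N / 8) ^ m * Real.exp (m * K) / (n ^ 3) ^ (2 * m) = (Real.exp K / (8 * n ^ 2)) ^ m := by
    rw [Real.exp_nat_mul, pow_mul, ← mul_pow, ← div_pow, hN]; congr 1; field_simp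
  have h4 : Real.exp K / (8 * n ^ 2) ≤ Real.exp (-(64 * (C1 + 2))) := by
    rw [div_le_iff₀ (by positivity)]
    calc Real.exp K = Real.exp (-(64 * (C1 + 2))) * Real.exp (K + 64 * (C1 + 2)) := by rw [← Real.exp_add]; congr 1; ring
      _ ≤ _ := by gcongr
  have h5 : (Real.exp K / (8 * n ^ 2)) ^ m ≤ Real.exp (-((C1 + 2) * N)) := by
    calc _ ≤ Real.exp (-(64 * (C1 + 2))) ^ m := by gcongr
      _ = Real.exp (m * (-(64 * (C1 + 2)))) := by rw [Real.exp_nat_mul]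
      _ ≤ _ := by apply Real.exp_le_exp.2; nlinarith
  have h6 : 2 * N ^ 2 ≤ Real.exp (2 * N) := by
    have := Real.quadratic_le_exp_of_nonneg (x := 2 * N) (by linarith)
    nlinarith
  have h7 : n ≤ N := by
    rw [hN]; calc n = n ^ 1 := (pow_one n).symm
      _ ≤ n ^ 4 := pow_le_pow_right₀ (by linarith) (by norm_num)
  calc _ ≤ N * Real.exp (C1 * N) * (2 * (N / 8) ^ m * Real.exp (m * K)) / (n ^ 3) ^ (2 * m) := by
        gcongr; exact h1.trans h2
    _ = 2 * N * Real.exp (C1 * N) * ((N / 8) ^ m * Real.exp (m * K) / (n ^ 3) ^ (2 * m)) := by ring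
    _ ≤ 2 * N * Real.exp (C1 * N) * Real.exp (-((C1 + 2) * N)) := by rw [h3]; gcongr
    _ = 2 * N * Real.exp (-(2 * N)) := by rw [mul_assoc, ← Real.exp_add]; congr 2; ring
    _ ≤ 1 / n := by
      rw [Real.exp_neg, le_div_iff₀ hn0, ← div_eq_mul_inv, div_mul_eq_mul_div, div_le_one (Real.exp_pos _)]
      nlinarith

/-- prime blocks -/
noncomputable def blk (i : ℕ) : Finset ℕ := PX (XJ (i+1)) \ PX (XJ i)

lemma PX_mono {X Y : ℝ} (h : X ≤ Y) : PX X ⊆ PX Y := fun p hp => by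
  rw [mem_PX] at hp ⊢; exact ⟨hp.1, hp.2.trans h⟩

lemma mem_blk {i p : ℕ} : p ∈ blk i ↔ p.Prime ∧ XJ i < Real.log p ∧ Real.log p ≤ XJ (i+1) := by
  unfold blk
  rw [Finset.mem_sdiff, mem_PX, mem_PX]
  constructor
  · rintro ⟨⟨h1, h2⟩, h3⟩; exact ⟨h1, by by_contra h; exact h3 ⟨h1, not_lt.1 h⟩, h2⟩
  · rintro ⟨h1, h2, h3⟩; exact ⟨⟨h1, h3⟩, fun h => absurd h.2 (not_le.2 h2)⟩

lemma blk_disj {i j : ℕ} (h : i < j) : Disjoint (blk i) (blk j) := by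
  rw [Finset.disjoint_left]
  intro p hp hp'
  have h1 := (mem_blk.1 hp).2.2
  have h2 := (mem_blk.1 hp').2.1
  have := XJ_mono (show i + 1 ≤ j from h)
  linarith

lemma blk_pairwise (s : Set ℕ) : s.PairwiseDisjoint blk := by
  intro i _ j _ hij
  rcases lt_or_gt_of_ne hij with h | h
  · exact blk_disj h
  · exact (blk_disj h).symm

lemma biUnion_blk (l : ℕ) : (Finset.range l).biUnion blk = PX (XJ l) \ PX 50 := by
  induction l with
  | zero => simp [XJ]
  | succ l ih =>
    rw [Finset.range_add_one, Finset.biUnion_insert, ih, blk]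
    have h1 : PX 50 ⊆ PX (XJ l) := PX_mono (XJ_ge l)
    have h2 : PX (XJ l) ⊆ PX (XJ (l+1)) := PX_mono (XJ_mono (by omega))
    ext p
    simp only [Finset.mem_union, Finset.mem_sdiff]
    constructor
    · rintro (⟨a, b⟩ | ⟨a, b⟩)
      · exact ⟨a, fun h => b (h1 h)⟩
      · exact ⟨h2 a, b⟩
    · rintro ⟨a, b⟩
      by_cases h : p ∈ PX (XJ l)
      · exact Or.inr ⟨h, b⟩
      · exact Or.inl ⟨a, h⟩

/-- lengths -/
lemma len_le {L : ℝ} (hL : 0 < L) {j : ℕ} (hj : 1100 ≤ nn L j) (m : ℕ) (hm : (m:ℝ) ≤ nn L j ^ 4 / 32) :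
    (∏ i ∈ Finset.range j, (Real.exp (2 * XJ (i+1)) ^ ⌈10 * nn L i ^ 3⌉₊) ^ 2) * Real.exp (2 * XJ (j+1)) ^ (2 * m) < Real.exp L := by
  have h1 : ∏ i ∈ Finset.range j, (Real.exp (2 * XJ (i+1)) ^ ⌈10 * nn L i ^ 3⌉₊) ^ 2 ≤ Real.exp (L / 2) := by
    have : ∀ i ∈ Finset.range j, (Real.exp (2 * XJ (i+1)) ^ ⌈10 * nn L i ^ 3⌉₊) ^ 2 ≤ Real.exp (88 * L * (1 / nn L i)) := by
      intro i hi
      have hin : nn L j ≤ nn L i := nn_anti hL (Finset.mem_range.1 hi).le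
      have hn1 : 1 ≤ nn L i ^ 3 := one_le_pow₀ (by linarith)
      have hc : (⌈10 * nn L i ^ 3⌉₊ : ℝ) ≤ 11 * nn L i ^ 3 := by
        have := Nat.ceil_lt_add_one (show 0 ≤ 10 * nn L i ^ 3 by linarith)
        linarith
      rw [← pow_mul, ← Real.exp_nat_mul]
      apply Real.exp_le_exp.2
      push_cast
      rw [XJ_succ]
      have h4 := nn_pow hL i
      have hx := XJ_pos i
      have hn0 := nn_pos hL i
      have e : L * (1 / nn L i) = XJ i * nn L i ^ 3 := by
        rw [eq_div_iff hx.ne'] at h4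
        rw [mul_one_div, div_eq_iff hn0.ne', mul_assoc, ← pow_succ, mul_comm]; exact h4.symm
      calc _ = 8 * XJ i * ⌈10 * nn L i ^ 3⌉₊ := by ring
        _ ≤ 8 * XJ i * (11 * nn L i ^ 3) := by gcongr
        _ = 88 * (XJ i * nn L i ^ 3) := by ring
        _ = _ := by rw [← e]; ring
    refine (Finset.prod_le_prod (fun i _ => by positivity) this).trans ?_
    rw [← Real.exp_sum, ← Finset.mul_sum]
    apply Real.exp_le_exp.2
    calc _ ≤ 88 * L * (6 / nn L j) := by gcongr; exact sum_inv_nn hL j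
      _ = L * (528 / nn L j) := by ring
      _ ≤ L * (1 / 2) := by
        refine mul_le_mul_of_nonneg_left ?_ hL.le
        rw [div_le_div_iff₀ (by linarith) (by norm_num)]; linarith
      _ = _ := by ring
  have h2 : Real.exp (2 * XJ (j+1)) ^ (2 * m) ≤ Real.exp (L / 4) := by
    rw [← Real.exp_nat_mul]
    apply Real.exp_le_exp.2
    rw [nn_pow hL] at hm
    have hx := XJ_pos j
    push_cast
    rw [XJ_succ]
    have : (m:ℝ) * XJ j ≤ L / 32 := by
      calc _ ≤ L / XJ j / 32 * XJ j := by gcongr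
        _ = _ := by field_simp
    linarith
  calc _ ≤ Real.exp (L / 2) * Real.exp (L / 4) := by gcongr
    _ = Real.exp (L / 2 + L / 4) := by rw [Real.exp_add]
    _ < _ := by apply Real.exp_lt_exp.2; linarith

/-! ### B7: the shifted moment bound -/

section harper
variable {ι : Type*} [Fintype ι]

/-- majorant of the coefficients at primes -/
noncomputable def CM (a t : ι → ℝ) (p : ℕ) : ℝ := ‖gp a t p‖ * (p:ℝ) ^ (-(1/2 : ℝ))
/-- majorant of the coefficients at prime squares -/
noncomputable def DM (a : ι → ℝ) (p : ℕ) : ℝ := (∑ k, a k) / (2 * p)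

lemma CM_sq (a t : ι → ℝ) {p : ℕ} (hp : 0 < p) : CM a t p ^ 2 = ‖gp a t p‖ ^ 2 / p := by
  unfold CM
  have : (0:ℝ) < p := by exact_mod_cast hp
  rw [mul_pow, ← Real.rpow_natCast ((p:ℝ) ^ _), ← Real.rpow_mul this.le]
  norm_num
  rw [Real.rpow_neg_one]; rfl

/-- exponent in the main term -/
noncomputable def GE (a t : ι → ℝ) (L : ℝ) : ℝ := ∑ k, ∑ l, a k * a l / 4 * Real.log (1 / (|t k - t l| + 1 / L))

lemma good_exponent (a t : ι → ℝ) (ha : ∀ k, 0 ≤ a k) {X L : ℝ} (hX : 1 ≤ X) (hXL : X ≤ L) (U : Finset ℕ) (hU : U ⊆ PX X) :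
    ∑ p ∈ U, (Real.exp (DM a p) * CM a t p ^ 2 / 4 + DM a p ^ 2 / 2) ≤
      GE a t L + (∑ k, a k) * ∑ k, a k * Real.log (2 + |t k|) +
      (2 * (∑ k, a k) ^ 2 + (Real.exp (∑ k, a k) * (∑ k, a k) ^ 3 + (∑ k, a k) ^ 2)) := by
  set A := ∑ k, a k with hA
  have hA0 : 0 ≤ A := Finset.sum_nonneg fun k _ => ha k
  have hD0 : ∀ p, 0 ≤ DM a p := fun p => by unfold DM; positivity
  have h1 : ∀ p ∈ PX X, Real.exp (DM a p) * CM a t p ^ 2 / 4 + DM a p ^ 2 / 2 ≤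
      (1/4) * (‖gp a t p‖ ^ 2 / p) + ((Real.exp A * A ^ 3 + A ^ 2) / 8) * (1 / (p:ℝ) ^ 2) := by
    intro p hp
    have hpp := (mem_PX.1 hp).1
    have hp0 : (1:ℝ) ≤ p := by exact_mod_cast hpp.one_lt.le
    rw [CM_sq a t hpp.pos]
    have hg := gp_norm_le a t ha hpp.pos
    rw [← hA] at hg
    have hDA : DM a p ≤ A := by
      unfold DM; rw [← hA]
      apply div_le_self hA0; linarith
    have h2 : Real.exp (DM a p) ≤ 1 + DM a p * Real.exp A := by
      have h3 : Real.exp (-DM a p) ≥ 1 - DM a p := by linarith [Real.add_one_le_exp (-DM a p)]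
      have h4 : Real.exp (DM a p) * Real.exp (-DM a p) = 1 := by rw [← Real.exp_add]; simp
      have h5 : Real.exp (DM a p) ≤ Real.exp A := Real.exp_le_exp.2 hDA
      have h6 := Real.exp_pos (DM a p)
      have := hD0 p
      nlinarith
    have h7 : ‖gp a t p‖ ^ 2 / p ≤ A ^ 2 / p := by gcongr
    have e1 : DM a p = A / (2 * p) := rfl
    have h8 : 0 ≤ ‖gp a t p‖ ^ 2 / p := by positivity
    calc _ ≤ (1 + DM a p * Real.exp A) * (‖gp a t p‖ ^ 2 / p) / 4 + DM a p ^ 2 / 2 := by gcongr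
      _ = (1/4) * (‖gp a t p‖ ^ 2 / p) + DM a p * Real.exp A * (‖gp a t p‖ ^ 2 / p) / 4 + DM a p ^ 2 / 2 := by ring
      _ ≤ (1/4) * (‖gp a t p‖ ^ 2 / p) + DM a p * Real.exp A * (A ^ 2 / p) / 4 + DM a p ^ 2 / 2 := by
        have := hD0 p; gcongr
      _ = _ := by rw [e1]; field_simp; ring
  have h2 : ∑ p ∈ U, (Real.exp (DM a p) * CM a t p ^ 2 / 4 + DM a p ^ 2 / 2) ≤ ∑ p ∈ PX X, (Real.exp (DM a p) * CM a t p ^ 2 / 4 + DM a p ^ 2 / 2) := by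
    refine Finset.sum_le_sum_of_subset_of_nonneg hU fun p _ _ => by positivity
  have h3 := (Finset.sum_le_sum h1).trans_eq Finset.sum_add_distrib
  rw [← Finset.mul_sum, ← Finset.mul_sum] at h3
  have h4 := main_sum a t ha hX
  rw [← hA] at h4
  have h5 : ((Real.exp A * A ^ 3 + A ^ 2) / 8) * ∑ p ∈ PX X, 1 / (p:ℝ) ^ 2 ≤ ((Real.exp A * A ^ 3 + A ^ 2) / 8) * 2 := by
    gcongr; exact sum_inv_sq_le _
  have h6 : ∑ k, ∑ l, a k * a l * (Real.log (1 / (|t k - t l| + 1 / X)) + 2 * Real.log (2 + |t k - t l|) + 4) ≤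
      ∑ k, ∑ l, a k * a l * (Real.log (1 / (|t k - t l| + 1 / L)) + 2 * (Real.log (2 + |t k|) + Real.log (2 + |t l|)) + 4) := by
    refine Finset.sum_le_sum fun k _ => Finset.sum_le_sum fun l _ => ?_
    refine mul_le_mul_of_nonneg_left ?_ (mul_nonneg (ha k) (ha l))
    have hL0 : 0 < L := by linarith
    have h7 : Real.log (1 / (|t k - t l| + 1 / X)) ≤ Real.log (1 / (|t k - t l| + 1 / L)) := by
      apply Real.log_le_log (by positivity)
      gcongr
    have h8 : Real.log (2 + |t k - t l|) ≤ Real.log (2 + |t k|) + Real.log (2 + |t l|) := by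
      rw [← Real.log_mul (by positivity) (by positivity)]
      apply Real.log_le_log (by positivity)
      have := abs_sub (t k) (t l)
      nlinarith [abs_nonneg (t k), abs_nonneg (t l), mul_nonneg (abs_nonneg (t k)) (abs_nonneg (t l))]
    linarith
  have h7 : ∑ k, ∑ l, a k * a l * (Real.log (1 / (|t k - t l| + 1 / L)) + 2 * (Real.log (2 + |t k|) + Real.log (2 + |t l|)) + 4) =
      4 * GE a t L + 4 * (A * ∑ k, a k * Real.log (2 + |t k|)) + 4 * A ^ 2 := by
    have e1 : ∑ k, ∑ l, a k * a l * Real.log (2 + |t k|) = A * ∑ k, a k * Real.log (2 + |t k|) := by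
      rw [Finset.mul_sum]
      refine Finset.sum_congr rfl fun k _ => ?_
      rw [hA, Finset.sum_mul]
      exact Finset.sum_congr rfl fun l _ => by ring
    have e2 : ∑ k, ∑ l, a k * a l * Real.log (2 + |t l|) = A * ∑ k, a k * Real.log (2 + |t k|) := by
      rw [hA, Finset.sum_mul_sum]
      exact Finset.sum_congr rfl fun k _ => Finset.sum_congr rfl fun l _ => by ring
    have e3 : ∑ k, ∑ l, a k * a l = A ^ 2 := by rw [hA, sq, Finset.sum_mul_sum]
    have e4 : 4 * GE a t L = ∑ k, ∑ l, a k * a l * Real.log (1 / (|t k - t l| + 1 / L)) := by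
      unfold GE
      simp only [Finset.mul_sum]
      exact Finset.sum_congr rfl fun k _ => Finset.sum_congr rfl fun l _ => by ring
    rw [e4]
    calc _ = ∑ k, ∑ l, (a k * a l * Real.log (1 / (|t k - t l| + 1 / L)) + 2 * (a k * a l * Real.log (2 + |t k|))
          + 2 * (a k * a l * Real.log (2 + |t l|)) + 4 * (a k * a l)) :=
          Finset.sum_congr rfl fun k _ => Finset.sum_congr rfl fun l _ => by ring
      _ = _ := by
        simp only [Finset.sum_add_distrib, ← Finset.mul_sum]
        simp only [← Finset.mul_sum] at e3
        rw [e1, e2, e3]; ring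
  have h8 : 0 ≤ (Real.exp A * A ^ 3 + A ^ 2) := by positivity
  have h9 : 0 ≤ A ^ 2 := by positivity
  linarith

lemma blk_variance (a t : ι → ℝ) (ha : ∀ k, 0 ≤ a k) (j : ℕ) :
    ∑ p ∈ blk j, (CM a t p ^ 2 + DM a p ^ 2) ≤ 4 * (∑ k, a k) ^ 2 := by
  set A := ∑ k, a k with hA
  have hA0 : 0 ≤ A := Finset.sum_nonneg fun k _ => ha k
  have h1 : ∀ p ∈ blk j, CM a t p ^ 2 + DM a p ^ 2 ≤ A ^ 2 * (1 / p) + A ^ 2 / 4 * (1 / (p:ℝ) ^ 2) := by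
    intro p hp
    have hpp := (mem_blk.1 hp).1
    have hp0 : (1:ℝ) ≤ p := by exact_mod_cast hpp.one_lt.le
    rw [CM_sq a t hpp.pos]
    have hg := gp_norm_le a t ha hpp.pos
    rw [← hA] at hg
    have h7 : ‖gp a t p‖ ^ 2 / p ≤ A ^ 2 / p := by gcongr
    have e1 : DM a p = A / (2 * p) := rfl
    have e2 : DM a p ^ 2 = A ^ 2 / 4 * (1 / (p:ℝ) ^ 2) := by rw [e1]; field_simp; norm_num
    rw [e2, mul_one_div (A ^ 2) (p:ℝ)]; linarith
  have h2 := (Finset.sum_le_sum h1).trans_eq Finset.sum_add_distrib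
  rw [← Finset.mul_sum, ← Finset.mul_sum] at h2
  have h3 := block_var (X := XJ j) (by linarith [XJ_ge j]) (blk j) (fun p hp => by
    have := mem_blk.1 hp
    rw [← XJ_succ]
    exact ⟨mem_PX.2 ⟨this.1, this.2.2⟩, this.2.1.le⟩)
  have h4 := sum_inv_sq_le (blk j)
  have h5 : A ^ 2 * ∑ p ∈ blk j, 1 / (p:ℝ) ≤ A ^ 2 * 3 := by gcongr
  have h6 : A ^ 2 / 4 * ∑ p ∈ blk j, 1 / (p:ℝ) ^ 2 ≤ A ^ 2 / 4 * 2 := by gcongr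
  nlinarith [sq_nonneg A]

lemma pointwise_L (a t : ι → ℝ) (ha : ∀ k, 0 ≤ a k) {K : ℝ}
    (hK : ∀ (q : ℕ) (χ : DirichletCharacter ℂ q) (X t : ℝ), 50 ≤ X →
    ‖SS χ X ⟨1 / 2 + 40 / X, t⟩ - ∑ p ∈ PX X \ PX 50, (c1 X t p * χ p + c2 X t p * χ p ^ 2)‖ ≤ K)
    {q : ℕ} [NeZero q] (χ : DirichletCharacter ℂ q) (hχ : χ ≠ 1) (hRH : dirichletRH χ) (l : ℕ) (hl : XJ l ≤ Real.log q) :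
    ∏ k, ‖DirichletCharacter.LFunction χ ⟨1 / 2 + 1 / Real.log q, t k⟩‖ ^ (a k) ≤
      Real.exp ((∑ k, a k) * K + 3000 * ∑ k, a k * Real.log (2 + |t k|)) *
      Real.exp (110000 * (∑ k, a k) * (Real.log q / XJ l)) *
      Real.exp (∑ i ∈ Finset.range l, YN (blk i) (cc a t (XJ l)) (dd a t (XJ l)) χ) := by
  set X := XJ l with hX
  have hX50 : 50 ≤ X := XJ_ge l
  have hL0 : 0 < Real.log q := by linarith
  have h1 : ∀ k, ‖DirichletCharacter.LFunction χ ⟨1 / 2 + 1 / Real.log q, t k⟩‖ ^ (a k) ≤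
      Real.exp (a k * ((SS χ X ⟨1/2+40/X, t k⟩).re + 110000*(Real.log q / X) + 3000*Real.log (2+|t k|))) := by
    intro k
    have h := log_L_le hχ hRH hX50 (show 0 < 1 / Real.log q by positivity) (by
      rw [div_le_div_iff₀ hL0 (by linarith)]; linarith) (t k)
    rw [mul_comm (a k), Real.exp_mul]
    exact Real.rpow_le_rpow (norm_nonneg _) h (ha k)
  have h2 : ∀ k, (SS χ X ⟨1/2+40/X, t k⟩).re ≤ K + (∑ p ∈ PX X \ PX 50, (c1 X (t k) p * χ p + c2 X (t k) p * χ p ^ 2)).re := by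
    intro k
    have h := (Complex.re_le_norm _).trans (hK q χ X (t k) hX50)
    rw [Complex.sub_re] at h; linarith
  have h3 : ∑ k, a k * (∑ p ∈ PX X \ PX 50, (c1 X (t k) p * χ p + c2 X (t k) p * χ p ^ 2)).re =
      ∑ i ∈ Finset.range l, YN (blk i) (cc a t X) (dd a t X) χ := by
    unfold YN
    rw [← Finset.sum_biUnion (blk_pairwise _), biUnion_blk, ← hX]
    simp only [Complex.re_sum, Finset.mul_sum]
    rw [Finset.sum_comm]
    refine Finset.sum_congr rfl fun p _ => ?_
    unfold cc dd
    rw [Finset.sum_mul, Finset.sum_mul, ← Finset.sum_add_distrib, Complex.re_sum]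
    refine Finset.sum_congr rfl fun k _ => ?_
    rw [mul_assoc, mul_assoc, ← mul_add, Complex.re_ofReal_mul]
  calc _ ≤ ∏ k, Real.exp (a k * ((SS χ X ⟨1/2+40/X, t k⟩).re + 110000*(Real.log q / X) + 3000*Real.log (2+|t k|))) :=
        Finset.prod_le_prod (fun k _ => by positivity) fun k _ => h1 k
    _ = Real.exp (∑ k, a k * ((SS χ X ⟨1/2+40/X, t k⟩).re + 110000*(Real.log q / X) + 3000*Real.log (2+|t k|))) := by rw [Real.exp_sum]
    _ ≤ Real.exp (∑ k, a k * ((K + (∑ p ∈ PX X \ PX 50, (c1 X (t k) p * χ p + c2 X (t k) p * χ p ^ 2)).re) + 110000*(Real.log q / X) + 3000*Real.log (2+|t k|))) := by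
        apply Real.exp_le_exp.2
        refine Finset.sum_le_sum fun k _ => mul_le_mul_of_nonneg_left ?_ (ha k)
        linarith [h2 k]
    _ = _ := by
        rw [← Real.exp_add, ← Real.exp_add]
        congr 1
        have e : 110000 * (∑ k, a k) * (Real.log q / X) = ∑ k, a k * (110000 * (Real.log q / X)) := by
          rw [← Finset.sum_mul]; ring
        rw [← h3, e, Finset.sum_mul, Finset.mul_sum, ← Finset.sum_add_distrib, ← Finset.sum_add_distrib, ← Finset.sum_add_distrib]
        refine Finset.sum_congr rfl fun k _ => ?_
        ring
end harper

/-! ### B8: the shifted moment bound, conclusion -/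

section harper
variable {ι : Type*} [Fintype ι]

/-- cut-off exponent of the bad blocks -/
noncomputable def mm (L : ℝ) (j : ℕ) : ℕ := ⌊nn L j ^ 4 / 32⌋₊

lemma prod_Psi {q : ℕ} (L : ℝ) (hL : 0 < L) (j : ℕ) (hj : 1100 ≤ nn L j) (y : ℕ → DirichletCharacter ℂ q → ℝ) (χ : DirichletCharacter ℂ q) :
    ∏ i ∈ Finset.range j, (Real.exp (2 / nn L i ^ 3) * EEr ⌈10 * nn L i ^ 3⌉₊ (y i χ / 2) ^ 2) ≤
    Real.exp 1 * ∏ i ∈ Finset.range j, EEr ⌈10 * nn L i ^ 3⌉₊ (y i χ / 2) ^ 2 := by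
  rw [Finset.prod_mul_distrib, ← Real.exp_sum]
  refine mul_le_mul_of_nonneg_right ?_ (Finset.prod_nonneg fun i _ => sq_nonneg _)
  apply Real.exp_le_exp.2
  have h1 : ∀ i ∈ Finset.range j, 2 / nn L i ^ 3 ≤ 2 * (1 / nn L i) := by
    intro i hi
    have hin : nn L j ≤ nn L i := nn_anti hL (Finset.mem_range.1 hi).le
    have h0 := nn_pos hL i
    rw [mul_one_div]
    gcongr
    calc nn L i = nn L i ^ 1 := (pow_one _).symm
      _ ≤ nn L i ^ 3 := pow_le_pow_right₀ (by linarith) (by norm_num)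
  refine (Finset.sum_le_sum h1).trans ?_
  rw [← Finset.mul_sum]
  have h2 := sum_inv_nn hL j
  have h3 : 6 / nn L j ≤ 1 / 2 := by rw [div_le_div_iff₀ (by linarith) (by norm_num)]; linarith
  linarith

lemma good_term (a t : ι → ℝ) (ha : ∀ k, 0 ≤ a k) {q : ℕ} [NeZero q] (hL : 0 < Real.log q) (j J : ℕ) (hjJ : j ≤ J)
    (hJ : 1100 ≤ nn (Real.log q) J) (m : ℕ) (hm : (m:ℝ) ≤ nn (Real.log q) j ^ 4 / 32) (l : ℕ) (hl : j < l) {μ : ℝ} (hμ : 0 < μ) {G : ℝ}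
    (hG : ∀ U ⊆ PX (XJ J), ∑ p ∈ U, (Real.exp (DM a p) * CM a t p ^ 2 / 4 + DM a p ^ 2 / 2) ≤ G) :
    ∑ χ : DirichletCharacter ℂ q, (∏ i ∈ Finset.range j, (Real.exp (2 / nn (Real.log q) i ^ 3) *
      EEr ⌈10 * nn (Real.log q) i ^ 3⌉₊ (YN (blk i) (cc a t (XJ j)) (dd a t (XJ j)) χ / 2) ^ 2)) *
      YN (blk j) (cc a t (XJ l)) (dd a t (XJ l)) χ ^ (2 * m) ≤
    Real.exp 1 * q.totient * Real.exp G * (2 * ((2 * m).factorial / μ ^ (2 * m)) * Real.exp (μ ^ 2 * (4 * (∑ k, a k) ^ 2))) := by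
  set L := Real.log q with hLdef
  have hq0 : (0:ℝ) < q := by exact_mod_cast NeZero.pos q
  have hj : 1100 ≤ nn L j := hJ.trans (nn_anti hL hjJ)
  have hD : ∀ p, 0 ≤ DM a p := fun p => by
    have : 0 ≤ ∑ k, a k := Finset.sum_nonneg fun k _ => ha k
    unfold DM; positivity
  have hin : ∀ i l, i < l → ∀ p ∈ blk i, p ∈ PX (XJ l) := by
    intro i l hil p hp
    have := mem_blk.1 hp
    exact mem_PX.2 ⟨this.1, this.2.2.trans (XJ_mono hil)⟩
  have hsq : ∀ i, ∀ p ∈ blk i, (p:ℝ) ^ 2 ≤ Real.exp (2 * XJ (i+1)) := by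
    intro i p hp
    have h := mem_blk.1 hp
    have hp0 : (0:ℝ) < p := by exact_mod_cast h.1.pos
    rw [← Real.exp_log (pow_pos hp0 2), Real.log_pow]
    apply Real.exp_le_exp.2
    push_cast; linarith [h.2.2]
  have hone : ∀ i, 1 ≤ Real.exp (2 * XJ (i+1)) := fun i => Real.one_le_exp (by linarith [XJ_pos (i+1)])
  have h := model_bound_nat (q := q) (Finset.range j) blk (blk_pairwise _) (blk j)
    (by
      rw [Finset.disjoint_biUnion_left]
      intro i hi
      exact blk_disj (Finset.mem_range.1 hi))
    (fun i _ p hp => (mem_blk.1 hp).1) (fun p hp => (mem_blk.1 hp).1) (CM a t) (DM a) hD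
    (fun _ => cc a t (XJ j)) (fun _ => dd a t (XJ j))
    (fun i hi p hp => norm_cc_le a t (XJ_pos j) (hin i j (Finset.mem_range.1 hi) p hp))
    (fun i hi p hp => norm_dd_le a t ha (XJ_pos j) (mem_blk.1 hp).1)
    (cc a t (XJ l)) (dd a t (XJ l))
    (fun p hp => norm_cc_le a t (XJ_pos l) (hin j l hl p hp))
    (fun p hp => norm_dd_le a t ha (XJ_pos l) (mem_blk.1 hp).1)
    (fun i => Real.exp (2 * XJ (i+1))) (fun i _ => hone i) (fun i _ p hp => hsq i p hp)
    (Real.exp (2 * XJ (j+1))) (hone j) (fun p hp => hsq j p hp)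
    (fun i => ⌈10 * nn L i ^ 3⌉₊) m
    ((len_le hL hj m hm).trans_eq (by rw [hLdef, Real.exp_log hq0])) hμ
  have h1 := hG ((Finset.range j).biUnion blk) (by
    rw [biUnion_blk]; exact Finset.sdiff_subset.trans (PX_mono (XJ_mono hjJ)))
  have h2 := blk_variance a t ha j
  calc _ ≤ ∑ χ : DirichletCharacter ℂ q, Real.exp 1 * ((∏ i ∈ Finset.range j,
      EEr ⌈10 * nn L i ^ 3⌉₊ (YN (blk i) (cc a t (XJ j)) (dd a t (XJ j)) χ / 2) ^ 2) *
      YN (blk j) (cc a t (XJ l)) (dd a t (XJ l)) χ ^ (2 * m)) := by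
        refine Finset.sum_le_sum fun χ _ => ?_
        rw [← mul_assoc]
        refine mul_le_mul_of_nonneg_right (prod_Psi L hL j hj (fun i χ => YN (blk i) (cc a t (XJ j)) (dd a t (XJ j)) χ) χ) ?_
        rw [pow_mul]; positivity
    _ ≤ _ := by
        rw [← Finset.mul_sum, mul_assoc (Real.exp 1), mul_assoc (Real.exp 1)]
        refine mul_le_mul_of_nonneg_left (h.trans ?_) (Real.exp_pos _).le
        rw [mul_assoc (q.totient : ℝ) (Real.exp G)]
        refine mul_le_mul_of_nonneg_left (a := (q.totient : ℝ)) ?_ (Nat.cast_nonneg _)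
        calc _ ≤ 2 * (((2 * m).factorial : ℝ) / μ ^ (2 * m)) * (Real.exp G * Real.exp (μ ^ 2 * (4 * (∑ k, a k) ^ 2))) := by
              gcongr
          _ = _ := by ring

set_option maxHeartbeats 2000000 in
theorem shifted_moment (a : ι → ℝ) (ha : ∀ k, 0 ≤ a k) : ∃ C : ℝ, 0 ≤ C ∧ ∃ q0 : ℕ, ∀ (q : ℕ) [NeZero q], q0 ≤ q →
    (∀ χ : DirichletCharacter ℂ q, dirichletRH χ) → ∀ (t : ι → ℝ) (R : Finset (DirichletCharacter ℂ q)), (1 : DirichletCharacter ℂ q) ∉ R →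
    ∑ χ ∈ R, ∏ k, ‖DirichletCharacter.LFunction χ ⟨1 / 2 + 1 / Real.log q, t k⟩‖ ^ (a k) ≤
      q.totient * Real.exp (C * (1 + ∑ k, Real.log (2 + |t k|)) + GE a t (Real.log q)) := by
  obtain ⟨K, hK0, hK⟩ := SS_decomp
  set A := ∑ k, a k with hA
  have hA0 : 0 ≤ A := Finset.sum_nonneg fun k _ => ha k
  set C1 := 110000 * A with hC1
  have hC10 : 0 ≤ C1 := by positivity
  set K0 := 2000 + Real.exp (4 * A ^ 2 + 64 * (C1 + 2)) with hK0def
  have hK02 : 2000 ≤ K0 := by have := Real.exp_pos (4 * A ^ 2 + 64 * (C1 + 2)); linarith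
  set Q := 2 * A ^ 2 + (Real.exp A * A ^ 3 + A ^ 2) with hQ
  have hQ0 : 0 ≤ Q := by positivity
  set R0 := 2 + (C1 * (2 * K0 ^ 4) + 4 * A ^ 2) + 1 with hR0
  set C := A * K + (3000 + A) * A + Q + R0 with hC
  have hC0 : 0 ≤ C := by positivity
  refine ⟨C, hC0, ⌈Real.exp (50 * K0 ^ 4)⌉₊, ?_⟩
  intro q _ hq hRH t R h1R
  set L := Real.log q with hLdef
  have hq0 : (0:ℝ) < q := by exact_mod_cast NeZero.pos q
  have hLK : 50 * K0 ^ 4 ≤ L := by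
    rw [hLdef, Real.le_log_iff_exp_le hq0]
    exact (Nat.le_ceil _).trans (by exact_mod_cast hq)
  have hK04 : 0 < K0 ^ 4 := by positivity
  have hL : 0 < L := lt_of_lt_of_le (by positivity) hLK
  obtain ⟨J, hJ1, hJ2⟩ := exists_nat_pow_near (x := L / (50 * K0 ^ 4)) (y := 2) (by rw [one_le_div (by positivity)]; exact hLK) (by norm_num)
  rw [le_div_iff₀ (by positivity)] at hJ1
  rw [div_lt_iff₀ (by positivity)] at hJ2
  have hXJ1 : XJ J * K0 ^ 4 ≤ L := by unfold XJ; linarith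
  have hXJ2 : L ≤ 2 * XJ J * K0 ^ 4 := by unfold XJ; rw [pow_succ] at hJ2; linarith
  have hnJ : K0 ≤ nn L J := by
    refine le_of_pow_le_pow_left₀ (n := 4) (by norm_num) (nn_pos hL J).le ?_
    rw [nn_pow hL, le_div_iff₀ (XJ_pos J)]; linarith
  have hnJ2 : nn L J ^ 4 ≤ 2 * K0 ^ 4 := by
    rw [nn_pow hL, div_le_iff₀ (XJ_pos J)]; linarith
  have hJ1100 : 1100 ≤ nn L J := by linarith
  have hXJL : XJ J ≤ L := by
    have : 1 ≤ K0 ^ 4 := one_le_pow₀ (by linarith)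
    have := XJ_pos J
    nlinarith
  set W := ∑ k, a k * Real.log (2 + |t k|) with hW
  set G := GE a t L + A * W + Q with hGdef
  have hG : ∀ U ⊆ PX (XJ J), ∑ p ∈ U, (Real.exp (DM a p) * CM a t p ^ 2 / 4 + DM a p ^ 2 / 2) ≤ G :=
    fun U hU => good_exponent a t ha (by linarith [XJ_ge J]) hXJL U hU
  set T := Real.exp (A * K + 3000 * W) with hT
  set Ψ : ℕ → ℝ → ℝ := fun i y => Real.exp (2 / nn L i ^ 3) * EEr ⌈10 * nn L i ^ 3⌉₊ (y / 2) ^ 2 with hΨ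
  have hΨ0 : ∀ i y, 0 ≤ Ψ i y := fun i y => by positivity
  set E : ℕ → ℝ := fun l => Real.exp (C1 * nn L l ^ 4) with hE
  set Y : ℕ → ℕ → DirichletCharacter ℂ q → ℝ := fun i l χ => YN (blk i) (cc a t (XJ l)) (dd a t (XJ l)) χ with hY
  have hpt : ∀ χ ∈ R, ∏ k, ‖DirichletCharacter.LFunction χ ⟨1 / 2 + 1 / L, t k⟩‖ ^ (a k) ≤
      T * (E J * ∏ i ∈ Finset.range J, Ψ i (Y i J χ) + ∑ j ∈ Finset.range J, ∑ l ∈ Finset.Ioc j J,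
      E j * (∏ i ∈ Finset.range j, Ψ i (Y i j χ)) * (Y j l χ / nn L j ^ 3) ^ (2 * mm L j)) := by
    intro χ hχ
    refine harper_combi J _ T (Real.exp_pos _).le (fun i l => Y i l χ) (fun i => nn L i ^ 3) E
      (fun i _ => pow_pos (nn_pos hL i) 3) (fun i => (Real.exp_pos _).le) Ψ hΨ0 ?_ (mm L) ?_
    · intro i hi y hy
      have : 1 ≤ nn L i := by have := nn_anti hL hi.le; linarith
      exact exp_le_EEr (one_le_pow₀ this) _ (Nat.le_ceil _) hy
    · intro l hl
      have h := pointwise_L a t ha hK χ (fun h => h1R (h ▸ hχ)) (hRH χ) l ((XJ_mono hl).trans hXJL)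
      rw [hE]
      simp only
      rw [nn_pow hL l]
      exact h
  have hpos : ∀ χ, 0 ≤ T * (E J * ∏ i ∈ Finset.range J, Ψ i (Y i J χ) + ∑ j ∈ Finset.range J, ∑ l ∈ Finset.Ioc j J,
      E j * (∏ i ∈ Finset.range j, Ψ i (Y i j χ)) * (Y j l χ / nn L j ^ 3) ^ (2 * mm L j)) := by
    intro χ
    refine mul_nonneg (Real.exp_pos _).le (add_nonneg (mul_nonneg (Real.exp_pos _).le (Finset.prod_nonneg fun i _ => hΨ0 _ _)) ?_)
    refine Finset.sum_nonneg fun j _ => Finset.sum_nonneg fun l _ => ?_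
    refine mul_nonneg (mul_nonneg (Real.exp_pos _).le (Finset.prod_nonneg fun i _ => hΨ0 _ _)) ?_
    rw [pow_mul]; positivity
  have hstep1 : ∑ χ ∈ R, ∏ k, ‖DirichletCharacter.LFunction χ ⟨1 / 2 + 1 / L, t k⟩‖ ^ (a k) ≤
      ∑ χ : DirichletCharacter ℂ q, T * (E J * ∏ i ∈ Finset.range J, Ψ i (Y i J χ) + ∑ j ∈ Finset.range J, ∑ l ∈ Finset.Ioc j J,
      E j * (∏ i ∈ Finset.range j, Ψ i (Y i j χ)) * (Y j l χ / nn L j ^ 3) ^ (2 * mm L j)) :=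
    (Finset.sum_le_sum hpt).trans (Finset.sum_le_sum_of_subset_of_nonneg (Finset.subset_univ _) fun χ _ _ => hpos χ)
  have hstep2 : ∑ χ : DirichletCharacter ℂ q, T * (E J * ∏ i ∈ Finset.range J, Ψ i (Y i J χ) + ∑ j ∈ Finset.range J, ∑ l ∈ Finset.Ioc j J,
      E j * (∏ i ∈ Finset.range j, Ψ i (Y i j χ)) * (Y j l χ / nn L j ^ 3) ^ (2 * mm L j)) =
      T * (E J * ∑ χ : DirichletCharacter ℂ q, ∏ i ∈ Finset.range J, Ψ i (Y i J χ) + ∑ j ∈ Finset.range J, ∑ l ∈ Finset.Ioc j J,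
      E j / (nn L j ^ 3) ^ (2 * mm L j) * ∑ χ : DirichletCharacter ℂ q, (∏ i ∈ Finset.range j, Ψ i (Y i j χ)) * Y j l χ ^ (2 * mm L j)) := by
    rw [← Finset.mul_sum, Finset.sum_add_distrib, ← Finset.mul_sum]
    congr 2
    rw [Finset.sum_comm]
    refine Finset.sum_congr rfl fun j _ => ?_
    rw [Finset.sum_comm]
    refine Finset.sum_congr rfl fun l _ => ?_
    rw [Finset.mul_sum]
    refine Finset.sum_congr rfl fun χ _ => ?_
    rw [div_pow]; ring
  set H := Real.exp 1 * q.totient * Real.exp G with hH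
  have hH0 : 0 ≤ H := by positivity
  have hgood : ∑ χ : DirichletCharacter ℂ q, ∏ i ∈ Finset.range J, Ψ i (Y i J χ) ≤ H * 2 * Real.exp (4 * A ^ 2) := by
    have h := good_term a t ha hL J J le_rfl hJ1100 0 (by have := nn_pos hL J; simp only [Nat.cast_zero]; positivity) (J+1) (by omega) (μ := 1) one_pos hG
    simp only [mul_zero, pow_zero, mul_one, Nat.factorial_zero, Nat.cast_one, div_one, one_pow, one_mul, ← mul_assoc] at h
    exact h
  have hbad : ∀ j ∈ Finset.range J, ∑ l ∈ Finset.Ioc j J,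
      E j / (nn L j ^ 3) ^ (2 * mm L j) * ∑ χ : DirichletCharacter ℂ q, (∏ i ∈ Finset.range j, Ψ i (Y i j χ)) * Y j l χ ^ (2 * mm L j) ≤
      H * (1 / nn L j) := by
    intro j hj
    have hjJ := Finset.mem_range.1 hj
    have hnj : K0 ≤ nn L j := hnJ.trans (nn_anti hL hjJ.le)
    have hn0 := nn_pos hL j
    have hmm : (mm L j : ℝ) ≤ nn L j ^ 4 / 32 := Nat.floor_le (by positivity)
    have hmpos : 0 < mm L j := by
      apply Nat.floor_pos.2
      have : (4:ℝ) ^ 4 ≤ nn L j ^ 4 := by gcongr; linarith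
      linarith
    have hmu : 0 < √(mm L j : ℝ) := Real.sqrt_pos.2 (by exact_mod_cast hmpos)
    set Z := 2 * (((2 * mm L j).factorial : ℝ) / √(mm L j : ℝ) ^ (2 * mm L j)) * Real.exp (√(mm L j : ℝ) ^ 2 * (4 * A ^ 2)) with hZ
    have hb : ∀ l ∈ Finset.Ioc j J, E j / (nn L j ^ 3) ^ (2 * mm L j) * ∑ χ : DirichletCharacter ℂ q, (∏ i ∈ Finset.range j, Ψ i (Y i j χ)) * Y j l χ ^ (2 * mm L j) ≤
        E j / (nn L j ^ 3) ^ (2 * mm L j) * (H * Z) := by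
      intro l hl
      refine mul_le_mul_of_nonneg_left ?_ (by positivity)
      exact good_term a t ha hL j J hjJ.le hJ1100 (mm L j) hmm l (Finset.mem_Ioc.1 hl).1 hmu hG
    refine (Finset.sum_le_sum hb).trans ?_
    rw [Finset.sum_const, nsmul_eq_mul]
    have hcard := card_le_nn hL hjJ (by linarith)
    have hbn := bad_num (C1 := C1) (K := 4 * A ^ 2) (n := nn L j) hC10 (by linarith) (by
      have : Real.exp (4 * A ^ 2 + 64 * (C1 + 2)) ≤ nn L j := by linarith
      nlinarith) (mm L j) rfl
    calc _ ≤ nn L j ^ 4 * (E j / (nn L j ^ 3) ^ (2 * mm L j) * (H * Z)) := by gcongr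
      _ = H * (nn L j ^ 4 * Real.exp (C1 * nn L j ^ 4) * Z / (nn L j ^ 3) ^ (2 * mm L j)) := by rw [hE]; ring
      _ ≤ _ := by gcongr
  have hEJ : E J ≤ Real.exp (C1 * (2 * K0 ^ 4)) := by
    apply Real.exp_le_exp.2; gcongr
  have hsum : ∑ j ∈ Finset.range J, H * (1 / nn L j) ≤ H := by
    rw [← Finset.mul_sum]
    refine mul_le_of_le_one_right hH0 ((sum_inv_nn hL J).trans ?_)
    rw [div_le_one (by linarith)]; linarith
  have hfin : T * (Real.exp (C1 * (2 * K0 ^ 4)) * (H * 2 * Real.exp (4 * A ^ 2)) + H) ≤ q.totient * Real.exp (C * (1 + ∑ k, Real.log (2 + |t k|)) + GE a t L) := by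
    have h1 : Real.exp (C1 * (2 * K0 ^ 4)) * (H * 2 * Real.exp (4 * A ^ 2)) + H ≤ q.totient * (Real.exp R0 * Real.exp G) := by
      set Z1 := Real.exp (C1 * (2 * K0 ^ 4)) with hZ1
      set Z2 := Real.exp (4 * A ^ 2) with hZ2
      have e1 : 1 ≤ Z1 := Real.one_le_exp (by positivity)
      have e1' : 1 ≤ Z2 := Real.one_le_exp (by positivity)
      have e2 : (3:ℝ) ≤ Real.exp 2 := by linarith [Real.add_one_le_exp (2:ℝ)]
      have e3 : Real.exp R0 = Real.exp 2 * (Z1 * Z2) * Real.exp 1 := by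
        rw [hR0, Real.exp_add, Real.exp_add, Real.exp_add]
      have e4 : 1 ≤ Z1 * Z2 := by nlinarith
      calc _ ≤ Z1 * (H * 2 * Z2) + (Z1 * Z2) * H := by
            gcongr; exact le_mul_of_one_le_left hH0 e4
        _ = 3 * (Z1 * Z2) * H := by ring
        _ ≤ Real.exp 2 * (Z1 * Z2) * H := by gcongr
        _ = _ := by rw [e3, hH]; ring
    calc _ ≤ T * (q.totient * (Real.exp R0 * Real.exp G)) := by gcongr
      _ = q.totient * Real.exp (A * K + 3000 * W + (R0 + G)) := by
        rw [Real.exp_add (A * K + 3000 * W), Real.exp_add R0]; ring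
      _ ≤ _ := by
        refine mul_le_mul_of_nonneg_left (Real.exp_le_exp.2 ?_) (Nat.cast_nonneg _)
        set S := ∑ k, Real.log (2 + |t k|) with hS
        have hlog : ∀ k, 0 ≤ Real.log (2 + |t k|) := fun k => Real.log_nonneg (by linarith [abs_nonneg (t k)])
        have hWS : W ≤ A * S := by
          rw [hW, hS, Finset.mul_sum]
          refine Finset.sum_le_sum fun k _ => mul_le_mul_of_nonneg_right ?_ (hlog k)
          exact Finset.single_le_sum (f := a) (fun i _ => ha i) (Finset.mem_univ k)
        have hS0 : 0 ≤ S := Finset.sum_nonneg fun k _ => hlog k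
        have h5 : (3000 + A) * W ≤ (3000 + A) * (A * S) := by gcongr
        have h6 : 0 ≤ (A * K + Q + R0) * S := by positivity
        have h7 : 0 ≤ (3000 + A) * A := by positivity
        rw [hGdef, hC]
        nlinarith
  calc _ ≤ _ := hstep1
    _ = _ := hstep2
    _ ≤ T * (Real.exp (C1 * (2 * K0 ^ 4)) * (H * 2 * Real.exp (4 * A ^ 2)) + H) := by
      gcongr
      exact (Finset.sum_le_sum hbad).trans hsum
    _ ≤ _ := hfin
end harper

open MeasureTheory

lemma norm_Gamma_le_Gamma_re {z : ℂ} (hz : 0 < z.re) : ‖Complex.Gamma z‖ ≤ Real.Gamma z.re := by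
  rw [Complex.Gamma_eq_integral hz, Real.Gamma_eq_integral hz, Complex.GammaIntegral]
  refine (norm_integral_le_integral_norm _).trans (le_of_eq ?_)
  refine setIntegral_congr_fun measurableSet_Ioi fun x hx => ?_
  simp only [norm_mul, Complex.norm_real, Real.norm_eq_abs, abs_of_pos (Real.exp_pos _)]
  rw [Complex.norm_cpow_eq_rpow_re_of_pos hx]
  simp

lemma Gamma_decay_aux (m : ℕ) : ∀ z : ℂ, 1 / 2 ≤ z.re →
    ‖Complex.Gamma z‖ * (1 + z.im ^ 2) ^ m ≤ 4 ^ m * Real.Gamma (z.re + 2 * m) := by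
  induction m with
  | zero =>
    intro z hz
    simpa using norm_Gamma_le_Gamma_re (by linarith)
  | succ m ih =>
    intro z hz
    have h := ih (z + 2) (by simp; linarith)
    have hz0 : z ≠ 0 := by rintro rfl; norm_num at hz
    have hz1 : z + 1 ≠ 0 := by
      intro h
      have := congrArg Complex.re h
      simp at this; linarith
    have e : Complex.Gamma (z + 2) = (z + 1) * (z * Complex.Gamma z) := by
      rw [← Complex.Gamma_add_one z hz0, ← Complex.Gamma_add_one _ hz1]; congr 1; ring
    have n1 : (1 + z.im ^ 2) / 4 ≤ ‖z‖ ^ 2 := by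
      rw [Complex.sq_norm, Complex.normSq_apply]; nlinarith
    have n2 : ‖z‖ ^ 2 ≤ ‖z + 1‖ ^ 2 := by
      simp only [Complex.sq_norm, Complex.normSq_apply]; simp; nlinarith
    have n3 : ‖z‖ ≤ ‖z + 1‖ := by
      exact (sq_le_sq₀ (norm_nonneg _) (norm_nonneg _)).1 n2
    have n4 : (1 + z.im ^ 2) / 4 ≤ ‖z + 1‖ * ‖z‖ := by nlinarith [norm_nonneg z]
    rw [e] at h
    simp only [norm_mul, Complex.add_im, Complex.add_re] at h
    have e2 : z.re + (2 : ℂ).re + 2 * (m : ℝ) = z.re + 2 * ((m + 1 : ℕ) : ℝ) := by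
      push_cast; norm_num; ring
    have e3 : z.im + (2 : ℂ).im = z.im := by norm_num
    rw [e2, e3] at h
    have h0 : 0 ≤ ‖Complex.Gamma z‖ * (1 + z.im ^ 2) ^ m := by positivity
    calc _ = 4 * ((1 + z.im ^ 2) / 4 * (‖Complex.Gamma z‖ * (1 + z.im ^ 2) ^ m)) := by ring
      _ ≤ 4 * (‖z + 1‖ * ‖z‖ * (‖Complex.Gamma z‖ * (1 + z.im ^ 2) ^ m)) := by gcongr
      _ = 4 * (‖z + 1‖ * (‖z‖ * ‖Complex.Gamma z‖) * (1 + z.im ^ 2) ^ m) := by ring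
      _ ≤ 4 * (4 ^ m * Real.Gamma (z.re + 2 * ((m + 1 : ℕ) : ℝ))) := by gcongr
      _ = _ := by ring

lemma Gamma_decay (m : ℕ) (hm : 1 ≤ m) {z : ℂ} (h1 : 1 / 2 ≤ z.re) (h2 : z.re ≤ 2) :
    ‖Complex.Gamma z‖ ≤ 4 ^ m * (2 * m + 1).factorial * ((1 + z.im ^ 2) ^ m)⁻¹ := by
  have hp : (0:ℝ) < (1 + z.im ^ 2) ^ m := by positivity
  rw [← div_eq_mul_inv, le_div_iff₀ hp]
  refine (Gamma_decay_aux m z h1).trans ?_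
  have hm' : (1:ℝ) ≤ m := by exact_mod_cast hm
  gcongr
  have := Real.Gamma_strictMonoOn_Ici.monotoneOn (a := z.re + 2 * m) (b := 2 + 2 * m)
    (by simp; linarith) (by simp) (by linarith)
  refine this.trans (le_of_eq ?_)
  rw [← Real.Gamma_nat_eq_factorial]
  congr 1; push_cast; ring

lemma Gamma_vertical_integrable {c : ℝ} (h1 : 1 / 2 ≤ c) (h2 : c ≤ 2) :
    Integrable fun v : ℝ => Complex.Gamma (c + v * I) := by
  have hc : Continuous fun v : ℝ => Complex.Gamma (c + v * I) := by
    refine continuous_iff_continuousAt.2 fun v => ?_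
    refine ContinuousAt.comp (f := fun v : ℝ => (c + v * I : ℂ)) (g := Complex.Gamma) ?_ (by fun_prop)
    refine (Complex.differentiableAt_Gamma _ fun m h => ?_).continuousAt
    have := congrArg Complex.re h
    simp at this
    have : (0:ℝ) ≤ m := Nat.cast_nonneg m
    linarith
  refine ((integrable_inv_one_add_sq).const_mul (4 ^ 1 * ((2 * 1 + 1).factorial : ℝ))).mono'
    hc.aestronglyMeasurable (Filter.Eventually.of_forall fun v => ?_)
  have := Gamma_decay 1 le_rfl (z := c + v * I) (by simpa using h1) (by simpa using h2)
  simpa using this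

lemma exp_eq_mellin {x : ℝ} (hx : 0 < x) :
    (1 / (2 * π) : ℂ) * ∫ v : ℝ, (x : ℂ) ^ (-(2 + v * I)) * Complex.Gamma (2 + v * I)
      = Complex.exp (-x) := by
  set f : ℝ → ℂ := fun x => ((Real.exp (-x) : ℝ) : ℂ) with hf
  have hG : ∀ v : ℝ, mellin f (2 + v * I) = Complex.Gamma (2 + v * I) := by
    intro v
    rw [Complex.Gamma_eq_integral (by simp), Complex.GammaIntegral_eq_mellin]
  have h := mellinInv_mellin_eq 2 f hx ?_ ?_ ?_
  · rw [mellinInv] at h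
    simp only [Complex.ofReal_ofNat, hG, smul_eq_mul] at h
    rw [Complex.real_smul] at h
    simp only [hf] at h
    push_cast at h
    exact h
  · have := Complex.GammaIntegral_convergent (s := 2) (by simp)
    rw [MellinConvergent]
    refine this.congr_fun (fun x _ => ?_) measurableSet_Ioi
    simp [hf, mul_comm]
  · have := Gamma_vertical_integrable (c := 2) (by norm_num) le_rfl
    rw [Complex.VerticalIntegrable]
    refine this.congr (Filter.Eventually.of_forall fun v => ?_)
    simp [hG]
  · simp only [hf]; fun_prop

open MeasureTheory

/-- The integrand in the Mellin representation of the theta function. -/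
noncomputable def thH {q : ℕ} [NeZero q] (χ : DirichletCharacter ℂ q) (z : ℂ) : ℂ :=
  Complex.Gamma z * Complex.exp (Real.log (q / π) * z) * DirichletCharacter.LFunction χ (2 * z - 1)

lemma odd_ne_one {q : ℕ} {χ : DirichletCharacter ℂ q} (h : χ (-1) = -1) : χ ≠ 1 := by
  rintro rfl
  rw [MulChar.one_apply (by simp)] at h
  norm_num at h

lemma theta_eq_integral {q : ℕ} [NeZero q] {χ : DirichletCharacter ℂ q} (hodd : χ (-1) = -1) :
    dirichletTheta χ 1 = (1 / (2 * π) : ℂ) * ∫ v : ℝ, thH χ ((2 : ℝ) + v * I) := by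
  have hq : (0:ℝ) < q := by exact_mod_cast Nat.pos_of_ne_zero (NeZero.ne q)
  have hπ := Real.pi_pos
  set M : ℝ → ℂ := fun v => Complex.Gamma ((2 : ℝ) + v * I) *
    Complex.exp (Real.log (q / π) * ((2 : ℝ) + v * I)) with hM
  set F : ℕ → ℝ → ℂ := fun n v => M v * LSeries.term (fun n => χ n) (2 * ((2 : ℝ) + v * I) - 1) n with hF
  have hFeq : ∀ n : ℕ, n ≠ 0 → ∀ v : ℝ, F n v = (χ n * n) *
      (((π * n ^ 2 / q : ℝ) : ℂ) ^ (-(2 + v * I)) * Complex.Gamma (2 + v * I)) := by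
    intro n hn v
    have hn0 : (n:ℂ) ≠ 0 := by exact_mod_cast hn
    have hnp : (0:ℝ) < n := by exact_mod_cast Nat.pos_of_ne_zero hn
    have hx : (0:ℝ) < π * n ^ 2 / q := by positivity
    simp only [hF, hM]
    rw [LSeries.term_of_ne_zero hn, div_eq_mul_inv (χ n), ← Complex.cpow_neg,
      Complex.cpow_def_of_ne_zero hn0, Complex.cpow_def_of_ne_zero (by exact_mod_cast hx.ne'),
      ← Complex.ofReal_log hx.le, ← Complex.natCast_log]
    have hl : Real.log (π * n ^ 2 / q) = 2 * Real.log n - Real.log (q / π) := by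
      rw [Real.log_div (by positivity) hq.ne', Real.log_mul hπ.ne' (by positivity),
        Real.log_pow, Real.log_div hq.ne' hπ.ne']; push_cast; ring
    rw [hl]
    have hn1 : (n:ℂ) = Complex.exp (Real.log n) := by
      rw [← Complex.ofReal_exp, Real.exp_log hnp]; simp
    have : Complex.exp (Real.log (q / π) * ((2 : ℝ) + v * I)) *
        Complex.exp (Real.log n * -(2 * ((2 : ℝ) + v * I) - 1)) =
        Complex.exp (Real.log n) *
        Complex.exp (((2 * Real.log n - Real.log (q / π) : ℝ) : ℂ) * -(2 + v * I)) := by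
      rw [← Complex.exp_add, ← Complex.exp_add]; congr 1; push_cast; ring
    rw [← hn1] at this
    push_cast at this ⊢
    linear_combination (Complex.Gamma (2 + v * I) * χ n) * this
  have hF0 : ∀ v, F 0 v = 0 := by intro v; simp [hF]
  have hMi : Integrable M := by
    have h := Gamma_vertical_integrable (c := 2) (by norm_num) le_rfl
    refine h.mul_bdd (c := Real.exp (Real.log (q / π) * 2)) ?_ ?_
    · apply Continuous.aestronglyMeasurable; fun_prop
    · refine Filter.Eventually.of_forall fun v => ?_
      rw [Complex.norm_exp]; simp
  have hFn : ∀ n v, ‖F n v‖ ≤ 1 / (n:ℝ) ^ 3 * ‖M v‖ := by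
    intro n v
    rcases eq_or_ne n 0 with rfl | hn
    · simp [hF0]
    · simp only [hF]
      rw [norm_mul, mul_comm]
      refine mul_le_mul_of_nonneg_right ?_ (norm_nonneg _)
      rw [LSeries.term_of_ne_zero hn, norm_div, Complex.norm_natCast_cpow_of_pos (Nat.pos_of_ne_zero hn)]
      apply div_le_div₀ zero_le_one (χ.norm_le_one _) (by have := Nat.pos_of_ne_zero hn; positivity)
      have h1 : (1:ℝ) ≤ n := by exact_mod_cast Nat.pos_of_ne_zero hn
      rw [← Real.rpow_natCast]
      apply Real.rpow_le_rpow_of_exponent_le h1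
      simp; norm_num
  have hFi : ∀ n, Integrable (F n) := by
    intro n
    refine (hMi.norm.const_mul (1 / (n:ℝ) ^ 3)).mono' ?_ (Filter.Eventually.of_forall (hFn n))
    rcases eq_or_ne n 0 with rfl | hn
    · rw [show F 0 = fun _ => 0 from funext hF0]; exact aestronglyMeasurable_const
    · refine hMi.1.mul (Continuous.aestronglyMeasurable ?_)
      have hn0 : (n:ℂ) ≠ 0 := by exact_mod_cast hn
      simp only [LSeries.term_of_ne_zero hn]
      refine continuous_const.div ?_ fun v => ?_
      · exact Continuous.const_cpow (by fun_prop) (Or.inl hn0)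
      · simp [Complex.cpow_eq_zero_iff, hn0]
  have hmain := integral_tsum_of_summable_integral_norm (F := F) hFi (by
    refine Summable.of_nonneg_of_le (fun n => integral_nonneg fun v => norm_nonneg _) (fun n => ?_)
      ((Real.summable_one_div_nat_pow.2 (by norm_num : 1 < 3)).mul_right (∫ v, ‖M v‖))
    rw [← integral_const_mul]
    exact integral_mono (hFi n).norm (hMi.norm.const_mul _) fun v => hFn n v)
  have hL : ∀ v : ℝ, ∑' n, F n v = thH χ ((2:ℝ) + v * I) := by
    intro v
    simp only [hF]
    rw [tsum_mul_left, thH, DirichletCharacter.LFunction_eq_LSeries _ (by simp; norm_num)]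
    rfl
  simp_rw [hL] at hmain
  rw [← hmain, ← tsum_mul_left, dirichletTheta]
  refine tsum_congr fun n => ?_
  have hne : ¬ ((-1 : ℂ) = 1) := by norm_num
  rw [hodd, if_neg hne, pow_one]
  rcases eq_or_ne n 0 with rfl | hn
  · simp [hF0]
  · have hnp : (0:ℝ) < n := by exact_mod_cast Nat.pos_of_ne_zero hn
    have hx : (0:ℝ) < π * n ^ 2 / q := by positivity
    rw [show F n = _ from funext (hFeq n hn), integral_const_mul]
    have := exp_eq_mellin hx
    rw [mul_left_comm, this]
    push_cast
    congr 2; ring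

theorem theta_bound (N : ℕ) (hN : 1 ≤ N) : ∃ K : ℝ, 0 < K ∧ ∀ (q : ℕ) [NeZero q], 3 ≤ q →
    ∀ χ : DirichletCharacter ℂ q, χ (-1) = -1 →
    ENNReal.ofReal ‖dirichletTheta χ 1‖ ≤ ENNReal.ofReal (K * (q:ℝ) ^ (3 / 4 : ℝ)) *
      ∫⁻ t : ℝ, ENNReal.ofReal (‖DirichletCharacter.LFunction χ ⟨1 / 2 + 1 / Real.log q, t⟩‖ *
        ((1 + t ^ 2) ^ N)⁻¹) := by
  set G : ℝ := 4 ^ N * (2 * N + 1).factorial with hG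
  have hG0 : 0 < G := by positivity
  refine ⟨G * 4 ^ N * Real.exp (1 / 2), by positivity, fun q _ hq χ hodd => ?_⟩
  have hχ := odd_ne_one hodd
  have hq3 : (3:ℝ) ≤ q := by exact_mod_cast hq
  have hq0 : (0:ℝ) < q := by linarith
  have hπ := Real.pi_pos
  set L := Real.log q with hL
  have hL1 : 1 ≤ L := by
    rw [hL, Real.le_log_iff_exp_le hq0]
    linarith [Real.exp_one_lt_d9]
  have hL0 : 0 < L := by linarith
  have hLi : 0 < 1 / L := by positivity
  have hLi1 : 1 / L ≤ 1 := by rw [div_le_one hL0]; exact hL1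
  set c : ℝ := 3 / 4 + 1 / (2 * L) with hc
  have hc' : c = 3 / 4 + (1 / L) / 2 := by rw [hc]; field_simp
  have hshift := (vertical_shift (H := thH χ) (c := c) (d := 2)
    (B := 4 ^ 2 * (2 * 2 + 1).factorial * Real.exp (|Real.log (q / π)| * 2) * (q * 12))
    (U := {z : ℂ | 0 < z.re}) (by linarith) (fun z hz => by
      have := hz.1; simp only [Set.mem_ofPred_eq]; linarith) ?_ ?_).2
  · rw [theta_eq_integral hodd, ← hshift]
    have e : ∫ v : ℝ, thH χ (c + v * I) = (1 / 2 : ℂ) * ∫ t : ℝ, thH χ (c + (t / 2 : ℝ) * I) := by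
      have := Measure.integral_comp_mul_left (fun t : ℝ => thH χ (c + (t / 2 : ℝ) * I)) 2
      rw [Complex.real_smul] at this
      norm_num at this ⊢
      exact this
    rw [e, norm_mul, norm_mul, ← mul_assoc, ENNReal.ofReal_mul (by positivity), ofReal_norm (E := ℂ)]
    refine (mul_le_mul_right (enorm_integral_le_lintegral_enorm _) _).trans ?_
    have h1 : ENNReal.ofReal (‖(1 / (2 * π) : ℂ)‖ * ‖(1 / 2 : ℂ)‖) ≤ 1 := by
      rw [ENNReal.ofReal_le_one]
      have h1 : ‖(1 / (2 * π) : ℂ)‖ = 1 / (2 * π) := by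
        rw [norm_div, norm_mul, Complex.norm_real, Real.norm_of_nonneg hπ.le]; simp
      have h2 : ‖(1 / 2 : ℂ)‖ = 1 / 2 := by simp
      rw [h1, h2]
      have : 1 / (2 * π) ≤ 1 := by
        rw [div_le_one (by positivity)]; linarith [Real.pi_gt_three]
      linarith
    refine (mul_le_mul_left h1 _).trans ?_
    rw [one_mul, ← lintegral_const_mul' _ _ ENNReal.ofReal_ne_top]
    refine lintegral_mono fun t => ?_
    rw [← ofReal_norm, ← ENNReal.ofReal_mul (by positivity)]
    refine ENNReal.ofReal_le_ofReal ?_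
    rw [thH, norm_mul, norm_mul, Complex.norm_exp]
    have hs : (2 * (c + (t / 2 : ℝ) * I) - 1 : ℂ) = ⟨1 / 2 + 1 / L, t⟩ := by
      apply Complex.ext
      · simp [hc']; ring
      · simp; ring
    rw [hs]
    have g1 := Gamma_decay N hN (z := c + (t / 2 : ℝ) * I) (by simp; linarith) (by simp; linarith)
    have g2 : ((1 + (c + (t / 2 : ℝ) * I : ℂ).im ^ 2) ^ N)⁻¹ ≤ 4 ^ N * ((1 + t ^ 2) ^ N)⁻¹ := by
      have : (1 + t ^ 2) ^ N ≤ 4 ^ N * (1 + (t / 2) ^ 2) ^ N := by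
        rw [← mul_pow]; gcongr; nlinarith [sq_nonneg t]
      simp
      rw [inv_eq_one_div, ← div_eq_mul_inv, div_le_div_iff₀ (by positivity) (by positivity), one_mul]
      simpa using this
    have g3 : Real.exp ((Real.log (q / π) * (c + (t / 2 : ℝ) * I) : ℂ).re) ≤
        Real.exp (1 / 2) * (q:ℝ) ^ (3 / 4 : ℝ) := by
      rw [Real.rpow_def_of_pos hq0, ← Real.exp_add]
      refine Real.exp_le_exp.2 ?_
      have h1 : Real.log (q / π) ≤ L := by
        refine Real.log_le_log (by positivity) ?_
        exact div_le_self hq0.le (by linarith [Real.pi_gt_three])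
      have h2 : (Real.log (q / π) * (c + (t / 2 : ℝ) * I) : ℂ).re = Real.log (q / π) * c := by
        rw [Complex.re_ofReal_mul]; simp
      rw [h2, ← hL]
      calc _ ≤ L * c := by gcongr
        _ = _ := by rw [hc]; field_simp; ring
    calc _ ≤ (G * (4 ^ N * ((1 + t ^ 2) ^ N)⁻¹)) * (Real.exp (1 / 2) * (q:ℝ) ^ (3 / 4 : ℝ)) *
          ‖DirichletCharacter.LFunction χ ⟨1 / 2 + 1 / L, t⟩‖ := by
          gcongr
          exact g1.trans (by rw [← hG]; gcongr)
      _ = _ := by ring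
  · intro z hz
    have hz' : 0 < z.re := hz
    refine DifferentiableAt.differentiableWithinAt ?_
    unfold thH
    refine ((Complex.differentiableAt_Gamma _ fun m h => ?_).mul (by fun_prop)).mul ?_
    · have := congrArg Complex.re h
      simp at this
      have : (0:ℝ) ≤ m := Nat.cast_nonneg m
      linarith
    · exact ((DirichletCharacter.differentiable_LFunction hχ).comp (f := fun z : ℂ => 2 * z - 1)
        (by fun_prop)) z
  · intro z h1 h2
    have g1 := Gamma_decay 2 (by norm_num) (z := z) (by linarith) h2
    have hre : (2 * z - 1).re = 2 * z.re - 1 := by simp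
    have g2 := LFunction_bound hχ (s := 2 * z - 1) (by rw [hre]; linarith)
    have hr : 1 / 2 ≤ (2 * z - 1).re := by rw [hre]; linarith
    have g3 : ‖2 * z - 1‖ ≤ 6 * (1 + z.im ^ 2) := by
      have a1 := norm_sub_le (2 * z) 1
      have a2 := Complex.norm_le_abs_re_add_abs_im z
      rw [norm_mul] at a1
      rw [abs_of_nonneg (by linarith)] at a2
      simp at a1
      nlinarith [sq_nonneg (|z.im| - 1), sq_abs z.im, sq_nonneg z.im]
    have g4 : (q:ℝ) * ‖2 * z - 1‖ / (2 * z - 1).re ≤ q * 12 * (1 + z.im ^ 2) := by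
      rw [div_le_iff₀ (by linarith)]
      calc _ ≤ (q:ℝ) * (6 * (1 + z.im ^ 2)) := by gcongr
        _ = q * 12 * (1 + z.im ^ 2) * (1 / 2) := by ring
        _ ≤ _ := by gcongr
    rw [thH, norm_mul, norm_mul, Complex.norm_exp]
    have g5 : Real.exp ((Real.log (q / π) * z : ℂ).re) ≤ Real.exp (|Real.log (q / π)| * 2) := by
      refine Real.exp_le_exp.2 ?_
      rw [Complex.re_ofReal_mul]
      have := le_abs_self (Real.log (q / π))
      have h0 : 0 ≤ z.re := by linarith
      calc _ ≤ |Real.log (q / π)| * z.re := by gcongr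
        _ ≤ _ := by gcongr
    calc _ ≤ (4 ^ 2 * (2 * 2 + 1).factorial * ((1 + z.im ^ 2) ^ 2)⁻¹) *
          Real.exp (|Real.log (q / π)| * 2) * (q * 12 * (1 + z.im ^ 2)) := by
          gcongr
          exact g2.trans g4
      _ = _ := by field_simp

open MeasureTheory

section starint
variable {k : ℝ → ENNReal}

lemma star_t (hk : Measurable k) (t : ℝ) :
    ∫⁻ u : ℝ, ∫⁻ v : ℝ, ∫⁻ w : ℝ, k (t - u) * k (t - v) * k (t - w) = (∫⁻ x : ℝ, k x) ^ 3 := by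
  have h : ∀ c : ℝ, ∫⁻ w : ℝ, k (c - w) = ∫⁻ x : ℝ, k x := fun c => lintegral_sub_left_eq_self k c
  have e1 : ∀ u v : ℝ, ∫⁻ w : ℝ, k (t - u) * k (t - v) * k (t - w) = k (t - u) * k (t - v) * ∫⁻ x : ℝ, k x := by
    intro u v; rw [lintegral_const_mul _ (by fun_prop), h]
  simp_rw [e1]
  have e2 : ∀ u : ℝ, ∫⁻ v : ℝ, k (t - u) * k (t - v) * ∫⁻ x : ℝ, k x
      = k (t - u) * ((∫⁻ x : ℝ, k x) * ∫⁻ x : ℝ, k x) := by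
    intro u; rw [lintegral_mul_const _ (by fun_prop), lintegral_const_mul _ (by fun_prop), h, mul_assoc]
  simp_rw [e2]
  rw [lintegral_mul_const _ (by fun_prop), h]; ring

lemma star_u (hk : Measurable k) (t : ℝ) :
    ∫⁻ u : ℝ, ∫⁻ v : ℝ, ∫⁻ w : ℝ, k (t - u) * k (u - v) * k (u - w) = (∫⁻ x : ℝ, k x) ^ 3 := by
  have h : ∀ c : ℝ, ∫⁻ w : ℝ, k (c - w) = ∫⁻ x : ℝ, k x := fun c => lintegral_sub_left_eq_self k c
  have e1 : ∀ u v : ℝ, ∫⁻ w : ℝ, k (t - u) * k (u - v) * k (u - w) = k (t - u) * k (u - v) * ∫⁻ x : ℝ, k x := by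
    intro u v; rw [lintegral_const_mul _ (by fun_prop), h]
  simp_rw [e1]
  have e2 : ∀ u : ℝ, ∫⁻ v : ℝ, k (t - u) * k (u - v) * ∫⁻ x : ℝ, k x
      = k (t - u) * ((∫⁻ x : ℝ, k x) * ∫⁻ x : ℝ, k x) := by
    intro u; rw [lintegral_mul_const _ (by fun_prop), lintegral_const_mul _ (by fun_prop), h, mul_assoc]
  simp_rw [e2]
  rw [lintegral_mul_const _ (by fun_prop), h]; ring

lemma star_aux (hk : Measurable k) (t : ℝ) :
    ∫⁻ u : ℝ, ∫⁻ v : ℝ, k (t - v) * k (u - v) * ∫⁻ x : ℝ, k x = (∫⁻ x : ℝ, k x) ^ 3 := by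
  have h : ∀ c : ℝ, ∫⁻ w : ℝ, k (c - w) = ∫⁻ x : ℝ, k x := fun c => lintegral_sub_left_eq_self k c
  have h' : ∀ c : ℝ, ∫⁻ w : ℝ, k (w - c) = ∫⁻ x : ℝ, k x := fun c => lintegral_sub_right_eq_self k c
  rw [lintegral_lintegral_swap (by apply Measurable.aemeasurable; unfold Function.uncurry; fun_prop)]
  have e2 : ∀ v : ℝ, ∫⁻ u : ℝ, k (t - v) * k (u - v) * ∫⁻ x : ℝ, k x
      = k (t - v) * ((∫⁻ x : ℝ, k x) * ∫⁻ x : ℝ, k x) := by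
    intro u; rw [lintegral_mul_const _ (by fun_prop), lintegral_const_mul _ (by fun_prop), h', mul_assoc]
  simp_rw [e2]
  rw [lintegral_mul_const _ (by fun_prop), h]; ring

lemma star_v (hk : Measurable k) (t : ℝ) :
    ∫⁻ u : ℝ, ∫⁻ v : ℝ, ∫⁻ w : ℝ, k (t - v) * k (u - v) * k (v - w) = (∫⁻ x : ℝ, k x) ^ 3 := by
  have h : ∀ c : ℝ, ∫⁻ w : ℝ, k (c - w) = ∫⁻ x : ℝ, k x := fun c => lintegral_sub_left_eq_self k c
  have e1 : ∀ u v : ℝ, ∫⁻ w : ℝ, k (t - v) * k (u - v) * k (v - w) = k (t - v) * k (u - v) * ∫⁻ x : ℝ, k x := by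
    intro u v; rw [lintegral_const_mul _ (by fun_prop), h]
  simp_rw [e1]
  exact star_aux hk t

lemma star_w (hk : Measurable k) (t : ℝ) :
    ∫⁻ u : ℝ, ∫⁻ v : ℝ, ∫⁻ w : ℝ, k (t - w) * k (u - w) * k (v - w) = (∫⁻ x : ℝ, k x) ^ 3 := by
  have h' : ∀ c : ℝ, ∫⁻ w : ℝ, k (w - c) = ∫⁻ x : ℝ, k x := fun c => lintegral_sub_right_eq_self k c
  have e0 : ∀ u : ℝ, ∫⁻ v : ℝ, ∫⁻ w : ℝ, k (t - w) * k (u - w) * k (v - w)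
      = ∫⁻ w : ℝ, k (t - w) * k (u - w) * ∫⁻ x : ℝ, k x := by
    intro u
    rw [lintegral_lintegral_swap (by apply Measurable.aemeasurable; unfold Function.uncurry; fun_prop)]
    refine lintegral_congr fun w => ?_
    rw [lintegral_const_mul _ (by fun_prop), h']
  simp_rw [e0]
  exact star_aux hk t

lemma four_star_sum (hk : Measurable k) (t : ℝ) :
    ∫⁻ x : ℝ × ℝ × ℝ, (k (t - x.1) * k (t - x.2.1) * k (t - x.2.2) +
      k (t - x.1) * k (x.1 - x.2.1) * k (x.1 - x.2.2) +
      k (t - x.2.1) * k (x.1 - x.2.1) * k (x.2.1 - x.2.2) +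
      k (t - x.2.2) * k (x.1 - x.2.2) * k (x.2.1 - x.2.2)) = 4 * (∫⁻ x : ℝ, k x) ^ 3 := by
  rw [lintegral_add_left (by fun_prop), lintegral_add_left (by fun_prop), lintegral_add_left (by fun_prop)]
  have hp : ∀ f : ℝ × ℝ × ℝ → ENNReal, Measurable f →
      ∫⁻ x, f x = ∫⁻ u : ℝ, ∫⁻ v : ℝ, ∫⁻ w : ℝ, f (u, v, w) := by
    intro f hf
    rw [Measure.volume_eq_prod, lintegral_prod _ hf.aemeasurable]
    refine lintegral_congr fun u => ?_
    rw [Measure.volume_eq_prod, lintegral_prod _ (by apply Measurable.aemeasurable; fun_prop)]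
  rw [hp _ (by fun_prop), hp _ (by fun_prop), hp _ (by fun_prop), hp _ (by fun_prop)]
  simp only
  rw [star_t hk, star_u hk, star_v hk, star_w hk]
  ring

end starint

/-- The logarithm of the normalised distance. -/
noncomputable def lgd (L x : ℝ) : ℝ := Real.log (L * |x| + 1)

lemma lgd_nonneg {L : ℝ} (hL : 0 ≤ L) (x : ℝ) : 0 ≤ lgd L x :=
  Real.log_nonneg (by have := mul_nonneg hL (abs_nonneg x); linarith)

@[fun_prop]
lemma lgd_measurable (L : ℝ) : Measurable (lgd L) := by unfold lgd; fun_prop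

lemma kernel_integral {p : ℝ} (hp : 1 < p) : ∃ A : ℝ, 0 ≤ A ∧ ∀ L : ℝ, 0 < L →
    ∫⁻ x : ℝ, ENNReal.ofReal (Real.exp (-p * lgd L x)) = ENNReal.ofReal (A / L) := by
  have hfin := finite_integral_one_add_norm (E := ℝ) (μ := volume) (r := p) (by simpa using hp)
  refine ⟨(∫⁻ x : ℝ, ENNReal.ofReal ((1 + ‖x‖) ^ (-p))).toReal, ENNReal.toReal_nonneg, fun L hL => ?_⟩
  have e : ∀ x : ℝ, ENNReal.ofReal (Real.exp (-p * lgd L x)) =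
      (fun y : ℝ => ENNReal.ofReal ((1 + ‖y‖) ^ (-p))) (L * x) := by
    intro x
    simp only
    rw [Real.norm_eq_abs, abs_mul, abs_of_pos hL, Real.rpow_def_of_pos (by positivity), lgd]
    congr 2; rw [add_comm 1]; ring
  simp_rw [e]
  rw [← lintegral_map (f := fun y : ℝ => ENNReal.ofReal ((1 + ‖y‖) ^ (-p))) (g := fun x => L * x)
    (by fun_prop) (by fun_prop), Real.map_volume_mul_left hL.ne', lintegral_smul_measure,
    div_eq_inv_mul, ENNReal.ofReal_mul (by positivity), ENNReal.ofReal_toReal hfin.ne,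
    abs_of_pos (by positivity)]
  rfl

lemma avg_exp_le {w0 w1 a b c d : ℝ} (h0 : 0 ≤ w0) (h1 : 0 ≤ w1) (hs : w0 + 3 * w1 = 1) :
    Real.exp (w0 * a + w1 * b + w1 * c + w1 * d) ≤
      Real.exp a + Real.exp b + Real.exp c + Real.exp d := by
  set m := max (max a b) (max c d) with hm
  have ha : a ≤ m := by simp [hm]
  have hb : b ≤ m := by simp [hm]
  have hc : c ≤ m := by simp [hm]
  have hd : d ≤ m := by simp [hm]
  have : w0 * a + w1 * b + w1 * c + w1 * d ≤ m := by
    have := mul_le_mul_of_nonneg_left ha h0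
    have := mul_le_mul_of_nonneg_left hb h1
    have := mul_le_mul_of_nonneg_left hc h1
    have := mul_le_mul_of_nonneg_left hd h1
    have : m = w0 * m + w1 * m + w1 * m + w1 * m := by linear_combination (-m) * hs
    linarith
  refine (Real.exp_le_exp.2 this).trans ?_
  have := Real.exp_pos a
  have := Real.exp_pos b
  have := Real.exp_pos c
  have := Real.exp_pos d
  rcases max_choice (max a b) (max c d) with h | h <;> rw [hm, h]
  · rcases max_choice a b with h | h <;> rw [h] <;> linarith
  · rcases max_choice c d with h | h <;> rw [h] <;> linarith

/-- Sum of log distances from `t` to the coordinates of `x`. -/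
noncomputable def S1 (L t : ℝ) (x : ℝ × ℝ × ℝ) : ℝ :=
  lgd L (t - x.1) + lgd L (t - x.2.1) + lgd L (t - x.2.2)

/-- Sum of mutual log distances of the coordinates of `x`. -/
noncomputable def S2 (L : ℝ) (x : ℝ × ℝ × ℝ) : ℝ :=
  lgd L (x.1 - x.2.1) + lgd L (x.1 - x.2.2) + lgd L (x.2.1 - x.2.2)

lemma star_integral {p : ℝ} (hp : 1 < p) : ∃ A : ℝ, 0 ≤ A ∧ ∀ L s e1 e2 t : ℝ, 0 < L → 0 ≤ s → s ≤ 2 / 3 →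
    (1 - s) * p ≤ e1 → s * p ≤ e2 →
    ∫⁻ x : ℝ × ℝ × ℝ, ENNReal.ofReal (Real.exp (-e1 * S1 L t x - e2 * S2 L x)) ≤ ENNReal.ofReal (A / L ^ 3) := by
  obtain ⟨A, hA, h⟩ := kernel_integral hp
  refine ⟨4 * A ^ 3, by positivity, fun L s e1 e2 t hL hs0 hs h1 h2 => ?_⟩
  have hm : Measurable fun x : ℝ => ENNReal.ofReal (Real.exp (-p * lgd L x)) := by fun_prop
  have hst := four_star_sum hm t
  rw [h L hL] at hst
  have e : ENNReal.ofReal (4 * A ^ 3 / L ^ 3) = 4 * ENNReal.ofReal (A / L) ^ 3 := by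
    rw [← ENNReal.ofReal_pow (by positivity), mul_div_assoc, ENNReal.ofReal_mul (by norm_num), div_pow]
    norm_num
  rw [e, ← hst]
  refine lintegral_mono fun x => ?_
  simp only [← ENNReal.ofReal_mul (Real.exp_pos _).le, ← Real.exp_add]
  rw [← ENNReal.ofReal_add (by positivity) (by positivity),
    ← ENNReal.ofReal_add (by positivity) (by positivity),
    ← ENNReal.ofReal_add (by positivity) (by positivity)]
  refine ENNReal.ofReal_le_ofReal ?_
  refine le_trans (Real.exp_le_exp.2 ?_) (avg_exp_le (w0 := 1 - 3 * (s / 2)) (w1 := s / 2) (by linarith)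
    (by linarith) (by ring))
  have i1 : 0 ≤ S1 L t x := by
    unfold S1
    have := lgd_nonneg hL.le (t - x.1)
    have := lgd_nonneg hL.le (t - x.2.1)
    have := lgd_nonneg hL.le (t - x.2.2)
    linarith
  have i2 : 0 ≤ S2 L x := by
    unfold S2
    have := lgd_nonneg hL.le (x.1 - x.2.1)
    have := lgd_nonneg hL.le (x.1 - x.2.2)
    have := lgd_nonneg hL.le (x.2.1 - x.2.2)
    linarith
  have j1 := mul_le_mul_of_nonneg_right h1 i1
  have j2 := mul_le_mul_of_nonneg_right h2 i2
  refine le_trans (b := -((1 - s) * p * S1 L t x) - s * p * S2 L x) (by linarith) (le_of_eq ?_)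
  unfold S1 S2
  ring

open MeasureTheory

lemma lintegral_cube {g : ℝ → ENNReal} (hg : Measurable g) :
    ∫⁻ x : ℝ × ℝ × ℝ, g x.1 * (g x.2.1 * g x.2.2) = (∫⁻ t, g t) ^ 3 := by
  rw [Measure.volume_eq_prod, lintegral_prod_mul (f := g) (g := fun y : ℝ × ℝ => g y.1 * g y.2)
    hg.aemeasurable (by apply Measurable.aemeasurable; fun_prop), Measure.volume_eq_prod,
    lintegral_prod_mul (f := g) (g := g) hg.aemeasurable hg.aemeasurable]
  ring

lemma holder_star {κ : ℝ} (hκ : 1 < κ) {g : ℝ → ENNReal} (hg : Measurable g)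
    {E : ℝ × ℝ × ℝ → ℝ} (hE : Measurable E) {Z : ENNReal}
    (hZ : ∫⁻ x, ENNReal.ofReal (Real.exp (-(κ / (κ - 1)) * E x)) ≤ Z) :
    ((∫⁻ t, g t) ^ 3) ^ κ ≤ Z ^ (κ - 1) *
      ∫⁻ x : ℝ × ℝ × ℝ, (g x.1 * (g x.2.1 * g x.2.2)) ^ κ * ENNReal.ofReal (Real.exp (κ * E x)) := by
  have hκ0 : 0 < κ := by linarith
  have hκ1 : 0 < κ - 1 := by linarith
  have hpq : κ.HolderConjugate (κ / (κ - 1)) := by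
    simpa [Real.conjExponent] using Real.HolderConjugate.conjExponent hκ
  have hh := ENNReal.lintegral_mul_le_Lp_mul_Lq volume hpq
    (f := fun x : ℝ × ℝ × ℝ => g x.1 * (g x.2.1 * g x.2.2) * ENNReal.ofReal (Real.exp (E x)))
    (g := fun x => ENNReal.ofReal (Real.exp (- E x)))
    (by apply Measurable.aemeasurable; fun_prop) (by apply Measurable.aemeasurable; fun_prop)
  have e1 : ∫⁻ x : ℝ × ℝ × ℝ, ((fun x : ℝ × ℝ × ℝ => g x.1 * (g x.2.1 * g x.2.2) * ENNReal.ofReal (Real.exp (E x))) *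
      (fun x => ENNReal.ofReal (Real.exp (- E x)))) x = (∫⁻ t, g t) ^ 3 := by
    rw [← lintegral_cube hg]
    refine lintegral_congr fun x => ?_
    simp only [Pi.mul_apply]
    rw [mul_assoc, ← ENNReal.ofReal_mul (Real.exp_pos _).le, ← Real.exp_add]
    simp
  have e2 : ∀ x : ℝ × ℝ × ℝ, (g x.1 * (g x.2.1 * g x.2.2) * ENNReal.ofReal (Real.exp (E x))) ^ κ
      = (g x.1 * (g x.2.1 * g x.2.2)) ^ κ * ENNReal.ofReal (Real.exp (κ * E x)) := by
    intro x
    rw [ENNReal.mul_rpow_of_nonneg _ _ hκ0.le, ENNReal.ofReal_rpow_of_pos (Real.exp_pos _),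
      ← Real.exp_mul, mul_comm (E x)]
  have e3 : ∀ x : ℝ × ℝ × ℝ, ENNReal.ofReal (Real.exp (- E x)) ^ (κ / (κ - 1))
      = ENNReal.ofReal (Real.exp (-(κ / (κ - 1)) * E x)) := by
    intro x
    rw [ENNReal.ofReal_rpow_of_pos (Real.exp_pos _), ← Real.exp_mul]
    congr 2; ring
  rw [e1] at hh
  simp only [e2, e3] at hh
  have h3 := ENNReal.rpow_le_rpow hh hκ0.le
  refine h3.trans ?_
  rw [ENNReal.mul_rpow_of_nonneg _ _ hκ0.le, ← ENNReal.rpow_mul, ← ENNReal.rpow_mul, mul_comm]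
  have : 1 / κ * κ = 1 := by field_simp
  rw [this, ENNReal.rpow_one]
  have : 1 / (κ / (κ - 1)) * κ = κ - 1 := by field_simp
  rw [this]
  gcongr

lemma moment_holder {κ : ℝ} (hκ : 1 < κ) {g : ℝ → ENNReal} (hg : Measurable g)
    {E : ℝ → ℝ × ℝ × ℝ → ℝ} (hE : ∀ t, Measurable (E t)) {Z : ENNReal} (hZt : Z ≠ ⊤)
    (hZ : ∀ t, ∫⁻ x, ENNReal.ofReal (Real.exp (-(κ / (κ - 1)) * E t x)) ≤ Z) :
    (∫⁻ t, g t) ^ (1 + 3 * κ) ≤ Z ^ (κ - 1) * ∫⁻ t : ℝ, ∫⁻ x : ℝ × ℝ × ℝ,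
      g t * (g x.1 * (g x.2.1 * g x.2.2)) ^ κ * ENNReal.ofReal (Real.exp (κ * E t x)) := by
  have hκ0 : 0 < κ := by linarith
  have hκ1 : 0 < κ - 1 := by linarith
  have e : (∫⁻ t, g t) ^ (1 + 3 * κ) = ∫⁻ t, g t * ((∫⁻ t, g t) ^ 3) ^ κ := by
    rw [lintegral_mul_const _ hg, ENNReal.rpow_add_of_nonneg _ _ zero_le_one (by positivity),
      ENNReal.rpow_one, ENNReal.rpow_mul]
    norm_num
  rw [e, ← lintegral_const_mul' _ _ (ENNReal.rpow_ne_top_of_nonneg hκ1.le hZt)]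
  refine lintegral_mono fun t => ?_
  have := hE t
  refine (mul_le_mul_right (holder_star hκ hg this (hZ t)) _).trans (le_of_eq ?_)
  rw [mul_left_comm]
  congr 1
  rw [← lintegral_const_mul _ (by fun_prop)]
  refine lintegral_congr fun x => ?_
  ring

lemma log_inv_dist {L : ℝ} (hL : 0 < L) (x : ℝ) :
    Real.log (1 / (|x| + 1 / L)) = Real.log L - lgd L x := by
  have : |x| + 1 / L = (L * |x| + 1) / L := by field_simp
  have hp : 0 < L * |x| + 1 := by positivity
  rw [this, one_div_div, Real.log_div hL.ne' hp.ne', lgd]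

lemma lgd_zero (L : ℝ) : lgd L 0 = 0 := by simp [lgd]

lemma lgd_comm (L x y : ℝ) : lgd L (x - y) = lgd L (y - x) := by
  unfold lgd; rw [abs_sub_comm]

lemma GE_eq {L : ℝ} (hL : 0 < L) (κ t : ℝ) (x : ℝ × ℝ × ℝ) :
    GE ![1, κ, κ, κ] ![t, x.1, x.2.1, x.2.2] L =
      (1 + 3 * κ) ^ 2 / 4 * Real.log L - κ / 2 * S1 L t x - κ ^ 2 / 2 * S2 L x := by
  unfold GE S1 S2
  simp only [log_inv_dist hL, Fin.sum_univ_four]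
  simp only [Matrix.cons_val]
  simp only [sub_self, lgd_zero]
  rw [lgd_comm L x.1 t, lgd_comm L x.2.1 t, lgd_comm L x.2.2 t, lgd_comm L x.2.1 x.1,
    lgd_comm L x.2.2 x.1, lgd_comm L x.2.2 x.2.1]
  ring

lemma weight_bound {C : ℝ} (hC : 0 ≤ C) {N : ℕ} (hN : C / 2 ≤ N) (t : ℝ) :
    Real.exp (C * Real.log (2 + |t|)) ≤ Real.exp (C / 2 * Real.log 8) * (1 + t ^ 2) ^ N := by
  have h0 : 0 < 2 + |t| := by positivity
  have h1 : 2 * Real.log (2 + |t|) ≤ Real.log 8 + Real.log (1 + t ^ 2) := by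
    have : 2 * Real.log (2 + |t|) = Real.log ((2 + |t|) ^ 2) := by rw [Real.log_pow]; norm_num
    rw [this, ← Real.log_mul (by norm_num) (by positivity)]
    refine Real.log_le_log (by positivity) ?_
    nlinarith [sq_abs t, sq_nonneg (|t| - 2), sq_nonneg t]
  have h2 : 0 ≤ Real.log (1 + t ^ 2) := Real.log_nonneg (by nlinarith [sq_nonneg t])
  have h3 : (1 + t ^ 2) ^ N = Real.exp (N * Real.log (1 + t ^ 2)) := by
    rw [← Real.log_pow, Real.exp_log (by positivity)]
  rw [h3, ← Real.exp_add]
  refine Real.exp_le_exp.2 ?_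
  have h4 := mul_le_mul_of_nonneg_right hN h2
  have h5 := mul_le_mul_of_nonneg_left h1 (by positivity : 0 ≤ C / 2)
  linarith

lemma weight_bound' {C κ : ℝ} (hC : 0 ≤ C) (hκ : 1 ≤ κ) {N : ℕ} (hN : C / 2 ≤ N) (t : ℝ) :
    Real.exp (C * Real.log (2 + |t|)) * (((1 + t ^ 2) ^ (N + 1))⁻¹) ^ κ ≤
      Real.exp (C / 2 * Real.log 8) * (1 + t ^ 2)⁻¹ := by
  have hy : 1 ≤ 1 + t ^ 2 := by nlinarith [sq_nonneg t]
  have h1 : (((1 + t ^ 2) ^ (N + 1))⁻¹) ^ κ ≤ ((1 + t ^ 2) ^ (N + 1))⁻¹ := by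
    have := Real.rpow_le_rpow_of_exponent_ge (x := ((1 + t ^ 2) ^ (N + 1))⁻¹) (by positivity)
      (inv_le_one_of_one_le₀ (one_le_pow₀ hy)) hκ
    simpa using this
  calc _ ≤ Real.exp (C / 2 * Real.log 8) * (1 + t ^ 2) ^ N * ((1 + t ^ 2) ^ (N + 1))⁻¹ := by
        gcongr
        exact weight_bound hC hN t
    _ = _ := by
      have : (1 + t ^ 2) ≠ 0 := by positivity
      field_simp
      ring

open MeasureTheory

/-- The weighted value of the L-function near the critical line. -/
noncomputable def gL {q : ℕ} [NeZero q] (N : ℕ) (χ : DirichletCharacter ℂ q) (t : ℝ) : ENNReal :=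
  ENNReal.ofReal (‖DirichletCharacter.LFunction χ ⟨1 / 2 + 1 / Real.log q, t⟩‖ * ((1 + t ^ 2) ^ N)⁻¹)

lemma gL_measurable {q : ℕ} [NeZero q] (N : ℕ) {χ : DirichletCharacter ℂ q} (hχ : χ ≠ 1) :
    Measurable (gL N χ) := by
  unfold gL
  have h1 : Continuous fun t : ℝ => DirichletCharacter.LFunction χ ⟨1 / 2 + 1 / Real.log q, t⟩ := by
    have e : (fun t : ℝ => DirichletCharacter.LFunction χ ⟨1 / 2 + 1 / Real.log q, t⟩) =
        fun t : ℝ => DirichletCharacter.LFunction χ (((1 / 2 + 1 / Real.log q : ℝ) : ℂ) + t * I) := by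
      funext t; congr 1; exact Complex.mk_eq_add_mul_I _ _
    rw [e]
    exact (DirichletCharacter.differentiable_LFunction hχ).continuous.comp (by fun_prop)
  have := h1.norm.measurable
  exact (this.mul (by fun_prop)).ennreal_ofReal

lemma point_bound {κ : ℝ} (hκ : 1 < κ) : ∃ M : ℝ, 0 ≤ M ∧ ∃ (N q0 : ℕ), 1 ≤ N ∧
    ∀ (q : ℕ) [NeZero q], q0 ≤ q → 3 ≤ q → (∀ χ : DirichletCharacter ℂ q, dirichletRH χ) →
    ∀ R : Finset (DirichletCharacter ℂ q), (1 : DirichletCharacter ℂ q) ∉ R → ∀ (t : ℝ) (x : ℝ × ℝ × ℝ),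
    ∑ χ ∈ R, gL N χ t * (gL N χ x.1 * (gL N χ x.2.1 * gL N χ x.2.2)) ^ κ ≤
      ENNReal.ofReal (q.totient * M * Real.log q ^ ((1 + 3 * κ) ^ 2 / 4) * (1 + t ^ 2)⁻¹ *
        Real.exp (- (κ / 2) * S1 (Real.log q) t x - κ ^ 2 / 2 * S2 (Real.log q) x)) := by
  have hκ0 : 0 < κ := by linarith
  obtain ⟨C, hC, q0, hsm⟩ := shifted_moment ![1, κ, κ, κ] (by
    intro i; fin_cases i <;> simp <;> linarith)
  set B := Real.exp (C / 2 * Real.log 8) with hB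
  have hB0 : 0 < B := Real.exp_pos _
  refine ⟨Real.exp C * B ^ 4, by positivity, ⌈C / 2⌉₊ + 1, q0, by omega, ?_⟩
  intro q _ hq0 hq3 hRH R hR t x
  have hCN : C / 2 ≤ (⌈C / 2⌉₊ : ℝ) := Nat.le_ceil _
  set N := ⌈C / 2⌉₊
  have hq3' : (3:ℝ) ≤ q := by exact_mod_cast hq3
  set L := Real.log q with hL
  have hL1 : 1 ≤ L := by
    rw [hL, Real.le_log_iff_exp_le (by linarith)]
    linarith [Real.exp_one_lt_d9]
  have hL0 : 0 < L := by linarith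
  have hm := hsm q hq0 hRH ![t, x.1, x.2.1, x.2.2] R hR
  rw [← hL, GE_eq hL0] at hm
  simp only [Fin.prod_univ_four, Fin.sum_univ_four, Matrix.cons_val, Real.rpow_one] at hm
  set W : ℝ → ℝ := fun t => ((1 + t ^ 2) ^ (N + 1))⁻¹ with hW
  have hW0 : ∀ t, 0 ≤ W t := fun t => by simp only [hW]; positivity
  set f : DirichletCharacter ℂ q → ℝ → ℝ := fun χ t =>
    ‖DirichletCharacter.LFunction χ ⟨1 / 2 + 1 / L, t⟩‖ with hf
  have hf0 : ∀ χ t, 0 ≤ f χ t := fun χ t => norm_nonneg _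
  have e1 : ∀ χ ∈ R, gL (N + 1) χ t * (gL (N + 1) χ x.1 * (gL (N + 1) χ x.2.1 * gL (N + 1) χ x.2.2)) ^ κ =
      ENNReal.ofReal ((f χ t * f χ x.1 ^ κ * f χ x.2.1 ^ κ * f χ x.2.2 ^ κ) *
        (W t * W x.1 ^ κ * W x.2.1 ^ κ * W x.2.2 ^ κ)) := by
    intro χ _
    have hg : ∀ t, gL (N + 1) χ t = ENNReal.ofReal (f χ t * W t) := fun t => rfl
    have hn : ∀ t, 0 ≤ f χ t * W t := fun t => mul_nonneg (hf0 χ t) (hW0 t)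
    simp only [hg]
    rw [← ENNReal.ofReal_mul (hn _), ← ENNReal.ofReal_mul (hn _),
      ENNReal.ofReal_rpow_of_nonneg (mul_nonneg (hn _) (mul_nonneg (hn _) (hn _))) hκ0.le,
      ← ENNReal.ofReal_mul (hn _), Real.mul_rpow (hn _) (mul_nonneg (hn _) (hn _)),
      Real.mul_rpow (hn _) (hn _), Real.mul_rpow (hf0 _ _) (hW0 _), Real.mul_rpow (hf0 _ _) (hW0 _),
      Real.mul_rpow (hf0 _ _) (hW0 _)]
    congr 1; ring
  have hWp : 0 ≤ W t * W x.1 ^ κ * W x.2.1 ^ κ * W x.2.2 ^ κ := by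
    have := hW0 t
    have := hW0 x.1
    have := hW0 x.2.1
    have := hW0 x.2.2
    positivity
  rw [Finset.sum_congr rfl e1, ← ENNReal.ofReal_sum_of_nonneg, ← Finset.sum_mul]
  swap
  · intro χ _
    refine mul_nonneg ?_ hWp
    have := hf0 χ t
    have := hf0 χ x.1
    have := hf0 χ x.2.1
    have := hf0 χ x.2.2
    positivity
  refine ENNReal.ofReal_le_ofReal ?_
  have hb : ∀ t, Real.exp (C * Real.log (2 + |t|)) * W t ^ κ ≤ B := by
    intro t
    refine (weight_bound' hC hκ.le hCN t).trans ?_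
    have : (1 + t ^ 2)⁻¹ ≤ 1 := inv_le_one_of_one_le₀ (by nlinarith [sq_nonneg t])
    calc _ ≤ B * 1 := by gcongr
      _ = B := mul_one _
  have hbt : Real.exp (C * Real.log (2 + |t|)) * W t ≤ B * (1 + t ^ 2)⁻¹ := by
    have := weight_bound' (κ := 1) hC le_rfl hCN t
    rwa [Real.rpow_one] at this
  have hLp : L ^ ((1 + 3 * κ) ^ 2 / 4) = Real.exp ((1 + 3 * κ) ^ 2 / 4 * Real.log L) := by
    rw [Real.rpow_def_of_pos hL0, mul_comm]
  rw [hLp]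
  set X := Real.exp (- (κ / 2) * S1 L t x - κ ^ 2 / 2 * S2 L x) with hX
  set P := Real.exp ((1 + 3 * κ) ^ 2 / 4 * Real.log L) with hP
  have hsplit : Real.exp (C * (1 + (Real.log (2 + |t|) + Real.log (2 + |x.1|) + Real.log (2 + |x.2.1|)
      + Real.log (2 + |x.2.2|))) + ((1 + 3 * κ) ^ 2 / 4 * Real.log L - κ / 2 * S1 L t x - κ ^ 2 / 2 * S2 L x))
      = Real.exp C * Real.exp (C * Real.log (2 + |t|)) * Real.exp (C * Real.log (2 + |x.1|)) *
        Real.exp (C * Real.log (2 + |x.2.1|)) * Real.exp (C * Real.log (2 + |x.2.2|)) * P * X := by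
    rw [hP, hX]
    simp only [← Real.exp_add]
    congr 1; ring
  rw [hsplit] at hm
  have hWk : ∀ t, 0 ≤ W t ^ κ := fun t => Real.rpow_nonneg (hW0 t) _
  refine (mul_le_mul_of_nonneg_right hm hWp).trans ?_
  calc _ = (q.totient * Real.exp C * P * X) * ((Real.exp (C * Real.log (2 + |t|)) * W t) *
        (Real.exp (C * Real.log (2 + |x.1|)) * W x.1 ^ κ) *
        (Real.exp (C * Real.log (2 + |x.2.1|)) * W x.2.1 ^ κ) *
        (Real.exp (C * Real.log (2 + |x.2.2|)) * W x.2.2 ^ κ)) := by ring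
    _ ≤ (q.totient * Real.exp C * P * X) * ((B * (1 + t ^ 2)⁻¹) * B * B * B) := by
      have := hWk x.1
      have := hWk x.2.1
      have := hWk x.2.2
      have := hW0 t
      gcongr
      · exact hb _
      · exact hb _
      · exact hb _
    _ = _ := by ring

open MeasureTheory

lemma S1_meas (L : ℝ) : Measurable fun y : ℝ × (ℝ × ℝ × ℝ) => S1 L y.1 y.2 := by
  unfold S1; fun_prop

lemma S2_meas (L : ℝ) : Measurable (S2 L) := by
  unfold S2; fun_prop

set_option maxHeartbeats 1000000 in
theorem large_q (k : ℝ) (hk : 2 < k) : ∃ C : ℝ, 0 ≤ C ∧ ∃ q0 : ℕ, ∀ (q : ℕ) [NeZero q], q0 ≤ q →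
    (∀ χ : DirichletCharacter ℂ q, dirichletRH χ) → ∀ R : Finset (DirichletCharacter ℂ q),
    (∀ χ ∈ R, χ (-1) = -1) →
    ∑ χ ∈ R, ‖dirichletTheta χ 1‖ ^ (2 * k) ≤
      C * (Nat.totient q) * (q : ℝ) ^ (3 * k / 2) * Real.log q ^ ((k - 1) ^ 2) := by
  obtain ⟨κ, hκdef⟩ : ∃ κ : ℝ, κ = (2 * k - 1) / 3 := ⟨_, rfl⟩
  have hκ : 1 < κ := by rw [hκdef]; linarith
  have h2k : 2 * k = 1 + 3 * κ := by rw [hκdef]; ring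
  have hκ0 : 0 < κ := by linarith
  have hκ1 : 0 < κ - 1 := by linarith
  obtain ⟨M, hM, N, q0, hN, hpt⟩ := point_bound hκ
  obtain ⟨K, hK, hth⟩ := theta_bound N hN
  set η : ℝ := min (1 / 16) ((κ ^ 2 - κ) / 12) with hη
  have hη0 : 0 < η := lt_min (by norm_num) (by nlinarith)
  have hη1 : η ≤ 1 / 16 := min_le_left _ _
  have hη2 : η ≤ (κ ^ 2 - κ) / 12 := min_le_right _ _
  set α : ℝ := ((κ - 1) / 2 + η) / κ with hα
  have hκα : κ * α = (κ - 1) / 2 + η := by rw [hα]; field_simp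
  set eZ : ℝ := κ / (κ - 1) * α with heZ
  have heZ' : eZ = 1 / 2 + η / (κ - 1) := by
    rw [heZ, div_mul_eq_mul_div, hκα]; field_simp
  have hpZ : 1 < 2 * eZ := by
    rw [heZ']; have : 0 < η / (κ - 1) := by positivity
    linarith
  obtain ⟨AZ, hAZ, hZ⟩ := star_integral hpZ
  set pM : ℝ := (1 - 2 * η) / (1 - 4 * η) with hpM
  have h4η : 0 < 1 - 4 * η := by linarith
  have hpM1 : 1 < pM := by rw [hpM, lt_div_iff₀ h4η]; linarith
  obtain ⟨AM, hAM, hMi⟩ := star_integral hpM1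
  refine ⟨K ^ (2 * k) * AZ ^ (κ - 1) * M * π * AM, by positivity, max q0 3, ?_⟩
  intro q _ hq hRH R hR
  have hq0 : q0 ≤ q := (le_max_left _ _).trans hq
  have hq3 : 3 ≤ q := (le_max_right _ _).trans hq
  have hq3' : (3:ℝ) ≤ q := by exact_mod_cast hq3
  have hqp : (0:ℝ) < q := by linarith
  set L := Real.log q with hL
  have hL1 : 1 ≤ L := by
    rw [hL, Real.le_log_iff_exp_le (by linarith)]
    linarith [Real.exp_one_lt_d9]
  have hL0 : 0 < L := by linarith
  have hne : ∀ χ ∈ R, χ ≠ 1 := fun χ h => odd_ne_one (hR χ h)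
  have h1R : (1 : DirichletCharacter ℂ q) ∉ R := fun h => hne 1 h rfl
  set E : ℝ → ℝ × ℝ × ℝ → ℝ := fun t x => α * (S1 L t x + S2 L x) with hE
  have hS1 := S1_meas L
  have hS2 := S2_meas L
  have hS2' : Measurable fun y : ℝ × (ℝ × ℝ × ℝ) => S2 L y.2 := hS2.comp measurable_snd
  have hEu : Measurable fun y : ℝ × (ℝ × ℝ × ℝ) => E y.1 y.2 := by
    simp only [hE]; fun_prop
  have hEm : ∀ t, Measurable (E t) := fun t => hEu.comp measurable_prodMk_left
  set Z : ENNReal := ENNReal.ofReal (AZ / L ^ 3) with hZdef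
  have hZb : ∀ t, ∫⁻ x, ENNReal.ofReal (Real.exp (-(κ / (κ - 1)) * E t x)) ≤ Z := by
    intro t
    have := hZ L (1 / 2) eZ eZ t hL0 (by norm_num) (by norm_num) (by linarith) (by linarith)
    refine le_trans (le_of_eq (lintegral_congr fun x => ?_)) this
    congr 2
    simp only [hE, heZ]; ring
  set P : ℝ := L ^ ((1 + 3 * κ) ^ 2 / 4) with hP
  have hP0 : 0 ≤ P := Real.rpow_nonneg hL0.le _
  set T : ℝ := q.totient * M * P with hT
  have hT0 : 0 ≤ T := by positivity
  -- bound for the sum of integrals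
  have hsum : ∑ χ ∈ R, (∫⁻ t, gL N χ t) ^ (1 + 3 * κ) ≤
      Z ^ (κ - 1) * ENNReal.ofReal (T * (AM / L ^ 3) * π) := by
    calc _ ≤ ∑ χ ∈ R, Z ^ (κ - 1) * ∫⁻ t : ℝ, ∫⁻ x : ℝ × ℝ × ℝ,
          gL N χ t * (gL N χ x.1 * (gL N χ x.2.1 * gL N χ x.2.2)) ^ κ *
            ENNReal.ofReal (Real.exp (κ * E t x)) :=
          Finset.sum_le_sum fun χ hχ => moment_holder hκ (gL_measurable N (hne χ hχ)) hEm
            ENNReal.ofReal_ne_top hZb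
      _ = Z ^ (κ - 1) * ∫⁻ t : ℝ, ∫⁻ x : ℝ × ℝ × ℝ, ∑ χ ∈ R,
          gL N χ t * (gL N χ x.1 * (gL N χ x.2.1 * gL N χ x.2.2)) ^ κ *
            ENNReal.ofReal (Real.exp (κ * E t x)) := by
        rw [← Finset.mul_sum]
        congr 1
        have hmeas : ∀ χ ∈ R, Measurable fun y : ℝ × (ℝ × ℝ × ℝ) =>
            gL N χ y.1 * (gL N χ y.2.1 * (gL N χ y.2.2.1 * gL N χ y.2.2.2)) ^ κ *
            ENNReal.ofReal (Real.exp (κ * E y.1 y.2)) := by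
          intro χ hχ
          have := gL_measurable N (hne χ hχ)
          fun_prop
        rw [← lintegral_finsetSum' _ (fun χ hχ => (hmeas χ hχ).lintegral_prod_right'.aemeasurable)]
        refine lintegral_congr fun t => ?_
        exact (lintegral_finsetSum' (μ := volume) R
          (fun χ hχ => ((hmeas χ hχ).comp measurable_prodMk_left).aemeasurable)).symm
      _ ≤ Z ^ (κ - 1) * ∫⁻ t : ℝ, ∫⁻ x : ℝ × ℝ × ℝ, ENNReal.ofReal (T * (1 + t ^ 2)⁻¹) *
          ENNReal.ofReal (Real.exp (-(1 / 2 - η) * S1 L t x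
            - (κ ^ 2 / 2 - (κ - 1) / 2 - η) * S2 L x)) := by
        refine mul_le_mul_right (lintegral_mono fun t => lintegral_mono fun x => ?_) _
        rw [← Finset.sum_mul]
        refine (mul_le_mul_left (hpt q hq0 hq3 hRH R h1R t x) _).trans (le_of_eq ?_)
        rw [← hL, ← hP, ← hT, ENNReal.ofReal_mul (by positivity), mul_assoc]
        congr 1
        rw [← ENNReal.ofReal_mul (by positivity), ← Real.exp_add]
        congr 2
        simp only [hE]
        linear_combination (S1 L t x + S2 L x) * hκα
      _ ≤ Z ^ (κ - 1) * ∫⁻ t : ℝ, ENNReal.ofReal (T * (1 + t ^ 2)⁻¹) * ENNReal.ofReal (AM / L ^ 3) := by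
        refine mul_le_mul_right (lintegral_mono fun t => ?_) _
        rw [lintegral_const_mul' _ _ ENNReal.ofReal_ne_top]
        refine mul_le_mul_right (hMi L (1 / 2 + 2 * η) _ _ t hL0 (by linarith) (by linarith) ?_ ?_) _
        · rw [hpM, mul_div_assoc', div_le_iff₀ h4η]; refine le_of_eq ?_; ring
        · rw [hpM, mul_div_assoc', div_le_iff₀ h4η]
          nlinarith
      _ = _ := by
        congr 1
        rw [lintegral_mul_const' _ _ ENNReal.ofReal_ne_top,
          ← ofReal_integral_eq_lintegral_ofReal (integrable_inv_one_add_sq.const_mul T)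
            (Filter.Eventually.of_forall fun t => by positivity),
          integral_const_mul, integral_univ_inv_one_add_sq, ← ENNReal.ofReal_mul (by positivity)]
        congr 1; ring
  have hth' : ∀ χ ∈ R, ENNReal.ofReal (‖dirichletTheta χ 1‖ ^ (2 * k)) ≤
      ENNReal.ofReal ((K * (q:ℝ) ^ (3 / 4 : ℝ)) ^ (2 * k)) * (∫⁻ t, gL N χ t) ^ (1 + 3 * κ) := by
    intro χ hχ
    have h := hth q hq3 χ (hR χ hχ)
    rw [← ENNReal.ofReal_rpow_of_nonneg (norm_nonneg _) (by linarith),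
      ← ENNReal.ofReal_rpow_of_nonneg (by positivity) (by linarith), ← h2k,
      ← ENNReal.mul_rpow_of_nonneg _ _ (by linarith)]
    exact ENNReal.rpow_le_rpow h (by linarith)
  have hfin : ENNReal.ofReal (∑ χ ∈ R, ‖dirichletTheta χ 1‖ ^ (2 * k)) ≤
      ENNReal.ofReal ((K * (q:ℝ) ^ (3 / 4 : ℝ)) ^ (2 * k) *
        ((AZ / L ^ 3) ^ (κ - 1) * (T * (AM / L ^ 3) * π))) := by
    rw [ENNReal.ofReal_sum_of_nonneg (fun χ _ => by positivity)]
    refine (Finset.sum_le_sum hth').trans ?_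
    rw [← Finset.mul_sum, ENNReal.ofReal_mul (by positivity), ENNReal.ofReal_mul (by positivity),
      ← ENNReal.ofReal_rpow_of_nonneg (by positivity) hκ1.le]
    exact mul_le_mul_right hsum _
  rw [ENNReal.ofReal_le_ofReal_iff (by positivity)] at hfin
  refine hfin.trans (le_of_eq ?_)
  rw [Real.mul_rpow hK.le (by positivity), ← Real.rpow_mul hqp.le,
    Real.div_rpow hAZ (by positivity), hT, hP]
  have ex1 : (3 / 4 : ℝ) * (2 * k) = 3 * k / 2 := by ring
  rw [ex1]
  have ex2 : L ^ ((1 + 3 * κ) ^ 2 / 4) = L ^ ((k - 1) ^ 2) * ((L ^ 3) ^ (κ - 1) * L ^ 3) := by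
    rw [← Real.rpow_natCast L 3, ← Real.rpow_mul hL0.le, ← Real.rpow_add hL0, ← Real.rpow_add hL0]
    congr 1
    rw [← h2k, hκdef]; push_cast; ring
  rw [ex2]
  have d1 : (L ^ 3) ^ (κ - 1) ≠ 0 := by positivity
  field_simp

theorem small_q (k : ℝ) (hk : 2 < k) (q : ℕ) [NeZero q] (hq : 1 < q) : ∃ C : ℝ, 0 ≤ C ∧
    ∀ R : Finset (DirichletCharacter ℂ q),
    ∑ χ ∈ R, ‖dirichletTheta χ 1‖ ^ (2 * k) ≤
      C * (Nat.totient q) * (q : ℝ) ^ (3 * k / 2) * Real.log q ^ ((k - 1) ^ 2) := by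
  have hq1 : (1:ℝ) < q := by exact_mod_cast hq
  have hL : 0 < Real.log q := Real.log_pos hq1
  have ht : (0:ℝ) < q.totient := by exact_mod_cast Nat.totient_pos.2 (by omega)
  set D : ℝ := (Nat.totient q) * (q : ℝ) ^ (3 * k / 2) * Real.log q ^ ((k - 1) ^ 2) with hD
  have hD0 : 0 < D := by positivity
  refine ⟨(∑ χ : DirichletCharacter ℂ q, ‖dirichletTheta χ 1‖ ^ (2 * k)) / D, by positivity, fun R => ?_⟩
  have : (∑ χ : DirichletCharacter ℂ q, ‖dirichletTheta χ 1‖ ^ (2 * k)) / D * (Nat.totient q) *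
      (q : ℝ) ^ (3 * k / 2) * Real.log q ^ ((k - 1) ^ 2) =
      ∑ χ : DirichletCharacter ℂ q, ‖dirichletTheta χ 1‖ ^ (2 * k) := by
    rw [mul_assoc, mul_assoc, ← mul_assoc (Nat.totient q : ℝ), ← hD]; field_simp
  rw [this]
  exact Finset.sum_le_sum_of_subset_of_nonneg (Finset.subset_univ _) fun _ _ _ => by positivity

open Classical in
theorem stmt2 (k : ℝ) (hk : 2 < k) :
    ∃ C : ℝ, 0 < C ∧ ∀ (q : ℕ) [NeZero q], 1 < q →
      (∀ χ : DirichletCharacter ℂ q, dirichletRH χ) →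
      ∑ χ ∈ Finset.univ.filter
          (fun χ : DirichletCharacter ℂ q => χ.IsPrimitive ∧ χ (-1) = -1),
        ‖dirichletTheta χ 1‖ ^ (2 * k)
      ≤ C * (Nat.totient q) * (q : ℝ) ^ (3 * k / 2) * Real.log q ^ ((k - 1) ^ 2) := by
  obtain ⟨C, hC, q0, h⟩ := large_q k hk
  have hs : ∀ q : ℕ, ∃ c : ℝ, 0 ≤ c ∧ ∀ [NeZero q], 1 < q → ∀ R : Finset (DirichletCharacter ℂ q),
      ∑ χ ∈ R, ‖dirichletTheta χ 1‖ ^ (2 * k) ≤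
      c * (Nat.totient q) * (q : ℝ) ^ (3 * k / 2) * Real.log q ^ ((k - 1) ^ 2) := by
    intro q
    by_cases hq : 1 < q
    · haveI : NeZero q := ⟨by omega⟩
      obtain ⟨c, hc, h⟩ := small_q k hk q hq
      exact ⟨c, hc, fun {_} _ R => h R⟩
    · exact ⟨0, le_rfl, fun h => absurd h hq⟩
  choose c hc0 hc using hs
  have hcs : 0 ≤ ∑ i ∈ Finset.range q0, c i := Finset.sum_nonneg fun i _ => hc0 i
  refine ⟨C + ∑ i ∈ Finset.range q0, c i + 1, by positivity, fun q _ hq hRH => ?_⟩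
  have hq1 : (1:ℝ) < q := by exact_mod_cast hq
  have hL : 0 < Real.log q := Real.log_pos hq1
  by_cases hlt : q0 ≤ q
  · refine (h q hlt hRH _ (fun χ hχ => (Finset.mem_filter.1 hχ).2.2)).trans ?_
    gcongr
    linarith
  · refine (hc q hq _).trans ?_
    have : c q ≤ ∑ i ∈ Finset.range q0, c i :=
      Finset.single_le_sum (f := c) (fun i _ => hc0 i) (Finset.mem_range.2 (by omega))
    gcongr
    linarith
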